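/- Let a : ℝ² → ℂ be smooth on R = (−a₀,a₀)×(−b₀,b₀) and L = ∂/∂y + a(x,y)∂/∂x be locally integrable at the origin. Let g be the solution of the ODE g′(y) = Re a(g(y), y), g(0) = 0, defined on [0, η) for some η > 0 (so that y ↦ (g(y), y) is the integral curve of X = Re L = ∂/∂y + (Re a)∂/∂x through the origin). Assume there is a sequence (y_n) with y_n > 0, y_n → 0, and Im a(g(y_n), y_n) ≠ 0 for every n (i.e., L is elliptic at the points p_n = (g(y_n), y_n)). Then there exists δ ∈ (0, a₀) such that every bounded measurable u on (−a₀,a₀)×(0,b₀) that satisfies Lu = 0 in the sense of distributions and whose weak boundary value bu satisfies ∫_{−δ}^{δ} ln|bu(x)| dx = −∞ must vanish almost everywhere on (−δ,δ)×(0,δ). -/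

import Mathlib

open MeasureTheory Set Filter Topology Complex

/-- Partial derivative in the `x` direction. -/
noncomputable def pdx (f : ℝ × ℝ → ℂ) (p : ℝ × ℝ) : ℂ := fderiv ℝ f p (1, 0)

/-- Partial derivative in the `y` direction. -/
noncomputable def pdy (f : ℝ × ℝ → ℂ) (p : ℝ × ℝ) : ℂ := fderiv ℝ f p (0, 1)

/-- `u` satisfies `Lu = 0` in the sense of distributions on `Ω`, where
`L = ∂/∂y + a ∂/∂x`. -/
def IsDistribSol (a u : ℝ × ℝ → ℂ) (Ω : Set (ℝ × ℝ)) : Prop :=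
  ∀ ψ : ℝ × ℝ → ℂ, ContDiff ℝ (⊤ : ℕ∞) ψ → HasCompactSupport ψ → tsupport ψ ⊆ Ω →
    ∫ p in Ω, u p * (pdy ψ p + pdx (fun q => a q * ψ q) p) = 0

/-- `L = ∂/∂y + a ∂/∂x` is locally integrable at the origin: there is a smooth
first integral `Z` near `(0,0)` with `LZ = 0` and `dZ(0,0) ≠ 0`. -/
def LocallyIntegrableAtOrigin (a : ℝ × ℝ → ℂ) : Prop :=
  ∃ U : Set (ℝ × ℝ), IsOpen U ∧ (0, 0) ∈ U ∧ ∃ Z : ℝ × ℝ → ℂ,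
    ContDiffOn ℝ (⊤ : ℕ∞) Z U ∧ (∀ p ∈ U, pdy Z p + a p * pdx Z p = 0) ∧
    fderiv ℝ Z (0, 0) ≠ 0

/-- `∫_s ln|f| dx = -∞`, with the convention `ln 0 = -∞`: either `f` vanishes on a
set of positive measure, or `max(-ln|f|, 0)` has infinite integral over `s`. -/
def LogIntegralNegInf (f : ℝ → ℂ) (s : Set ℝ) : Prop :=
  0 < volume {x ∈ s | f x = 0} ∨
    ∫⁻ x in s, ENNReal.ofReal (max (-Real.log ‖f x‖) 0) = ⊤

/-- A curve of class `C^{1,1}` in the complex plane whose velocity stays close to `1`. -/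
structure NiceCurve (γ γ' : ℝ → ℂ) (K : ℝ) : Prop where
  hasDerivAt : ∀ x, HasDerivAt γ (γ' x) x
  near_one : ∀ x, ‖γ' x - 1‖ ≤ 1 / 10
  lipschitz : ∀ x y, ‖γ' x - γ' y‖ ≤ K * |x - y|
  nonneg : 0 ≤ K

theorem differentiableOn_integral_kernel {X : Type*} [MetricSpace X] [MeasurableSpace X]
    [BorelSpace X] {μ : Measure X} {S : Set X} (hS : IsCompact S) {f : X → ℂ}
    (hf : IntegrableOn f S μ) {k k' : ℂ → X → ℂ} {Ω : Set ℂ} (hΩ : IsOpen Ω)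
    (hk : ∀ x ∈ S, ∀ z ∈ Ω, HasDerivAt (fun z => k z x) (k' z x) z)
    (hkc : ContinuousOn (fun p : ℂ × X => k p.1 p.2) (Ω ×ˢ S))
    (hkc' : ContinuousOn (fun p : ℂ × X => k' p.1 p.2) (Ω ×ˢ S)) :
    DifferentiableOn ℂ (fun z => ∫ x in S, f x * k z x ∂μ) Ω := by
  intro z₀ hz₀
  obtain ⟨r, hr, hrΩ⟩ := Metric.isOpen_iff.1 hΩ z₀ hz₀
  have hsub : Metric.closedBall z₀ (r / 2) ⊆ Ω :=
    (Metric.closedBall_subset_ball (by linarith)).trans hrΩ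
  obtain ⟨B, hB⟩ := ((isCompact_closedBall z₀ (r / 2)).prod hS).exists_bound_of_continuousOn
    (hkc'.mono (prod_mono hsub subset_rfl))
  have hsm : ∀ z ∈ Ω, AEStronglyMeasurable (fun x => k z x) (μ.restrict S) := by
    intro z hz
    refine ContinuousOn.aestronglyMeasurable ?_ hS.measurableSet
    exact hkc.comp (f := fun x : X => (z, x)) (by fun_prop) (fun x hx => ⟨hz, hx⟩)
  have hsm' : AEStronglyMeasurable (fun x => k' z₀ x) (μ.restrict S) := by
    refine ContinuousOn.aestronglyMeasurable ?_ hS.measurableSet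
    exact hkc'.comp (f := fun x : X => (z₀, x)) (by fun_prop) (fun x hx => ⟨hz₀, hx⟩)
  have h_int : Integrable (fun x => f x * k z₀ x) (μ.restrict S) := by
    obtain ⟨B', hB'⟩ := hS.exists_bound_of_continuousOn (f := fun x => k z₀ x)
      (hkc.comp (f := fun x : X => (z₀, x)) (by fun_prop) (fun x hx => ⟨hz₀, hx⟩))
    refine Integrable.mul_bdd (c := B') hf (hsm z₀ hz₀) ?_
    exact (ae_restrict_iff' hS.measurableSet).2 (ae_of_all _ hB')
  have := hasDerivAt_integral_of_dominated_loc_of_deriv_le (μ := μ.restrict S)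
    (F := fun z x => f x * k z x) (F' := fun z x => f x * k' z x) (x₀ := z₀)
    (s := Metric.ball z₀ (r / 2)) (bound := fun x => ‖f x‖ * B)
    (Metric.ball_mem_nhds _ (by linarith)) ?_ h_int ?_ ?_ ?_ ?_
  · exact this.2.differentiableAt.differentiableWithinAt
  · filter_upwards [hΩ.mem_nhds hz₀] with z hz
    exact hf.aestronglyMeasurable.mul (hsm z hz)
  · exact hf.aestronglyMeasurable.mul hsm'
  · refine (ae_restrict_iff' hS.measurableSet).2 (ae_of_all _ fun x hx z hz => ?_)
    rw [norm_mul]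
    exact mul_le_mul_of_nonneg_left (hB (z, x) ⟨Metric.ball_subset_closedBall hz, hx⟩)
      (norm_nonneg _)
  · exact hf.norm.mul_const B
  · refine (ae_restrict_iff' hS.measurableSet).2 (ae_of_all _ fun x hx z hz => ?_)
    exact (hk x hx z (hsub (Metric.ball_subset_closedBall hz))).const_mul _

namespace NiceCurve

variable {γ γ' : ℝ → ℂ} {K : ℝ}

theorem continuous (h : NiceCurve γ γ' K) : Continuous γ :=
  continuous_iff_continuousAt.2 fun x => (h.hasDerivAt x).continuousAt

theorem continuous_deriv (h : NiceCurve γ γ' K) : Continuous γ' := by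
  have : LipschitzWith ⟨K, h.nonneg⟩ γ' :=
    LipschitzWith.of_dist_le_mul fun x y => by
      rw [dist_eq_norm, Real.dist_eq]; exact h.lipschitz x y
  exact this.continuous

theorem norm_chord (h : NiceCurve γ γ' K) (x y : ℝ) :
    ‖γ x - γ y - (x - y : ℝ)‖ ≤ |x - y| / 10 := by
  have := convex_univ.norm_image_sub_le_of_norm_hasDerivWithin_le (s := (univ : Set ℝ))
    (f := fun t : ℝ => γ t - (t : ℂ)) (f' := fun t => γ' t - 1) (C := 1 / 10) (x := y) (y := x)
    (fun t _ => ((h.hasDerivAt t).sub (Complex.ofRealCLM.hasDerivAt (x := t))).hasDerivWithinAt)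
    (fun t _ => h.near_one t) (mem_univ _) (mem_univ _)
  simp only [Real.norm_eq_abs] at this
  calc _ = ‖γ x - (x : ℂ) - (γ y - (y : ℂ))‖ := by congr 1; push_cast; ring
    _ ≤ _ := this
    _ = _ := by ring

theorem norm_taylor (h : NiceCurve γ γ' K) (x y : ℝ) :
    ‖γ x - γ y - (x - y : ℝ) * γ' y‖ ≤ K * (x - y) ^ 2 := by
  have := (convex_uIcc y x).norm_image_sub_le_of_norm_hasDerivWithin_le
    (f := fun t : ℝ => γ t - (t : ℂ) * γ' y) (f' := fun t => γ' t - 1 * γ' y) (C := K * |x - y|)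
    (x := y) (y := x)
    (fun t _ => ((h.hasDerivAt t).sub
      ((Complex.ofRealCLM.hasDerivAt (x := t)).mul_const (γ' y))).hasDerivWithinAt)
    (fun t ht => by
      rw [one_mul]
      refine (h.lipschitz t y).trans (mul_le_mul_of_nonneg_left ?_ h.nonneg)
      exact abs_sub_left_of_mem_uIcc ht) left_mem_uIcc right_mem_uIcc
  simp only [Real.norm_eq_abs] at this
  calc _ = ‖γ x - (x : ℂ) * γ' y - (γ y - (y : ℂ) * γ' y)‖ := by congr 1; push_cast; ring
    _ ≤ _ := this
    _ = _ := by rw [mul_assoc, abs_mul_abs_self]; ring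

theorem norm_deriv_le (h : NiceCurve γ γ' K) (x : ℝ) : ‖γ' x‖ ≤ 11 / 10 := by
  have := norm_add_le (γ' x - 1) 1
  simp only [sub_add_cancel, norm_one] at this
  linarith [h.near_one x]

theorem norm_sub_le (h : NiceCurve γ γ' K) (x y : ℝ) : ‖γ x - γ y‖ ≤ 11 / 10 * |x - y| := by
  have := norm_add_le (γ x - γ y - (x - y : ℝ)) (x - y : ℝ)
  rw [sub_add_cancel, Complex.norm_real, Real.norm_eq_abs] at this
  linarith [h.norm_chord x y]

theorem le_norm_sub_add (h : NiceCurve γ γ' K) (x y σ : ℝ) :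
    81 / 100 * ((x - y) ^ 2 + σ ^ 2) ≤ ‖γ x - γ y + σ * I‖ ^ 2 := by
  have h1 : ‖((x - y : ℝ) : ℂ) + σ * I‖ ^ 2 = (x - y) ^ 2 + σ ^ 2 := by
    rw [Complex.sq_norm, Complex.normSq_add_mul_I]
  have h2 : |x - y| ≤ ‖((x - y : ℝ) : ℂ) + σ * I‖ := by
    have := Complex.abs_re_le_norm (((x - y : ℝ) : ℂ) + σ * I)
    simpa using this
  have h3 := norm_sub_le_norm_add (((x - y : ℝ) : ℂ) + σ * I) (γ x - γ y - (x - y : ℝ))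
  rw [show ((x - y : ℝ) : ℂ) + σ * I + (γ x - γ y - (x - y : ℝ)) = γ x - γ y + σ * I by ring] at h3
  have h4 := h.norm_chord x y
  have h5 : 9 / 10 * ‖((x - y : ℝ) : ℂ) + σ * I‖ ≤ ‖γ x - γ y + σ * I‖ := by linarith
  have := pow_le_pow_left₀ (by positivity) h5 2
  rw [mul_pow, h1] at this
  linarith

theorem re_kernel_le (h : NiceCurve γ γ' K) (x y : ℝ) {σ : ℝ} (hσ : 0 < σ) :
    (I * γ' y / (γ x - γ y + σ * I)).re ≤ 2 * K + 2 * σ / ((x - y) ^ 2 + σ ^ 2) := by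
  set w := γ x - γ y + σ * I with hw
  have hw2 := h.le_norm_sub_add x y σ
  rw [← hw] at hw2
  have hpos : 0 < (x - y) ^ 2 + σ ^ 2 := by positivity
  have hwpos : 0 < ‖w‖ ^ 2 := by linarith
  set e := γ x - γ y - (x - y : ℝ) * γ' y with he
  have hwe : w = (x - y : ℝ) * γ' y + e + σ * I := by rw [hw, he]; ring
  have hnum : (I * γ' y / w).re = ((e * (starRingEnd ℂ) (γ' y)).im + σ * (γ' y).re) / ‖w‖ ^ 2 := by
    rw [Complex.div_re, ← Complex.normSq_eq_norm_sq, ← add_div]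
    congr 1
    rw [hwe]
    simp
    ring
  rw [hnum, div_le_iff₀ hwpos]
  have h1 : (e * (starRingEnd ℂ) (γ' y)).im ≤ K * (x - y) ^ 2 * (11 / 10) := by
    refine (Complex.abs_im_le_norm _ |>.trans' (le_abs_self _)).trans ?_
    rw [norm_mul, Complex.norm_conj]
    exact mul_le_mul (h.norm_taylor x y) (h.norm_deriv_le y) (norm_nonneg _)
      (mul_nonneg h.nonneg (sq_nonneg _))
  have h2 : σ * (γ' y).re ≤ σ * (11 / 10) :=
    mul_le_mul_of_nonneg_left ((Complex.re_le_norm _).trans (h.norm_deriv_le y)) hσ.le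
  have h3 : (2 * K + 2 * σ / ((x - y) ^ 2 + σ ^ 2)) * (81 / 100 * ((x - y) ^ 2 + σ ^ 2)) ≤
      (2 * K + 2 * σ / ((x - y) ^ 2 + σ ^ 2)) * ‖w‖ ^ 2 := by
    refine mul_le_mul_of_nonneg_left hw2 ?_
    have := h.nonneg
    positivity
  have h4 : (2 * K + 2 * σ / ((x - y) ^ 2 + σ ^ 2)) * (81 / 100 * ((x - y) ^ 2 + σ ^ 2)) =
      162 / 100 * K * ((x - y) ^ 2 + σ ^ 2) + 162 / 100 * σ := by
    field_simp
    ring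
  have h5 := mul_nonneg h.nonneg (sq_nonneg (x - y))
  have h6 := mul_nonneg h.nonneg (sq_nonneg σ)
  nlinarith

theorem strictMono_re (h : NiceCurve γ γ' K) : StrictMono fun x => (γ x).re := by
  intro x y hxy
  have h1 := (Complex.abs_re_le_norm _).trans (h.norm_chord y x)
  rw [abs_of_pos (sub_pos.2 hxy)] at h1
  have h2 := (abs_le.1 h1).1
  simp at h2 ⊢
  linarith

theorem surjective_re (h : NiceCurve γ γ' K) : Function.Surjective fun x => (γ x).re := by
  have hb : ∀ x : ℝ, |(γ x).re - (γ 0).re - x| ≤ |x| / 10 := fun x => by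
    have := (Complex.abs_re_le_norm _).trans (h.norm_chord x 0)
    simpa using this
  refine (Complex.continuous_re.comp h.continuous).surjective ?_ ?_
  · refine tendsto_atTop_mono' atTop (f₁ := fun x : ℝ => (γ 0).re + x * (9 / 10)) ?_ ?_
    · filter_upwards [eventually_ge_atTop 0] with x hx
      have := (abs_le.1 (hb x)).1
      rw [abs_of_nonneg hx] at this
      simp
      linarith
    · exact tendsto_atTop_add_const_left _ _ (tendsto_id.atTop_mul_const (by norm_num))
  · refine tendsto_atBot_mono' atBot (f₂ := re ∘ γ) (f₁ := fun x : ℝ => (γ 0).re + x * (9 / 10)) ?_ ?_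
    · filter_upwards [eventually_le_atBot 0] with x hx
      have := (abs_le.1 (hb x)).2
      rw [abs_of_nonpos hx] at this
      simp
      linarith
    · exact tendsto_atBot_add_const_left _ _ (tendsto_id.atBot_mul_const (by norm_num))

/-- The image of a nice curve is the graph of a continuous function. -/
theorem exists_graph (h : NiceCurve γ γ' K) :
    ∃ ψ : ℝ → ℝ, Continuous ψ ∧ (∀ x, ψ (γ x).re = (γ x).im) ∧
      ∀ z : ℂ, ∃ x : ℝ, z = γ x + ((z.im - ψ z.re : ℝ) : ℂ) * I := by
  let e := h.strictMono_re.orderIsoOfSurjective _ h.surjective_re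
  have he : ∀ x, e x = (γ x).re := fun x => rfl
  refine ⟨fun s => (γ (e.symm s)).im, ?_, fun x => ?_, fun z => ⟨e.symm z.re, ?_⟩⟩
  · exact Complex.continuous_im.comp (h.continuous.comp e.symm.continuous)
  · simp only [← he, OrderIso.symm_apply_apply]
  · have : (γ (e.symm z.re)).re = z.re := by rw [← he, OrderIso.apply_symm_apply]
    apply Complex.ext <;> simp [this]

end NiceCurve

theorem integrable_poisson (x : ℝ) {σ : ℝ} (hσ : 0 < σ) :
    Integrable (fun t : ℝ => 2 * σ / ((x - t) ^ 2 + σ ^ 2)) := by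
  have h : (fun t : ℝ => 2 * σ / ((x - t) ^ 2 + σ ^ 2)) =
      fun t => 2 / σ * (1 + ((t - x) / σ) ^ 2)⁻¹ := by
    ext t
    have : (x - t) ^ 2 + σ ^ 2 ≠ 0 := by positivity
    have : (1 + ((t - x) / σ) ^ 2) ≠ 0 := by positivity
    field_simp
    ring
  rw [h]
  exact ((integrable_inv_one_add_sq.comp_div hσ.ne').comp_sub_right x).const_mul _

theorem integral_poisson (x : ℝ) {σ : ℝ} (hσ : 0 < σ) :
    ∫ t : ℝ, 2 * σ / ((x - t) ^ 2 + σ ^ 2) = 2 * Real.pi := by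
  have h : (fun t : ℝ => 2 * σ / ((x - t) ^ 2 + σ ^ 2)) =
      fun t => 2 / σ * (1 + ((t - x) / σ) ^ 2)⁻¹ := by
    ext t
    have : (x - t) ^ 2 + σ ^ 2 ≠ 0 := by positivity
    have : (1 + ((t - x) / σ) ^ 2) ≠ 0 := by positivity
    field_simp
    ring
  rw [h, integral_const_mul,
    integral_sub_right_eq_self (fun t : ℝ => (1 + (t / σ) ^ 2)⁻¹) x,
    Measure.integral_comp_div (fun t : ℝ => (1 + t ^ 2)⁻¹) σ, integral_univ_inv_one_add_sq,
    abs_of_pos hσ, smul_eq_mul]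
  field_simp

theorem setIntegral_poisson_le (x : ℝ) {σ : ℝ} (hσ : 0 < σ) (s : Set ℝ) :
    ∫ t in s, 2 * σ / ((x - t) ^ 2 + σ ^ 2) ≤ 2 * Real.pi := by
  rw [← integral_poisson x hσ]
  exact setIntegral_le_integral (integrable_poisson x hσ) (ae_of_all _ fun t => by positivity)

/-- The truncated logarithm `-log max(|f|, ε)`. -/
noncomputable def truncLog (ε : ℝ) (c : ℂ) : ℝ := -Real.log (max ‖c‖ ε)

theorem continuous_truncLog {ε : ℝ} (hε : 0 < ε) : Continuous (truncLog ε) := by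
  unfold truncLog
  refine (Continuous.log (by fun_prop) fun c => ?_).neg
  exact (hε.trans_le (le_max_right _ _)).ne'

theorem truncLog_nonneg {ε : ℝ} (hε : 0 < ε) (hε1 : ε ≤ 1) {c : ℂ} (hc : ‖c‖ ≤ 1) :
    0 ≤ truncLog ε c := by
  unfold truncLog
  have := Real.log_nonpos (hε.le.trans (le_max_right ‖c‖ ε)) (max_le hc hε1)
  linarith

theorem truncLog_le {ε : ℝ} (hε : 0 < ε) (c : ℂ) : truncLog ε c ≤ -Real.log ε := by
  unfold truncLog
  have := Real.log_le_log hε (le_max_right ‖c‖ ε)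
  linarith

theorem norm_le_exp_neg_truncLog {ε : ℝ} (hε : 0 < ε) (c : ℂ) :
    ‖c‖ ≤ Real.exp (-truncLog ε c) := by
  unfold truncLog
  rw [neg_neg, Real.exp_log (hε.trans_le (le_max_right _ _))]
  exact le_max_left _ _

theorem re_setIntegral_ofReal_mul {s : Set ℝ} (hs : IsCompact s) {f : ℝ → ℝ} {k : ℝ → ℂ}
    (hf : ContinuousOn f s) (hk : ContinuousOn k s) :
    (∫ x in s, (f x : ℂ) * k x).re = ∫ x in s, f x * (k x).re := by
  have h_int : IntegrableOn (fun x => (f x : ℂ) * k x) s :=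
    ContinuousOn.integrableOn_compact hs
      ((Complex.continuous_ofReal.comp_continuousOn hf).mul hk)
  have := Complex.reCLM.integral_comp_comm h_int
  simp only [Complex.reCLM_apply] at this
  rw [← this]
  refine integral_congr_ae (ae_of_all _ fun x => ?_)
  simp

/-- Harmonic measure estimate: a bounded holomorphic function above a nice curve which is small
in logarithmic mean along an arc of the curve is small at interior points. -/
theorem NiceCurve.norm_le_exp {γ γ' : ℝ → ℂ} {K : ℝ} (h : NiceCurve γ γ' K) (h0 : γ 0 = 0)
    {R κ δ ε : ℝ} (hR : 0 < R) (hκK : 2 * K ≤ κ) (hκR : 4 ≤ κ * R) (hδ : 0 < δ)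
    (hδκ : δ * (240 * κ) ≤ 1) (hε : 0 < ε) (hε1 : ε < 1) {E : ℂ → ℂ} (hE : Differentiable ℂ E)
    (hE1 : ∀ x t : ℝ, 0 ≤ t → ‖γ x + t * I‖ ≤ R → ‖E (γ x + t * I)‖ ≤ 1)
    {z₀ : ℂ} (hz₀ : ‖z₀ - (1 / (6 * κ) : ℝ) * I‖ ≤ 1 / (24 * κ)) :
    ‖E z₀‖ ≤ Real.exp (-(κ / (2 * Real.pi) * ∫ x in Icc (-δ) δ, truncLog ε (E (γ x)))) := by
  have hκ : 0 < κ := by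
    by_contra hneg
    nlinarith
  obtain ⟨ψ, hψc, hψ, hψx⟩ := h.exists_graph
  set w : ℝ → ℝ := fun x => truncLog ε (E (γ x)) with hw
  have hwc : Continuous w := (continuous_truncLog hε).comp (hE.continuous.comp h.continuous)
  have hπ := Real.pi_pos
  -- elementary bounds on the parameters
  set h₀ : ℝ := 1 / (6 * κ) with hh₀
  have hh₀pos : 0 < h₀ := by positivity
  have hκh : κ * h₀ = 1 / 6 := by rw [hh₀]; field_simp
  have h24 : 1 / (24 * κ) = h₀ / 4 := by rw [hh₀]; field_simp; norm_num
  rw [h24] at hz₀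
  have hδh : 40 * δ ≤ h₀ := by
    have : δ * (240 * κ) * h₀ ≤ 1 * h₀ := mul_le_mul_of_nonneg_right hδκ hh₀pos.le
    nlinarith
  have hRh : 24 * h₀ ≤ R := by
    have := mul_le_mul_of_nonneg_right hκR hh₀pos.le
    nlinarith
  have hγδ : ∀ x ∈ Icc (-δ) δ, ‖γ x‖ ≤ 11 / 10 * δ := fun x hx => by
    have := h.norm_sub_le x 0
    rw [h0, sub_zero, sub_zero] at this
    exact this.trans (mul_le_mul_of_nonneg_left (abs_le.2 hx) (by norm_num))
  have hw0 : ∀ x ∈ Icc (-δ) δ, 0 ≤ w x := fun x hx => by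
    have := hE1 x 0 le_rfl (by simp; linarith [hγδ x hx])
    simp only [ofReal_zero, zero_mul, add_zero] at this
    exact truncLog_nonneg hε hε1.le this
  set D : Set ℂ := {z | ‖z‖ < R ∧ ψ z.re < z.im} with hD
  have hDo : IsOpen D := (isOpen_lt continuous_norm continuous_const).inter
    (isOpen_lt (hψc.comp continuous_re) continuous_im)
  have hDcl : closure D ⊆ {z | ‖z‖ ≤ R ∧ ψ z.re ≤ z.im} := by
    refine closure_minimal (fun z hz => ⟨hz.1.le, hz.2.le⟩) ?_
    exact (isClosed_le continuous_norm continuous_const).inter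
      (isClosed_le (hψc.comp continuous_re) continuous_im)
  have hEcl : ∀ z : ℂ, ‖z‖ ≤ R → ψ z.re ≤ z.im → ‖E z‖ ≤ 1 := fun z hz hz' => by
    obtain ⟨x, hx⟩ := hψx z
    rw [hx] at hz ⊢
    exact hE1 x _ (sub_nonneg.2 hz') hz
  have hz₀D : z₀ ∈ D := by
    have hre := (Complex.abs_re_le_norm _).trans hz₀
    have him := (Complex.abs_im_le_norm _).trans hz₀
    simp at hre him
    have him' := (abs_le.1 him).1
    constructor
    · have := norm_add_le (z₀ - (h₀ : ℝ) * I) ((h₀ : ℝ) * I)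
      simp only [sub_add_cancel, norm_mul, norm_I, mul_one, Complex.norm_real, Real.norm_eq_abs,
        abs_of_pos hh₀pos] at this
      show ‖z₀‖ < R
      linarith
    · obtain ⟨x, hx⟩ := hψx z₀
      have hxre : z₀.re = (γ x).re := by
        have := congrArg Complex.re hx
        simpa using this
      have hch := h.norm_chord x 0
      rw [h0, sub_zero, sub_zero] at hch
      have hchr := (Complex.abs_re_le_norm _).trans hch
      have hchi := (Complex.abs_im_le_norm _).trans hch
      simp at hchr hchi
      show ψ z₀.re < z₀.im
      rw [hxre, hψ]
      rw [hxre] at hre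
      have e1 : |x| ≤ |(γ x).re| + |(γ x).re - x| := by
        have := abs_sub_abs_le_abs_sub x (γ x).re
        rw [abs_sub_comm x] at this
        linarith
      have := le_abs_self (γ x).im
      linarith
  have hEcont : ∀ σ : ℝ, 0 < σ → ∀ z : ℂ, ψ z.re < z.im + σ → ∀ x, z + σ * I - γ x ≠ 0 := by
    intro σ _ z hz x hzero
    have h1 : γ x = z + σ * I := (sub_eq_zero.1 hzero).symm
    have h2 := hψ x
    rw [h1] at h2
    simp at h2
    linarith
  -- the exponent of the auxiliary outer function
  set A : ℝ → ℂ → ℂ := fun σ z =>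
    ∫ x in Icc (-δ) δ, ((w x / (2 * Real.pi) : ℝ) : ℂ) * (I * γ' x / (z + σ * I - γ x) - κ) with hA
  have hAd : ∀ σ : ℝ, 0 < σ → DifferentiableOn ℂ (A σ) {z : ℂ | ψ z.re < z.im + σ} := by
    intro σ hσ
    refine differentiableOn_integral_kernel isCompact_Icc
      (k' := fun z x => -(I * γ' x) / (z + σ * I - γ x) ^ 2) ?_ ?_ ?_ ?_ ?_
    · exact Continuous.integrableOn_Icc (by fun_prop)
    · exact isOpen_lt (hψc.comp continuous_re) (continuous_im.add continuous_const)
    · intro x _ z hz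
      have hne := hEcont σ hσ z hz x
      have hd : HasDerivAt (fun z : ℂ => z + σ * I - γ x) 1 z :=
        ((hasDerivAt_id z).add_const _).sub_const _
      refine HasDerivAt.congr_deriv (f' := (0 * (z + σ * I - γ x) - I * γ' x * 1) /
        (z + σ * I - γ x) ^ 2) ?_ (by ring)
      exact ((hasDerivAt_const z (I * γ' x)).fun_div hd hne).sub_const (κ : ℂ)
    · refine ContinuousOn.sub (ContinuousOn.div ?_ ?_ ?_) continuousOn_const
      · exact (continuous_const.mul (h.continuous_deriv.comp continuous_snd)).continuousOn
      · exact ((continuous_fst.add continuous_const).sub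
          (h.continuous.comp continuous_snd)).continuousOn
      · rintro ⟨z, x⟩ ⟨hz, _⟩
        exact hEcont σ hσ z hz x
    · refine ContinuousOn.div ?_ ?_ ?_
      · exact (continuous_const.mul (h.continuous_deriv.comp continuous_snd)).neg.continuousOn
      · exact (((continuous_fst.add continuous_const).sub
          (h.continuous.comp continuous_snd)).pow 2).continuousOn
      · rintro ⟨z, x⟩ ⟨hz, _⟩
        exact pow_ne_zero 2 (hEcont σ hσ z hz x)
  have hkc : ∀ σ : ℝ, 0 < σ → ∀ z : ℂ, ψ z.re < z.im + σ →
      Continuous fun x => I * γ' x / (z + σ * I - γ x) - (κ : ℂ) := by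
    intro σ hσ z hz
    refine Continuous.sub (Continuous.div ?_ ?_ (hEcont σ hσ z hz)) continuous_const
    · exact continuous_const.mul h.continuous_deriv
    · exact continuous_const.sub h.continuous
  have hAre : ∀ σ : ℝ, 0 < σ → ∀ z : ℂ, ψ z.re < z.im + σ → (A σ z).re =
      ∫ x in Icc (-δ) δ, w x / (2 * Real.pi) * ((I * γ' x / (z + σ * I - γ x)).re - κ) := by
    intro σ hσ z hz
    rw [hA, re_setIntegral_ofReal_mul isCompact_Icc (by fun_prop) (hkc σ hσ z hz).continuousOn]
    simp
  have hkre : ∀ σ : ℝ, 0 < σ → ∀ z : ℂ, ψ z.re < z.im + σ →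
      IntegrableOn (fun x => w x / (2 * Real.pi) * ((I * γ' x / (z + σ * I - γ x)).re - κ))
        (Icc (-δ) δ) := by
    intro σ hσ z hz
    refine Continuous.integrableOn_Icc ?_
    have := Complex.continuous_re.comp (hkc σ hσ z hz)
    simp only [Function.comp_def, sub_re, ofReal_re] at this
    exact (hwc.div_const _).mul this
  -- lower bound at the interior point
  have hlow : ∀ σ : ℝ, 0 < σ → σ ≤ h₀ / 40 →
      κ / (2 * Real.pi) * ∫ x in Icc (-δ) δ, w x ≤ (A σ z₀).re := by
    intro σ hσ hσh
    have hz : ψ z₀.re < z₀.im + σ := hz₀D.2.trans (by linarith)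
    rw [hAre σ hσ z₀ hz, ← integral_const_mul]
    refine setIntegral_mono_on ((hwc.integrableOn_Icc).const_mul _) (hkre σ hσ z₀ hz)
      measurableSet_Icc fun x hx => ?_
    have hk : 2 * κ ≤ (I * γ' x / (z₀ + σ * I - γ x)).re := by
      set v : ℂ := (z₀ + σ * I - γ x - h₀ * I) / (h₀ * I) with hv
      have hh₀I : (h₀ * I : ℂ) ≠ 0 := by simp [hh₀pos.ne']
      have hvn : ‖v‖ ≤ 1 / 3 := by
        rw [hv, norm_div, norm_mul, norm_I, mul_one, Complex.norm_real, Real.norm_eq_abs,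
          abs_of_pos hh₀pos, div_le_iff₀ hh₀pos]
        have e1 := norm_add_le (z₀ - (h₀ : ℝ) * I) (σ * I - γ x)
        have e2 := _root_.norm_sub_le (σ * I : ℂ) (γ x)
        rw [norm_mul, norm_I, mul_one, Complex.norm_real, Real.norm_eq_abs, abs_of_pos hσ] at e2
        have e3 := hγδ x hx
        rw [show z₀ + σ * I - γ x - h₀ * I = z₀ - (h₀ : ℝ) * I + (σ * I - γ x) by ring]
        linarith
      have h1v : 2 / 3 ≤ ‖1 + v‖ := by
        have := norm_sub_le_norm_add (1 : ℂ) v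
        rw [norm_one] at this
        linarith
      have h1v0 : 1 + v ≠ 0 := by
        intro h; rw [h, norm_zero] at h1v; linarith
      have hh₀C : (h₀ : ℂ) ≠ 0 := by exact_mod_cast hh₀pos.ne'
      have hden : z₀ + σ * I - γ x = h₀ * I * (1 + v) := by
        rw [hv]; field_simp; ring
      have hq : I * γ' x / (z₀ + σ * I - γ x) = ((1 / h₀ : ℝ) : ℂ) * (γ' x / (1 + v)) := by
        rw [hden]; push_cast; field_simp
      have hd : ‖γ' x / (1 + v) - 1‖ ≤ 13 / 20 := by
        rw [show γ' x / (1 + v) - 1 = ((γ' x - 1) - v) / (1 + v) by field_simp; ring,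
          norm_div, div_le_iff₀ (by linarith)]
        have := _root_.norm_sub_le (γ' x - 1) v
        have := h.near_one x
        linarith
      have hre := (abs_le.1 ((Complex.abs_re_le_norm _).trans hd)).1
      simp only [sub_re, one_re] at hre
      rw [hq, Complex.re_ofReal_mul]
      have e1 : 1 / h₀ = 6 * κ := by rw [hh₀]; field_simp
      rw [e1]
      have : 6 * κ * (7 / 20) ≤ 6 * κ * (γ' x / (1 + v)).re :=
        mul_le_mul_of_nonneg_left (by linarith) (by positivity)
      linarith
    have : w x / (2 * Real.pi) * κ ≤
        w x / (2 * Real.pi) * ((I * γ' x / (z₀ + σ * I - γ x)).re - κ) :=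
      mul_le_mul_of_nonneg_left (by linarith) (div_nonneg (hw0 x hx) (by positivity))
    refine le_trans (le_of_eq ?_) this
    ring
  -- upper bound on the boundary
  have hup : ∀ η : ℝ, 0 < η → ∃ c : ℝ, 0 ≤ c ∧ ∀ σ : ℝ, 0 < σ → σ ≤ h₀ / 40 →
      ∀ z ∈ frontier D, ‖E z‖ * Real.exp (A σ z).re ≤ Real.exp (η + c * σ) := by
    intro η hη
    obtain ⟨ρ, hρ, hρw⟩ := Metric.uniformContinuousOn_iff.1
      ((isCompact_Icc (a := -(2 * R)) (b := 2 * R)).uniformContinuousOn_of_continuous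
        hwc.continuousOn) η hη
    set Λ := -Real.log ε with hΛ
    have hΛ0 : 0 ≤ Λ := by have := Real.log_nonpos hε.le hε1.le; rw [hΛ]; linarith
    refine ⟨(2 * δ) * (Λ / ρ ^ 2 * 2 / (2 * Real.pi)), by positivity, fun σ hσ hσh z hz => ?_⟩
    have hzc := hDcl (frontier_subset_closure hz)
    have hz' : ψ z.re < z.im + σ := hzc.2.trans_lt (by linarith)
    have hcase : ‖z‖ = R ∨ (‖z‖ < R ∧ z.im = ψ z.re) := by
      rcases hzc.1.eq_or_lt with h1 | h1
      · exact Or.inl h1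
      · refine Or.inr ⟨h1, ?_⟩
        rcases hzc.2.eq_or_lt with h2 | h2
        · exact h2.symm
        · exact absurd (show z ∈ D from ⟨h1, h2⟩) (hDo.frontier_eq ▸ hz).2
    rcases hcase with hzR | ⟨hzR, hzψ⟩
    · have hA0 : (A σ z).re ≤ 0 := by
        rw [hAre σ hσ z hz']
        refine setIntegral_nonpos measurableSet_Icc fun x hx => ?_
        refine mul_nonpos_of_nonneg_of_nonpos (div_nonneg (hw0 x hx) (by positivity)) ?_
        have e0 : R / 2 ≤ ‖z + σ * I - γ x‖ := by
          have e1 := norm_sub_norm_le z (γ x - σ * I)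
          have e2 := _root_.norm_sub_le (γ x) (σ * I : ℂ)
          rw [norm_mul, norm_I, mul_one, Complex.norm_real, Real.norm_eq_abs, abs_of_pos hσ] at e2
          rw [show z + σ * I - γ x = z - (γ x - σ * I) by ring]
          linarith [hγδ x hx]
        have e1 : ‖I * γ' x / (z + σ * I - γ x)‖ ≤ κ := by
          rw [norm_div, norm_mul, norm_I, one_mul, div_le_iff₀ (by linarith)]
          have := h.norm_deriv_le x
          have := mul_le_mul_of_nonneg_left e0 hκ.le
          linarith
        linarith [Complex.re_le_norm (I * γ' x / (z + σ * I - γ x))]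
      calc _ ≤ 1 * 1 := mul_le_mul (hEcl z hzc.1 hzc.2) (Real.exp_le_one_iff.2 hA0)
            (Real.exp_nonneg _) zero_le_one
        _ ≤ _ := by
            rw [one_mul]
            exact Real.one_le_exp (by positivity)
    · obtain ⟨x, hx⟩ := hψx z
      rw [hzψ, sub_self, ofReal_zero, zero_mul, add_zero] at hx
      have hxR : |x| ≤ 2 * R := by
        have := h.norm_chord x 0
        rw [h0, sub_zero, sub_zero, ← hx] at this
        have e1 := norm_sub_norm_le ((x : ℝ) : ℂ) z
        rw [norm_sub_rev, Complex.norm_real, Real.norm_eq_abs] at e1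
        linarith [abs_nonneg x]
      have hwx : ∀ y ∈ Icc (-δ) δ, w y ≤ w x + η + Λ / ρ ^ 2 * (x - y) ^ 2 := by
        intro y hy
        have hwx0 : 0 ≤ w x := by
          refine truncLog_nonneg hε hε1.le ?_
          rw [← hx]
          exact hEcl z hzc.1 hzc.2
        rcases lt_or_ge |x - y| ρ with hlt | hge
        · have := hρw x (abs_le.1 hxR) y ⟨by linarith [hy.1], by linarith [hy.2]⟩
            (by rwa [Real.dist_eq])
          rw [Real.dist_eq] at this
          have := (abs_lt.1 this).1
          have : 0 ≤ Λ / ρ ^ 2 * (x - y) ^ 2 := by positivity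
          linarith
        · have e1 : w y ≤ Λ := truncLog_le hε _
          have e2 : ρ ^ 2 ≤ (x - y) ^ 2 := by
            rw [← sq_abs (x - y)]
            exact pow_le_pow_left₀ hρ.le hge 2
          have e3 : Λ ≤ Λ / ρ ^ 2 * (x - y) ^ 2 := by
            rw [div_mul_eq_mul_div, le_div_iff₀ (by positivity)]
            exact mul_le_mul_of_nonneg_left e2 hΛ0
          linarith
      have hAw : (A σ z).re ≤ w x + η + (2 * δ) * (Λ / ρ ^ 2 * 2 / (2 * Real.pi)) * σ := by
        have hwx0 : 0 ≤ w x := by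
          refine truncLog_nonneg hε hε1.le ?_
          rw [← hx]
          exact hEcl z hzc.1 hzc.2
        rw [hAre σ hσ z hz']
        have hP := integrable_poisson x hσ
        have hstep : ∀ y ∈ Icc (-δ) δ,
            w y / (2 * Real.pi) * ((I * γ' y / (z + σ * I - γ y)).re - κ) ≤
            (w x + η) / (2 * Real.pi) * (2 * σ / ((x - y) ^ 2 + σ ^ 2)) +
              Λ / ρ ^ 2 * 2 / (2 * Real.pi) * σ := by
          intro y hy
          have e1 := h.re_kernel_le x y hσ
          rw [show γ x - γ y + σ * I = z + σ * I - γ y by rw [hx]; ring] at e1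
          set P := 2 * σ / ((x - y) ^ 2 + σ ^ 2) with hPdef
          have hP0 : 0 ≤ P := by positivity
          have e2 : w y / (2 * Real.pi) * ((I * γ' y / (z + σ * I - γ y)).re - κ) ≤
              w y / (2 * Real.pi) * P :=
            mul_le_mul_of_nonneg_left (by linarith) (div_nonneg (hw0 y hy) (by positivity))
          have e3 : w y / (2 * Real.pi) * P ≤
              (w x + η + Λ / ρ ^ 2 * (x - y) ^ 2) / (2 * Real.pi) * P := by
            gcongr
            exact hwx y hy
          have e4 : (x - y) ^ 2 * P ≤ 2 * σ := by
            rw [hPdef, mul_div_assoc', div_le_iff₀ (by positivity)]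
            nlinarith [sq_nonneg σ, hσ]
          have e5 : Λ / ρ ^ 2 / (2 * Real.pi) * ((x - y) ^ 2 * P) ≤
              Λ / ρ ^ 2 / (2 * Real.pi) * (2 * σ) := by gcongr
          calc _ ≤ _ := e2.trans e3
            _ = (w x + η) / (2 * Real.pi) * P +
              Λ / ρ ^ 2 / (2 * Real.pi) * ((x - y) ^ 2 * P) := by ring
            _ ≤ (w x + η) / (2 * Real.pi) * P + Λ / ρ ^ 2 / (2 * Real.pi) * (2 * σ) := by gcongr
            _ = _ := by ring
        have hci : IntegrableOn (fun _ : ℝ => Λ / ρ ^ 2 * 2 / (2 * Real.pi) * σ) (Icc (-δ) δ) :=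
          continuous_const.integrableOn_Icc
        calc _ ≤ ∫ y in Icc (-δ) δ, ((w x + η) / (2 * Real.pi) * (2 * σ / ((x - y) ^ 2 + σ ^ 2)) +
                Λ / ρ ^ 2 * 2 / (2 * Real.pi) * σ) :=
              setIntegral_mono_on (hkre σ hσ z hz') (Integrable.fun_add (hP.integrableOn.const_mul _) hci)
                measurableSet_Icc hstep
          _ = (w x + η) / (2 * Real.pi) * (∫ y in Icc (-δ) δ, 2 * σ / ((x - y) ^ 2 + σ ^ 2)) +
                (2 * δ) * (Λ / ρ ^ 2 * 2 / (2 * Real.pi) * σ) := by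
              rw [integral_add (hP.integrableOn.const_mul _) hci, integral_const_mul,
                setIntegral_const, smul_eq_mul]
              congr 2
              rw [Measure.real, Real.volume_Icc, ENNReal.toReal_ofReal (by linarith)]
              ring
          _ ≤ (w x + η) / (2 * Real.pi) * (2 * Real.pi) +
                (2 * δ) * (Λ / ρ ^ 2 * 2 / (2 * Real.pi) * σ) := by
              gcongr
              exact setIntegral_poisson_le x hσ _
          _ = _ := by field_simp
      calc ‖E z‖ * Real.exp (A σ z).re
          ≤ Real.exp (-w x) *
            Real.exp (w x + η + (2 * δ) * (Λ / ρ ^ 2 * 2 / (2 * Real.pi)) * σ) := by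
            refine mul_le_mul ?_ (Real.exp_le_exp.2 hAw) (Real.exp_nonneg _) (Real.exp_nonneg _)
            rw [hx]
            exact norm_le_exp_neg_truncLog hε _
        _ = _ := by rw [← Real.exp_add]; congr 1; ring
  -- maximum principle
  have hbd : Bornology.IsBounded D :=
    (Metric.isBounded_ball (x := (0 : ℂ)) (r := R)).subset fun z hz => by
      simpa using hz.1
  have hmax : ∀ η : ℝ, 0 < η → ∃ c : ℝ, 0 ≤ c ∧ ∀ σ : ℝ, 0 < σ → σ ≤ h₀ / 40 →
      ‖E z₀‖ * Real.exp (κ / (2 * Real.pi) * ∫ x in Icc (-δ) δ, w x) ≤ Real.exp (η + c * σ) := by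
    intro η hη
    obtain ⟨c, hc, hcb⟩ := hup η hη
    refine ⟨c, hc, fun σ hσ hσh => ?_⟩
    have hdiff : DiffContOnCl ℂ (fun z => E z * exp (A σ z)) D := by
      have hd : DifferentiableOn ℂ (fun z => E z * exp (A σ z)) {z : ℂ | ψ z.re < z.im + σ} :=
        hE.differentiableOn.mul (hAd σ hσ).cexp
      refine (hd.mono fun z hz => ?_).diffContOnCl
      exact (hDcl hz).2.trans_lt (by linarith)
    have := Complex.norm_le_of_forall_mem_frontier_norm_le hbd hdiff
      (C := Real.exp (η + c * σ)) (fun z hz => by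
        rw [norm_mul, Complex.norm_exp]; exact hcb σ hσ hσh z hz) (subset_closure hz₀D)
    rw [norm_mul, Complex.norm_exp] at this
    exact le_trans (mul_le_mul_of_nonneg_left (Real.exp_le_exp.2 (hlow σ hσ hσh))
      (norm_nonneg _)) this
  have hfin : ‖E z₀‖ * Real.exp (κ / (2 * Real.pi) * ∫ x in Icc (-δ) δ, w x) ≤ 1 := by
    have hη : ∀ η : ℝ, 0 < η →
        ‖E z₀‖ * Real.exp (κ / (2 * Real.pi) * ∫ x in Icc (-δ) δ, w x) ≤ Real.exp (2 * η) := by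
      intro η hη
      obtain ⟨c, hc, hcb⟩ := hmax η hη
      have hσ : 0 < min (h₀ / 40) (η / (c + 1)) := by positivity
      refine (hcb _ hσ (min_le_left _ _)).trans (Real.exp_le_exp.2 ?_)
      have : c * min (h₀ / 40) (η / (c + 1)) ≤ η := by
        calc c * min (h₀ / 40) (η / (c + 1)) ≤ (c + 1) * (η / (c + 1)) := by
              gcongr
              · linarith
              · exact min_le_right _ _
          _ = η := by field_simp
      linarith
    have hlim : Tendsto (fun η : ℝ => Real.exp (2 * η)) (𝓝[>] 0) (𝓝 1) := by
      have : Continuous fun η : ℝ => Real.exp (2 * η) := by fun_prop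
      have := this.tendsto 0
      simp only [mul_zero, Real.exp_zero] at this
      exact this.mono_left nhdsWithin_le_nhds
    exact ge_of_tendsto hlim (eventually_mem_nhdsWithin.mono fun η hη' => hη η hη')
  rw [Real.exp_neg, ← one_div, le_div_iff₀ (Real.exp_pos _)]
  exact hfin

/-- The sequence `E` tends to `0` uniformly on `s`. -/
def TendsToZeroOn (E : ℕ → ℂ → ℂ) (s : Set ℂ) : Prop :=
  ∀ ε : ℝ, 0 < ε → ∀ᶠ n in atTop, ∀ z ∈ s, ‖E n z‖ ≤ ε

theorem TendsToZeroOn.mono {E : ℕ → ℂ → ℂ} {s t : Set ℂ} (h : TendsToZeroOn E t) (hst : s ⊆ t) :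
    TendsToZeroOn E s :=
  fun ε hε => (h ε hε).mono fun _ hn z hz => hn z (hst hz)

theorem tendsto_tsum_min_geometric {p q C : ℝ} (hq : 0 ≤ q) (hp : 0 ≤ p) (hp1 : p < 1) (hC : 0 ≤ C) :
    Tendsto (fun s : ℝ => ∑' k : ℕ, min (s * q ^ k) (C * p ^ k)) (𝓝[>] 0) (𝓝 0) := by
  have hq0 : ∀ k : ℕ, 0 ≤ C * p ^ k := fun k => by positivity
  have hs : Summable fun k : ℕ => C * p ^ k :=
    (summable_geometric_of_lt_one hp hp1).mul_left C
  have key : Tendsto (fun s : ℝ => ∑' k : ℕ, min (s * q ^ k) (C * p ^ k)) (𝓝[>] 0)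
      (𝓝 (∑' _ : ℕ, (0 : ℝ))) := by
    refine tendsto_tsum_of_dominated_convergence hs (fun k => ?_) ?_
    · have : Continuous fun s : ℝ => min (s * q ^ k) (C * p ^ k) := by fun_prop
      have := this.tendsto 0
      rw [zero_mul, min_eq_left (hq0 k)] at this
      exact this.mono_left nhdsWithin_le_nhds
    · filter_upwards [self_mem_nhdsWithin] with s hs k
      have hs' : (0 : ℝ) < s := hs
      rw [Real.norm_eq_abs, abs_of_nonneg (le_min (by positivity) (hq0 k))]
      exact min_le_right _ _
  simpa only [tsum_zero] using key

theorem TendsToZeroOn.closedBall_of_bounded {E : ℕ → ℂ → ℂ} (hE : ∀ n, Differentiable ℂ (E n))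
    {c : ℂ} {ρ r R C : ℝ} (hρ : 0 < ρ) (hr : 0 ≤ r) (hrR : r < R)
    (hC : ∀ n, ∀ z ∈ Metric.closedBall c R, ‖E n z‖ ≤ C)
    (h : TendsToZeroOn E (Metric.closedBall c ρ)) : TendsToZeroOn E (Metric.closedBall c r) := by
  have hR : 0 < R := hr.trans_lt hrR
  have hC0 : 0 ≤ C := (norm_nonneg _).trans (hC 0 c (Metric.mem_closedBall_self hR.le))
  have hp1 : r / R < 1 := (div_lt_one hR).2 hrR
  intro ε hε
  obtain ⟨s, hsε, hs⟩ := (((tendsto_tsum_min_geometric (q := r / ρ) (div_nonneg hr hρ.le) (div_nonneg hr hR.le) hp1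
    hC0).eventually (gt_mem_nhds hε)).and self_mem_nhdsWithin).exists
  have hs0 : (0 : ℝ) < s := hs
  filter_upwards [h s hs0] with n hn z hz
  have hz' : ‖z - c‖ ≤ r := by simpa [dist_eq_norm] using hz
  rw [← Complex.taylorSeries_eq_of_entire (hE n) c z]
  have hb : ∀ k : ℕ, ‖((k.factorial : ℂ))⁻¹ • (z - c) ^ k • iteratedDeriv k (E n) c‖ ≤
      min (s * (r / ρ) ^ k) (C * (r / R) ^ k) := by
    intro k
    have hk : (0 : ℝ) < k.factorial := by positivity
    have hgen : ∀ {P S : ℝ}, 0 < P → 0 ≤ S → (∀ w ∈ Metric.closedBall c P, ‖E n w‖ ≤ S) →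
        ‖((k.factorial : ℂ))⁻¹ • (z - c) ^ k • iteratedDeriv k (E n) c‖ ≤ S * (r / P) ^ k := by
      intro P S hP hS hPS
      have := Complex.norm_iteratedDeriv_le_of_forall_mem_sphere_norm_le k hP
        (hE n).diffContOnCl (fun w hw => hPS w (Metric.sphere_subset_closedBall hw))
      rw [norm_smul, norm_smul, norm_inv, norm_pow, Complex.norm_natCast]
      calc _ ≤ (k.factorial : ℝ)⁻¹ * (r ^ k * (k.factorial * S / P ^ k)) := by gcongr
        _ = _ := by rw [div_pow]; field_simp
    exact le_min (hgen hρ hs0.le hn) (hgen hR hC0 (hC n))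
  have hsum : Summable fun k : ℕ => min (s * (r / ρ) ^ k) (C * (r / R) ^ k) := by
    refine Summable.of_nonneg_of_le (fun k => ?_) (fun k => min_le_right _ _)
      ((summable_geometric_of_lt_one (div_nonneg hr hR.le) hp1).mul_left C)
    exact (norm_nonneg _).trans (hb k)
  exact (tsum_of_norm_bounded hsum.hasSum hb).trans hsε.le

/-- Propagation of locally uniform convergence to `0` along connected sets, for bounded sequences
of holomorphic functions. -/
theorem TendsToZeroOn.propagate {E : ℕ → ℂ → ℂ} (hE : ∀ n, Differentiable ℂ (E n))
    {D S : Set ℂ} (hD : IsOpen D) (hS : IsPreconnected S) (hSD : S ⊆ D) {C : ℝ}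
    (hC : ∀ n, ∀ z ∈ D, ‖E n z‖ ≤ C) {c : ℂ} (hc : c ∈ S) {ρ : ℝ} (hρ : 0 < ρ)
    (h : TendsToZeroOn E (Metric.closedBall c ρ)) {z : ℂ} (hz : z ∈ S) :
    Tendsto (fun n => E n z) atTop (𝓝 0) := by
  set u : Set ℂ := {w | ∃ r : ℝ, 0 < r ∧ TendsToZeroOn E (Metric.closedBall w r)} with hu
  have huo : IsOpen u := by
    rw [Metric.isOpen_iff]
    rintro w ⟨r, hr, hw⟩
    refine ⟨r / 2, by positivity, fun v hv => ⟨r / 2, by positivity, hw.mono ?_⟩⟩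
    refine Metric.closedBall_subset_closedBall' ?_
    rw [Metric.mem_ball] at hv
    linarith
  have hsub : S ⊆ u := by
    refine hS.subset_of_closure_inter_subset huo ⟨c, hc, ρ, hρ, h⟩ ?_
    rintro w ⟨hw, hwS⟩
    obtain ⟨r, hr, hrD⟩ := Metric.isOpen_iff.1 hD w (hSD hwS)
    obtain ⟨v, ⟨r', hr', hv⟩, hvw⟩ := Metric.mem_closure_iff.1 hw (r / 4) (by positivity)
    refine ⟨r / 4, by positivity, ?_⟩
    have hbig : TendsToZeroOn E (Metric.closedBall v (r / 2)) := by
      refine hv.closedBall_of_bounded hE (R := r * (5 / 8)) (C := C) hr' (by positivity)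
        (by linarith) fun n x hx => hC n x (hrD ?_)
      rw [Metric.mem_closedBall] at hx
      rw [Metric.mem_ball]
      have := dist_triangle x v w
      rw [dist_comm v w] at this
      linarith
    refine hbig.mono (Metric.closedBall_subset_closedBall' ?_)
    linarith
  obtain ⟨r, hr, hzr⟩ := hsub hz
  rw [tendsto_zero_iff_norm_tendsto_zero, Metric.tendsto_nhds]
  intro ε hε
  filter_upwards [hzr (ε / 2) (by positivity)] with n hn
  have := hn z (Metric.mem_closedBall_self hr.le)
  rw [Real.dist_eq, sub_zero, abs_of_nonneg (norm_nonneg _)]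
  linarith

theorem truncLog_sub_le {ε : ℝ} (hε : 0 < ε) (c d : ℂ) :
    truncLog ε c - truncLog ε d ≤ ‖c - d‖ / ε := by
  have hc : 0 < max ‖c‖ ε := hε.trans_le (le_max_right _ _)
  have hd : 0 < max ‖d‖ ε := hε.trans_le (le_max_right _ _)
  have h1 : truncLog ε c - truncLog ε d = Real.log (max ‖d‖ ε / max ‖c‖ ε) := by
    rw [Real.log_div hd.ne' hc.ne']; unfold truncLog; ring
  rw [h1]
  refine (Real.log_le_sub_one_of_pos (div_pos hd hc)).trans ?_
  have h2 : max ‖d‖ ε - max ‖c‖ ε ≤ ‖c - d‖ := by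
    have := norm_sub_norm_le d c
    rw [norm_sub_rev] at this
    have e1 := le_max_left ‖c‖ ε
    have e2 := le_max_right ‖c‖ ε
    have := norm_nonneg (c - d)
    rw [sub_le_iff_le_add]
    exact max_le (by linarith) (by linarith)
  rw [div_sub_one hc.ne']
  calc _ ≤ ‖c - d‖ / max ‖c‖ ε := by gcongr
    _ ≤ _ := by gcongr; exact le_max_right _ _

theorem ae_eq_zero_of_forall_intervalIntegral_eq_zero {f : ℝ → ℂ} (hf : Integrable f)
    {r : ℝ} (h : ∀ x ∈ Ioo (-r) r, ∫ t in (0 : ℝ)..x, f t = 0) :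
    ∀ᵐ x, x ∈ Ioo (-r) r → f x = 0 := by
  filter_upwards [LocallyIntegrable.ae_hasDerivAt_integral hf.locallyIntegrable] with x hx hxr
  refine (hx 0).unique ((hasDerivAt_const x (0 : ℂ)).congr_of_eventuallyEq ?_)
  filter_upwards [isOpen_Ioo.mem_nhds hxr] with y hy
  exact h y hy

theorem tendsto_setIntegral_norm_sub {s t : Set ℝ} (hst : s ⊆ t)
    {F : ℕ → ℝ → ℂ} {f : ℝ → ℂ} (hF : ∀ n, IntegrableOn (fun x => F n x - f x) t)
    (h : Tendsto (fun n => ∫ x in t, ‖F n x - f x‖) atTop (𝓝 0)) :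
    Tendsto (fun n => ∫ x in s, ‖F n x - f x‖) atTop (𝓝 0) :=
  squeeze_zero (fun _ => integral_nonneg fun _ => norm_nonneg _)
    (fun n => setIntegral_mono_set (hF n).norm (ae_of_all _ fun _ => norm_nonneg _)
      (LE.le.eventuallyLE hst)) h

/-- Holomorphic functions that are uniformly bounded above a nice curve and converge in the mean
on the curve to a function with divergent logarithmic integral: the limit vanishes. -/
theorem NiceCurve.ae_eq_zero_of_log {γ γ' : ℝ → ℂ} {K : ℝ} (h : NiceCurve γ γ' K) (h0 : γ 0 = 0)
    {R κ δ C : ℝ} (hR : 0 < R) (hκK : 2 * K ≤ κ) (hκR : 4 ≤ κ * R) (hδ : 0 < δ)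
    (hδκ : δ * (240 * κ) ≤ 1) (hC : 0 < C) {E : ℕ → ℂ → ℂ} (hE : ∀ n, Differentiable ℂ (E n))
    (hEC : ∀ n, ∀ x t : ℝ, 0 ≤ t → ‖γ x + t * I‖ ≤ R → ‖E n (γ x + t * I)‖ ≤ C)
    {b : ℝ → ℂ} (hb : Integrable b)
    (hlim : Tendsto (fun n => ∫ x in Icc (-R) R, ‖E n (γ x) - b x‖) atTop (𝓝 0))
    (hlog : ∀ M : ℝ, ∃ ε : ℝ, 0 < ε ∧ ε < 1 ∧
      M ≤ ∫ x in Icc (-δ) δ, truncLog ε (b x / C)) :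
    ∀ᵐ x, x ∈ Ioo (-(R / 4)) (R / 4) → b x = 0 := by
  have hκ : 0 < κ := by
    by_contra hneg
    nlinarith
  have hπ := Real.pi_pos
  have hEγ : ∀ n, Continuous fun x => E n (γ x) := fun n =>
    (hE n).continuous.comp h.continuous
  have hsubi : ∀ n r, IntegrableOn (fun x => E n (γ x) - b x) (Icc (-r) r) := fun n r =>
    Integrable.sub (hEγ n).integrableOn_Icc hb.integrableOn
  have hδR : δ ≤ R := by
    have : 0 < κ * R := by linarith
    by_contra hlt
    have : κ * R < κ * δ := by gcongr; linarith
    linarith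
  have hmem : ∀ r, 0 ≤ r → r ≤ R → Tendsto (fun n => ∫ x in Icc (-r) r, ‖E n (γ x) - b x‖) atTop
      (𝓝 0) := fun r hr hrR =>
    tendsto_setIntegral_norm_sub (Icc_subset_Icc (by linarith) hrR)
      (fun n => hsubi n R) hlim
  -- smallness on a disc
  have hsmall : TendsToZeroOn E (Metric.closedBall ((1 / (6 * κ) : ℝ) * I) (1 / (24 * κ))) := by
    intro ε hε
    obtain ⟨M, hM⟩ : ∃ M : ℝ, C * Real.exp (-(κ / (2 * Real.pi) * M)) ≤ ε := by
      refine ⟨2 * Real.pi / κ * -Real.log (ε / C), ?_⟩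
      rw [show -(κ / (2 * Real.pi) * (2 * Real.pi / κ * -Real.log (ε / C))) = Real.log (ε / C) by
        field_simp, Real.exp_log (by positivity)]
      exact (mul_div_cancel₀ _ hC.ne').le
    obtain ⟨ε', hε', hε'1, hMε⟩ := hlog (M + 1)
    have hlt := (hmem δ hδ.le hδR).eventually (gt_mem_nhds (show 0 < ε' * C by positivity))
    filter_upwards [hlt] with n hn z hz
    have hz' : ‖z - (1 / (6 * κ) : ℝ) * I‖ ≤ 1 / (24 * κ) := by
      simpa only [Metric.mem_closedBall, dist_eq_norm] using hz
    have key := h.norm_le_exp h0 hR hκK hκR hδ hδκ hε' hε'1 (E := fun z => E n z / C)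
      ((hE n).div_const _) (fun x t ht hxt => by
        rw [norm_div, Complex.norm_real, Real.norm_of_nonneg hC.le]
        exact div_le_one_of_le₀ (hEC n x t ht hxt) hC.le) hz'
    have hbm : AEStronglyMeasurable (fun x => truncLog ε' (b x / C))
        (volume.restrict (Icc (-δ) δ)) :=
      ((continuous_truncLog hε').comp (continuous_id.div_const (C : ℂ))).comp_aestronglyMeasurable
        hb.aestronglyMeasurable.restrict
    have hEi : IntegrableOn (fun x => truncLog ε' (E n (γ x) / C)) (Icc (-δ) δ) :=
      ((continuous_truncLog hε').comp ((hEγ n).div_const _)).integrableOn_Icc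
    have hdi : IntegrableOn (fun x => ‖b x - E n (γ x)‖ * (1 / (ε' * C))) (Icc (-δ) δ) := by
      refine Integrable.mul_const ?_ _
      have := (hsubi n δ).norm
      simpa only [norm_sub_rev] using this
    have hpt : ∀ x, |truncLog ε' (b x / C) - truncLog ε' (E n (γ x) / C)| ≤
        ‖b x - E n (γ x)‖ * (1 / (ε' * C)) := by
      intro x
      have e : ‖b x / C - E n (γ x) / C‖ / ε' = ‖b x - E n (γ x)‖ * (1 / (ε' * C)) := by
        rw [← sub_div, norm_div, Complex.norm_real, Real.norm_of_nonneg hC.le]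
        field_simp
      rw [← e, abs_le]
      have e1 := truncLog_sub_le hε' (b x / C) (E n (γ x) / C)
      have e2 := truncLog_sub_le hε' (E n (γ x) / C) (b x / C)
      rw [norm_sub_rev] at e2
      constructor <;> linarith
    have hbi : IntegrableOn (fun x => truncLog ε' (b x / C)) (Icc (-δ) δ) := by
      have : IntegrableOn (fun x => truncLog ε' (b x / C) - truncLog ε' (E n (γ x) / C))
          (Icc (-δ) δ) :=
        Integrable.mono' hdi (hbm.sub hEi.aestronglyMeasurable) (ae_of_all _ hpt)
      have hadd := Integrable.fun_add this hEi
      simp only [sub_add_cancel] at hadd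
      exact hadd
    have hcmp : M ≤ ∫ x in Icc (-δ) δ, truncLog ε' (E n (γ x) / C) := by
      have e1 : ∫ x in Icc (-δ) δ, truncLog ε' (b x / C) ≤
          ∫ x in Icc (-δ) δ, (truncLog ε' (E n (γ x) / C) +
            ‖b x - E n (γ x)‖ * (1 / (ε' * C))) := by
        refine integral_mono hbi (Integrable.fun_add hEi hdi) fun x => ?_
        have := (abs_le.1 (hpt x)).2
        simp only
        linarith
      rw [integral_add hEi hdi, integral_mul_const] at e1
      simp only [norm_sub_rev (b _)] at e1
      have e2 : (∫ x in Icc (-δ) δ, ‖E n (γ x) - b x‖) * (1 / (ε' * C)) ≤ 1 := by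
        rw [mul_one_div]
        exact div_le_one_of_le₀ hn.le (by positivity)
      linarith
    rw [norm_div, Complex.norm_real, Real.norm_of_nonneg hC.le, div_le_iff₀ hC] at key
    refine key.trans (le_trans ?_ hM)
    rw [mul_comm]
    gcongr
  -- pointwise convergence above the curve
  obtain ⟨ψ, hψc, hψ, hψx⟩ := h.exists_graph
  have hDo : IsOpen {z : ℂ | ‖z‖ < R ∧ ψ z.re < z.im} :=
    (isOpen_lt continuous_norm continuous_const).inter
      (isOpen_lt (hψc.comp continuous_re) continuous_im)
  have hnγ : ∀ x, ‖γ x‖ ≤ 11 / 10 * |x| := fun x => by simpa [h0] using h.norm_sub_le x 0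
  set S : Set ℂ := (fun p : ℝ × ℝ => γ p.1 + p.2 * I) '' (Ioo (-(R / 4)) (R / 4) ×ˢ Ioo 0 (R / 2))
    with hS
  have hSc : IsPreconnected S := by
    refine (isPreconnected_Ioo.prod isPreconnected_Ioo).image _ (Continuous.continuousOn ?_)
    have := h.continuous
    fun_prop
  have hnS : ∀ x t : ℝ, x ∈ Ioo (-(R / 4)) (R / 4) → 0 ≤ t → t < R / 2 →
      ‖γ x + t * I‖ < R := by
    intro x t hx ht ht'
    have e1 := norm_add_le (γ x) (t * I)
    rw [norm_mul, norm_I, mul_one, Complex.norm_real, Real.norm_of_nonneg ht] at e1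
    have := hnγ x
    have := abs_lt.2 hx
    linarith
  have hSD : S ⊆ {z : ℂ | ‖z‖ < R ∧ ψ z.re < z.im} := by
    rintro _ ⟨⟨x, t⟩, ⟨hx, ht⟩, rfl⟩
    refine ⟨hnS x t hx ht.1.le ht.2, ?_⟩
    simp [hψ]
    exact ht.1
  have hDC : ∀ n, ∀ z ∈ {z : ℂ | ‖z‖ < R ∧ ψ z.re < z.im}, ‖E n z‖ ≤ C := by
    rintro n z ⟨hzR, hzψ⟩
    obtain ⟨x, hx⟩ := hψx z
    rw [hx] at hzR ⊢
    exact hEC n x _ (sub_pos.2 hzψ).le hzR.le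
  have hcS : ((1 / (6 * κ) : ℝ) * I : ℂ) ∈ S := by
    refine ⟨(0, 1 / (6 * κ)), ⟨⟨by simp; linarith, by simp; linarith⟩, ?_⟩, by simp [h0]⟩
    refine ⟨by positivity, ?_⟩
    rw [div_lt_iff₀ (by positivity)]
    linarith
  have hpt : ∀ x t : ℝ, x ∈ Ioo (-(R / 4)) (R / 4) → t ∈ Ioo 0 (R / 2) →
      Tendsto (fun n => E n (γ x + t * I)) atTop (𝓝 0) := fun x t hx ht =>
    TendsToZeroOn.propagate hE hDo hSc hSD hDC hcS (by positivity) hsmall ⟨(x, t), ⟨hx, ht⟩, rfl⟩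
  -- primitives along the curve
  have hγm : AEStronglyMeasurable γ' volume := h.continuous_deriv.aestronglyMeasurable
  have hbγ : Integrable fun x => b x * γ' x :=
    hb.mul_bdd (c := 11 / 10) hγm (ae_of_all _ h.norm_deriv_le)
  have hzero : ∀ x ∈ Ioo (-(R / 4)) (R / 4), ∫ t in (0 : ℝ)..x, b t * γ' t = 0 := by
    intro x hx
    have h00 : (0 : ℝ) ∈ Ioo (-(R / 4)) (R / 4) := ⟨by linarith, by linarith⟩
    have hsub : uIcc 0 x ⊆ Ioo (-(R / 4)) (R / 4) := ordConnected_Ioo.uIcc_subset h00 hx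
    have hlim1 : Tendsto (fun n => ∫ t in (0 : ℝ)..x, E n (γ t) * γ' t) atTop
        (𝓝 (∫ t in (0 : ℝ)..x, b t * γ' t)) := by
      rw [tendsto_iff_norm_sub_tendsto_zero]
      refine squeeze_zero (fun _ => norm_nonneg _) (fun n => ?_)
        (by simpa using hlim.mul_const (11 / 10 : ℝ))
      have hci : IntervalIntegrable (fun t => E n (γ t) * γ' t) volume 0 x :=
        ((hEγ n).mul h.continuous_deriv).intervalIntegrable _ _
      rw [← intervalIntegral.integral_sub hci hbγ.intervalIntegrable]
      refine intervalIntegral.norm_integral_le_integral_norm_uIoc.trans ?_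
      rw [← integral_mul_const]
      calc _ ≤ ∫ t in uIoc 0 x, ‖E n (γ t) - b t‖ * (11 / 10) := by
            have hi : IntegrableOn (fun x => E n (γ x) - b x) (uIoc 0 x) :=
              (hsubi n R).mono_set ((uIoc_subset_uIcc.trans hsub).trans
                (fun y hy => ⟨by linarith [hy.1], by linarith [hy.2]⟩))
            refine integral_mono_of_nonneg (ae_of_all _ fun _ => norm_nonneg _)
              (hi.norm.mul_const _) (ae_of_all _ fun t => ?_)
            simp only
            rw [← sub_mul, norm_mul]
            gcongr
            exact h.norm_deriv_le t
        _ ≤ _ := by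
            refine setIntegral_mono_set ((hsubi n R).norm.mul_const _)
              (ae_of_all _ fun _ => by positivity) (LE.le.eventuallyLE ?_)
            exact (uIoc_subset_uIcc.trans hsub).trans
              (fun y hy => ⟨by linarith [hy.1], by linarith [hy.2]⟩)
    have hbound : ∀ t ∈ Ioo 0 (R / 2), ‖∫ t in (0 : ℝ)..x, b t * γ' t‖ ≤ 2 * (C * t) := by
      intro t ht
      have hlim2 : Tendsto (fun n => ∫ s in (0 : ℝ)..x, E n (γ s + t * I) * γ' s) atTop
          (𝓝 (∫ _ in (0 : ℝ)..x, (0 : ℂ))) := by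
        refine intervalIntegral.tendsto_integral_filter_of_dominated_convergence
          (fun _ => C * (11 / 10)) (Eventually.of_forall fun n => ?_)
          (Eventually.of_forall fun n => ae_of_all _ fun s hs => ?_)
          intervalIntegrable_const (ae_of_all _ fun s hs => ?_)
        · have := h.continuous
          have := h.continuous_deriv
          have := (hE n).continuous
          exact Continuous.aestronglyMeasurable (by fun_prop)
        · rw [norm_mul]
          have hs' := hsub (uIoc_subset_uIcc hs)
          exact mul_le_mul (hEC n s t ht.1.le (hnS s t hs' ht.1.le ht.2).le) (h.norm_deriv_le s)
            (norm_nonneg _) hC.le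
        · simpa using (hpt s t (hsub (uIoc_subset_uIcc hs)) ht).mul_const (γ' s)
      have hn : ∀ n, ‖∫ s in (0 : ℝ)..x, E n (γ s) * γ' s‖ ≤
          2 * (C * t) + ‖∫ s in (0 : ℝ)..x, E n (γ s + t * I) * γ' s‖ := by
        intro n
        obtain ⟨P, hP⟩ := (hE n).isExactOn_univ
        have hPd : ∀ z, HasDerivAt P (E n z) z := fun z => hP z (mem_univ z)
        have hprim : ∀ c : ℂ, ∫ s in (0 : ℝ)..x, E n (γ s + c) * γ' s =
            P (γ x + c) - P (γ 0 + c) := by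
          intro c
          refine intervalIntegral.integral_eq_sub_of_hasDerivAt (f := fun s => P (γ s + c))
            (fun s _ => ?_) (Continuous.intervalIntegrable ?_ _ _)
          · exact (hPd (γ s + c)).comp s ((h.hasDerivAt s).add_const c)
          · have := h.continuous
            have := h.continuous_deriv
            have := (hE n).continuous
            fun_prop
        have hvert : ∀ s ∈ Ioo (-(R / 4)) (R / 4), ‖P (γ s + t * I) - P (γ s)‖ ≤ C * t := by
          intro s hs
          have hd : ∀ τ ∈ Icc 0 t, HasDerivWithinAt (fun τ : ℝ => P (γ s + τ * I))
              (E n (γ s + τ * I) * I) (Icc 0 t) τ := by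
            intro τ _
            have h1 : HasDerivAt (fun τ : ℝ => γ s + (τ : ℂ) * I) I τ := by
              simpa using ((hasDerivAt_id τ).ofReal_comp.mul_const I).const_add (γ s)
            exact ((hPd (γ s + τ * I)).comp τ h1).hasDerivWithinAt
          have := norm_image_sub_le_of_norm_deriv_le_segment' hd (C := C) (fun τ hτ => by
            rw [norm_mul, norm_I, mul_one]
            exact hEC n s τ hτ.1 (hnS s τ hs hτ.1 (hτ.2.trans ht.2)).le) t ⟨ht.1.le, le_rfl⟩
          simpa using this
        have e1 := hprim 0
        have e2 := hprim (t * I)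
        simp only [add_zero] at e1
        rw [e1, e2]
        have e3 := hvert 0 h00
        have e4 := hvert x hx
        have e5 : P (γ x) - P (γ 0) = (P (γ 0 + t * I) - P (γ 0)) +
            -(P (γ x + t * I) - P (γ x)) + (P (γ x + t * I) - P (γ 0 + t * I)) := by ring
        rw [e5]
        refine (norm_add₃_le).trans ?_
        rw [norm_neg]
        linarith
      have := le_of_tendsto_of_tendsto' hlim1.norm (hlim2.norm.const_add (2 * (C * t))) hn
      simpa using this
    have hl : Tendsto (fun t : ℝ => 2 * (C * t)) (𝓝[>] 0) (𝓝 0) := by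
      have : Continuous fun t : ℝ => 2 * (C * t) := by fun_prop
      have := this.tendsto 0
      simp only [mul_zero] at this
      exact this.mono_left nhdsWithin_le_nhds
    have := ge_of_tendsto hl (by
      filter_upwards [Ioo_mem_nhdsGT (show (0 : ℝ) < R / 2 by positivity)] with t ht
      exact hbound t ht)
    exact norm_le_zero_iff.1 this
  filter_upwards [ae_eq_zero_of_forall_intervalIntegral_eq_zero hbγ hzero] with x hx hxr
  refine (mul_eq_zero.1 (hx hxr)).resolve_right fun hγ0 => ?_
  have := h.near_one x
  rw [hγ0] at this
  norm_num at this

theorem NiceCurve.conj {γ γ' : ℝ → ℂ} {K : ℝ} (h : NiceCurve γ γ' K) :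
    NiceCurve (fun x => starRingEnd ℂ (γ x)) (fun x => starRingEnd ℂ (γ' x)) K where
  hasDerivAt x := by
    exact Complex.conjCLE.toContinuousLinearMap.hasFDerivAt.comp_hasDerivAt x (h.hasDerivAt x)
  near_one x := by
    have := h.near_one x
    rwa [← Complex.norm_conj, map_sub, map_one] at this
  lipschitz x y := by
    have := h.lipschitz x y
    rwa [← Complex.norm_conj, map_sub] at this
  nonneg := h.nonneg

/-- The version of `NiceCurve.ae_eq_zero_of_log` for functions bounded below the curve. -/
theorem NiceCurve.ae_eq_zero_of_log_below {γ γ' : ℝ → ℂ} {K : ℝ} (h : NiceCurve γ γ' K)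
    (h0 : γ 0 = 0) {R κ δ C : ℝ} (hR : 0 < R) (hκK : 2 * K ≤ κ) (hκR : 4 ≤ κ * R) (hδ : 0 < δ)
    (hδκ : δ * (240 * κ) ≤ 1) (hC : 0 < C) {E : ℕ → ℂ → ℂ} (hE : ∀ n, Differentiable ℂ (E n))
    (hEC : ∀ n, ∀ x t : ℝ, 0 ≤ t → ‖γ x - t * I‖ ≤ R → ‖E n (γ x - t * I)‖ ≤ C)
    {b : ℝ → ℂ} (hb : Integrable b)
    (hlim : Tendsto (fun n => ∫ x in Icc (-R) R, ‖E n (γ x) - b x‖) atTop (𝓝 0))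
    (hlog : ∀ M : ℝ, ∃ ε : ℝ, 0 < ε ∧ ε < 1 ∧
      M ≤ ∫ x in Icc (-δ) δ, truncLog ε (b x / C)) :
    ∀ᵐ x, x ∈ Ioo (-(R / 4)) (R / 4) → b x = 0 := by
  have hcc : ∀ z : ℂ, starRingEnd ℂ (starRingEnd ℂ z) = z := fun z => Complex.conj_conj z
  have key := h.conj.ae_eq_zero_of_log (by simp [h0]) hR hκK hκR hδ hδκ hC
    (E := fun n z => starRingEnd ℂ (E n (starRingEnd ℂ z)))
    (fun n z => by
      have := (hE n (starRingEnd ℂ z)).star_star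
      rwa [show star (starRingEnd ℂ z) = z from hcc z] at this) (fun n x t ht hxt => ?_)
    (b := fun x => starRingEnd ℂ (b x))
    ((Complex.conjCLE.toContinuousLinearMap.integrable_comp hb)) ?_ ?_
  · filter_upwards [key] with x hx hxr
    simpa using hx hxr
  · have e : starRingEnd ℂ (starRingEnd ℂ (γ x) + t * I) = γ x - t * I := by
      simp [sub_eq_add_neg]
    rw [← Complex.norm_conj, e] at hxt
    rw [Complex.norm_conj, e]
    exact hEC n x t ht hxt
  · simpa only [hcc, ← map_sub, Complex.norm_conj] using hlim
  · intro M
    obtain ⟨ε, hε, hε1, hM⟩ := hlog M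
    refine ⟨ε, hε, hε1, hM.trans_eq ?_⟩
    refine integral_congr_ae (ae_of_all _ fun x => ?_)
    simp only [truncLog, norm_div, Complex.norm_conj]

/-- The complex Gaussian kernel `√(n/π) exp (-n w²)`. -/
noncomputable def gaussKer (n : ℕ) (w : ℂ) : ℂ :=
  (√(n / Real.pi) : ℝ) * exp (-(n * w ^ 2))

/-- The real Gaussian that dominates `gaussKer` along nice curves. -/
noncomputable def gaussMaj (n : ℕ) (d : ℝ) : ℝ :=
  √(n / Real.pi) * Real.exp (-(n / 2) * d ^ 2)

theorem continuous_gaussKer (n : ℕ) : Continuous (gaussKer n) := by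
  unfold gaussKer
  fun_prop

theorem differentiable_gaussKer (n : ℕ) : Differentiable ℂ (gaussKer n) := by
  unfold gaussKer
  fun_prop

theorem norm_gaussKer (n : ℕ) (w : ℂ) :
    ‖gaussKer n w‖ = √(n / Real.pi) * Real.exp (-(n * (w ^ 2).re)) := by
  unfold gaussKer
  rw [norm_mul, Complex.norm_real, Real.norm_of_nonneg (Real.sqrt_nonneg _), Complex.norm_exp]
  simp [-Nat.cast_ofNat]

theorem gaussMaj_nonneg (n : ℕ) (d : ℝ) : 0 ≤ gaussMaj n d := by
  unfold gaussMaj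
  positivity

theorem integrable_gaussMaj (n : ℕ) : Integrable (gaussMaj n) := by
  unfold gaussMaj
  rcases n.eq_zero_or_pos with rfl | hn
  · simp
  · exact (integrable_exp_neg_mul_sq (by positivity)).const_mul _

theorem integral_gaussMaj_le (n : ℕ) : ∫ d, gaussMaj n d ≤ √2 := by
  unfold gaussMaj
  rcases n.eq_zero_or_pos with rfl | hn
  · simp
  · have hn' : (0 : ℝ) < n := by exact_mod_cast hn
    rw [integral_const_mul, integral_gaussian, ← Real.sqrt_mul (by positivity)]
    refine le_of_eq ?_
    congr 1
    have := Real.pi_pos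
    field_simp

theorem re_sq_ge_of_norm_sub_le {w : ℂ} {d : ℝ} (h : ‖w - d‖ ≤ 1 / 5 * |d|) :
    d ^ 2 / 2 ≤ (w ^ 2).re := by
  have hr := (Complex.abs_re_le_norm _).trans h
  have hi := (Complex.abs_im_le_norm _).trans h
  simp at hr hi
  have e1 : (w ^ 2).re = w.re ^ 2 - w.im ^ 2 := by rw [sq, Complex.mul_re]; ring
  have e2 : |d| ≤ |w.re| + |w.re - d| := by
    have := abs_sub_abs_le_abs_sub d w.re
    rw [abs_sub_comm d] at this
    linarith
  have e3 : (4 / 5 * |d|) ^ 2 ≤ |w.re| ^ 2 :=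
    pow_le_pow_left₀ (by positivity) (by linarith) 2
  have e4 : |w.im| ^ 2 ≤ (1 / 5 * |d|) ^ 2 := pow_le_pow_left₀ (abs_nonneg _) (by linarith) 2
  rw [sq_abs] at e3 e4
  rw [e1]
  have e5 : |d| ^ 2 = d ^ 2 := sq_abs d
  nlinarith [sq_nonneg d]

namespace NiceCurve

variable {γ γ' : ℝ → ℂ} {K : ℝ}

theorem norm_gaussKer_le (h : NiceCurve γ γ' K) (n : ℕ) (x y : ℝ) :
    ‖gaussKer n (γ x - γ y)‖ ≤ gaussMaj n (x - y) := by
  rw [norm_gaussKer, gaussMaj]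
  have := re_sq_ge_of_norm_sub_le (w := γ x - γ y) (d := x - y) (by
    have := h.norm_chord x y
    push_cast at this ⊢
    linarith [abs_nonneg (x - y)])
  gcongr
  have hn : (0 : ℝ) ≤ n := n.cast_nonneg
  nlinarith

theorem integrable_prod_gaussKer (h : NiceCurve γ γ' K) (n : ℕ) {f : ℝ → ℂ} (hf : Integrable f) :
    Integrable (fun p : ℝ × ℝ => f p.2 * γ' p.2 * gaussKer n (γ p.1 - γ p.2))
      (volume.prod volume) := by
  have hc := ((hf.norm.mul_const (11 / 10)).convolution_integrand (ContinuousLinearMap.mul ℝ ℝ)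
    (integrable_gaussMaj n) : Integrable _ (volume.prod volume))
  refine hc.mono' ?_ (ae_of_all _ fun p => ?_)
  · refine (hf.aestronglyMeasurable.comp_snd.mul ?_).mul ?_
    · exact (h.continuous_deriv.comp continuous_snd).aestronglyMeasurable
    · refine Continuous.aestronglyMeasurable ((continuous_gaussKer n).comp ?_)
      exact (h.continuous.comp continuous_fst).sub (h.continuous.comp continuous_snd)
  · rw [norm_mul, norm_mul]
    simp only [ContinuousLinearMap.mul_apply']
    gcongr
    · exact h.norm_deriv_le _
    · exact h.norm_gaussKer_le n _ _

theorem integral_norm_integral_gaussKer_le (h : NiceCurve γ γ' K) (n : ℕ) {f : ℝ → ℂ}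
    (hf : Integrable f) :
    ∫ x, ‖∫ y, f y * γ' y * gaussKer n (γ x - γ y)‖ ≤ 2 * ∫ y, ‖f y‖ := by
  have hg := integrable_gaussMaj n
  have hfn : Integrable fun y => ‖f y‖ * (11 / 10) := hf.norm.mul_const _
  have hc := (hfn.convolution_integrand (ContinuousLinearMap.mul ℝ ℝ) hg :
    Integrable _ (volume.prod volume))
  have hF := h.integrable_prod_gaussKer n hf
  have e1 : ∫ x, ‖∫ y, f y * γ' y * gaussKer n (γ x - γ y)‖ ≤
      ∫ x, ∫ y, ‖f y‖ * (11 / 10) * gaussMaj n (x - y) := by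
    refine integral_mono_ae hF.integral_prod_left.norm hc.integral_prod_left ?_
    filter_upwards [hc.prod_right_ae] with x hx
    refine norm_integral_le_of_norm_le hx (ae_of_all _ fun y => ?_)
    rw [norm_mul, norm_mul]
    gcongr
    · exact h.norm_deriv_le _
    · exact h.norm_gaussKer_le n _ _
  have e2 : ∫ x, ∫ y, ‖f y‖ * (11 / 10) * gaussMaj n (x - y) =
      (∫ y, ‖f y‖ * (11 / 10)) * ∫ d, gaussMaj n d := by
    have := integral_convolution (μ := volume) (ν := volume) (ContinuousLinearMap.mul ℝ ℝ) hfn hg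
    simpa only [convolution, ContinuousLinearMap.mul_apply'] using this
  rw [e2, integral_mul_const] at e1
  have e3 := integral_gaussMaj_le n
  have e4 : √2 ≤ 18 / 11 := by
    rw [Real.sqrt_le_left (by norm_num)]
    norm_num
  have e5 : 0 ≤ ∫ y, ‖f y‖ := integral_nonneg fun _ => norm_nonneg _
  refine e1.trans ?_
  have : (∫ y, ‖f y‖) * (11 / 10) * ∫ d, gaussMaj n d ≤ (∫ y, ‖f y‖) * (11 / 10) * (18 / 11) := by
    gcongr
    linarith
  linarith

theorem norm_integral_gaussKer_le (h : NiceCurve γ γ' K) (n : ℕ) {f : ℝ → ℂ} {C : ℝ}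
    (hC : ∀ x, ‖f x‖ ≤ C) (x : ℝ) :
    ‖∫ y, f y * γ' y * gaussKer n (γ x - γ y)‖ ≤ 2 * C := by
  have hg := integrable_gaussMaj n
  have hC0 : 0 ≤ C := (norm_nonneg _).trans (hC 0)
  have hi : Integrable fun y => C * (11 / 10) * gaussMaj n (x - y) :=
    (hg.comp_sub_left x).const_mul _
  refine (norm_integral_le_of_norm_le hi (ae_of_all _ fun y => ?_)).trans ?_
  · rw [norm_mul, norm_mul]
    gcongr
    · exact hC y
    · exact h.norm_deriv_le _
    · exact h.norm_gaussKer_le n _ _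
  · rw [integral_const_mul, integral_sub_left_eq_self (gaussMaj n)]
    have e3 := integral_gaussMaj_le n
    have e4 : √2 ≤ 18 / 11 := by
      rw [Real.sqrt_le_left (by norm_num)]
      norm_num
    have : C * (11 / 10) * ∫ d, gaussMaj n d ≤ C * (11 / 10) * (18 / 11) := by
      gcongr
      linarith
    linarith

theorem tendsto_integral_gaussKer_of_continuous (h : NiceCurve γ γ' K) {f : ℝ → ℂ}
    (hf : Continuous f) {C : ℝ} (hC : ∀ x, ‖f x‖ ≤ C) (x : ℝ) :
    Tendsto (fun n : ℕ => ∫ y, f y * γ' y * gaussKer n (γ x - γ y)) atTop (𝓝 (f x)) := by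
  have hπ := Real.pi_pos
  have hC0 : 0 ≤ C := (norm_nonneg _).trans (hC 0)
  set F : ℕ → ℝ → ℂ := fun n v => ((1 / √Real.pi : ℝ) : ℂ) * (f (x + v / √n) * γ' (x + v / √n) *
    exp (-(n * (γ x - γ (x + v / √n)) ^ 2))) with hF
  have hγc := h.continuous
  have hγ'c := h.continuous_deriv
  have hsub : ∀ n : ℕ, 0 < n → ∫ y, f y * γ' y * gaussKer n (γ x - γ y) = ∫ v, F n v := by
    intro n hn
    have hn' : (0 : ℝ) < √n := Real.sqrt_pos.2 (by exact_mod_cast hn)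
    rw [← integral_add_left_eq_self (fun y => f y * γ' y * gaussKer n (γ x - γ y)) x]
    have := Measure.integral_comp_div
      (fun v => f (x + v) * γ' (x + v) * gaussKer n (γ x - γ (x + v))) (√n)
    rw [abs_of_pos hn'] at this
    have e : ∀ v, F n v = (1 / √n : ℝ) • (f (x + v / √n) * γ' (x + v / √n) *
        gaussKer n (γ x - γ (x + v / √n))) := by
      intro v
      have h1 : ((1 / √Real.pi : ℝ) : ℂ) = ((1 / √n : ℝ) : ℂ) * ((√(n / Real.pi) : ℝ) : ℂ) := by
        rw [← ofReal_mul, Real.sqrt_div (Nat.cast_nonneg n)]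
        congr 1
        field_simp
      simp only [hF, gaussKer, Complex.real_smul]
      rw [h1]
      ring
    simp only [e]
    rw [integral_smul, this, smul_smul, one_div, inv_mul_cancel₀ hn'.ne', one_smul]
  have hlim : Tendsto (fun n : ℕ => ∫ v, F n v) atTop
      (𝓝 (∫ v : ℝ, ((1 / √Real.pi : ℝ) : ℂ) * (f x * γ' x * exp (-(γ' x ^ 2) * v ^ 2)))) := by
    refine tendsto_integral_filter_of_dominated_convergence
      (fun v => 1 / √Real.pi * (C * (11 / 10) * Real.exp (-(1 / 2) * v ^ 2)))
      (Eventually.of_forall fun n => ?_) ?_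
      (((integrable_exp_neg_mul_sq (by norm_num)).const_mul _).const_mul _)
      (ae_of_all _ fun v => ?_)
    · exact Continuous.aestronglyMeasurable (by fun_prop)
    · filter_upwards [eventually_gt_atTop 0] with n hn
      refine ae_of_all _ fun v => ?_
      have hn0 : (0 : ℝ) < n := by exact_mod_cast hn
      have hn' : (0 : ℝ) < √n := Real.sqrt_pos.2 hn0
      simp only [hF]
      rw [norm_mul, norm_mul, norm_mul, Complex.norm_real, Complex.norm_exp,
        Real.norm_of_nonneg (by positivity)]
      have e1 := re_sq_ge_of_norm_sub_le (w := γ x - γ (x + v / √n)) (d := x - (x + v / √n)) (by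
        have := h.norm_chord x (x + v / √n)
        push_cast at this ⊢
        linarith [abs_nonneg (x - (x + v / √n))])
      have e2 : (x - (x + v / √n)) ^ 2 = v ^ 2 / n := by
        rw [show x - (x + v / √n) = -(v / √n) by ring, neg_sq, div_pow, Real.sq_sqrt hn0.le]
      rw [e2] at e1
      gcongr
      · exact hC _
      · exact h.norm_deriv_le _
      · have e3 : (-((n : ℂ) * (γ x - γ (x + v / √n)) ^ 2)).re =
            -(n * ((γ x - γ (x + v / √n)) ^ 2).re) := by simp
        rw [e3]
        have := mul_le_mul_of_nonneg_left e1 hn0.le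
        rw [show (n : ℝ) * (v ^ 2 / n / 2) = v ^ 2 / 2 by field_simp] at this
        linarith
    · have hsq : Tendsto (fun n : ℕ => √(n : ℝ)) atTop atTop :=
        Real.tendsto_sqrt_atTop.comp tendsto_natCast_atTop_atTop
      have h0 : Tendsto (fun n : ℕ => v / √n) atTop (𝓝 0) := hsq.const_div_atTop v
      have hx : Tendsto (fun n : ℕ => x + v / √n) atTop (𝓝 x) := by
        simpa using h0.const_add x
      have hsl : Tendsto (fun n : ℕ => (n : ℂ) * (γ x - γ (x + v / √n)) ^ 2) atTop
          (𝓝 (γ' x ^ 2 * v ^ 2)) := by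
        rcases eq_or_ne v 0 with rfl | hv
        · simp
        have h1 : Tendsto (fun n : ℕ => (v / √n)⁻¹ • (γ (x + v / √n) - γ x)) atTop
            (𝓝 (γ' x)) := by
          refine (hasDerivAt_iff_tendsto_slope_zero.1 (h.hasDerivAt x)).comp
            (tendsto_nhdsWithin_iff.2 ⟨h0, ?_⟩)
          filter_upwards [eventually_gt_atTop 0] with n hn
          have hn' : (0 : ℝ) < √n := Real.sqrt_pos.2 (by exact_mod_cast hn)
          exact div_ne_zero hv hn'.ne'
        refine ((h1.pow 2).mul_const ((v : ℂ) ^ 2)).congr' ?_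
        filter_upwards [eventually_gt_atTop 0] with n hn
        have hn0 : (0 : ℝ) < n := by exact_mod_cast hn
        have hn' : (√n : ℂ) ≠ 0 := by exact_mod_cast (Real.sqrt_pos.2 hn0).ne'
        have hv' : (v : ℂ) ≠ 0 := by exact_mod_cast hv
        rw [Complex.real_smul]
        have e : ((n : ℕ) : ℂ) = (√n : ℂ) ^ 2 := by
          rw [← ofReal_pow, Real.sq_sqrt hn0.le, ofReal_natCast]
        rw [e]
        push_cast
        field_simp
        ring
      refine Tendsto.const_mul _ (Tendsto.mul ?_ ?_)
      · exact ((hf.tendsto x).comp hx).mul ((hγ'c.tendsto x).comp hx)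
      · rw [neg_mul]
        exact (Complex.continuous_exp.tendsto _).comp hsl.neg
  have hval : ∫ v : ℝ, ((1 / √Real.pi : ℝ) : ℂ) * (f x * γ' x * exp (-(γ' x ^ 2) * v ^ 2)) =
      f x := by
    have hnear := h.near_one x
    have hre : 9 / 10 ≤ (γ' x).re := by
      have := (abs_le.1 ((Complex.abs_re_le_norm _).trans hnear)).1
      simp at this
      linarith
    have hγ0 : γ' x ≠ 0 := by
      intro h0
      rw [h0] at hre
      norm_num at hre
    have hre2 : 0 < (γ' x ^ 2).re := by
      have := re_sq_ge_of_norm_sub_le (w := γ' x) (d := 1) (by norm_num; linarith)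
      linarith
    rw [integral_const_mul, integral_const_mul, integral_gaussian_complex hre2]
    have e1 : (Real.pi : ℂ) / γ' x ^ 2 = ((√Real.pi : ℂ) / γ' x) ^ 2 := by
      rw [div_pow, ← ofReal_pow, Real.sq_sqrt hπ.le]
    have e2 : 0 < ((√Real.pi : ℂ) / γ' x).re := by
      rw [Complex.div_re]
      simp only [ofReal_re, ofReal_im, zero_mul, zero_div, add_zero]
      have : 0 < normSq (γ' x) := normSq_pos.2 hγ0
      have : 0 < (γ' x).re := by linarith
      positivity
    rw [e1, one_div 2, Complex.sq_cpow_two_inv e2]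
    have : (√Real.pi : ℂ) ≠ 0 := by exact_mod_cast (Real.sqrt_pos.2 hπ).ne'
    push_cast
    field_simp
  rw [hval] at hlim
  refine hlim.congr' ?_
  filter_upwards [eventually_gt_atTop 0] with n hn
  exact (hsub n hn).symm

/-- Gaussian integrals along a nice curve are an approximate identity in the mean. -/
theorem tendsto_integral_norm_gaussKer_sub (h : NiceCurve γ γ' K) {f : ℝ → ℂ}
    (hf : Integrable f) (r : ℝ) :
    Tendsto (fun n : ℕ => ∫ x in Icc (-r) r, ‖(∫ y, f y * γ' y * gaussKer n (γ x - γ y)) - f x‖)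
      atTop (𝓝 0) := by
  rw [Metric.tendsto_nhds]
  intro ε hε
  obtain ⟨g, hgs, hfg, hgc, hgi⟩ :=
    hf.exists_hasCompactSupport_integral_sub_le (show 0 < ε / 4 by positivity)
  obtain ⟨C, hC⟩ := hgs.exists_bound_of_continuous hgc
  have hT : ∀ n : ℕ, ∀ {k : ℝ → ℂ}, Integrable k →
      Integrable fun x => ∫ y, k y * γ' y * gaussKer n (γ x - γ y) := fun n k hk =>
    (h.integrable_prod_gaussKer n hk).integral_prod_left
  have hglim : Tendsto (fun n : ℕ => ∫ x in Icc (-r) r,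
      ‖(∫ y, g y * γ' y * gaussKer n (γ x - γ y)) - g x‖) atTop (𝓝 0) := by
    have := tendsto_integral_of_dominated_convergence (μ := volume.restrict (Icc (-r) r))
      (F := fun n x => ‖(∫ y, g y * γ' y * gaussKer n (γ x - γ y)) - g x‖) (f := fun _ => 0)
      (fun _ => 3 * C) (fun n => ((hT n hgi).sub hgi).norm.aestronglyMeasurable.restrict)
      (integrable_const _) (fun n => ae_of_all _ fun x => by
        rw [norm_norm]
        refine (_root_.norm_sub_le _ _).trans ?_
        have := h.norm_integral_gaussKer_le n hC x
        linarith [hC x])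
      (ae_of_all _ fun x => by
        have := (h.tendsto_integral_gaussKer_of_continuous hgc hC x).sub_const (g x)
        simpa using this.norm)
    simpa using this
  filter_upwards [hglim.eventually (gt_mem_nhds (show 0 < ε / 8 by positivity))] with n hn
  rw [Real.dist_eq, sub_zero, abs_of_nonneg (integral_nonneg fun _ => norm_nonneg _)]
  have hd : Integrable fun y => f y - g y := hf.sub hgi
  have hsplit : ∀ᵐ x, (∫ y, f y * γ' y * gaussKer n (γ x - γ y)) =
      (∫ y, (f y - g y) * γ' y * gaussKer n (γ x - γ y)) +
      ∫ y, g y * γ' y * gaussKer n (γ x - γ y) := by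
    filter_upwards [(h.integrable_prod_gaussKer n hd).prod_right_ae,
      (h.integrable_prod_gaussKer n hgi).prod_right_ae] with x h1 h2
    rw [← integral_add h1 h2]
    refine integral_congr_ae (ae_of_all _ fun y => ?_)
    simp only
    ring
  have i1 := (hT n hd).norm
  have i2 : Integrable fun x => ‖(∫ y, g y * γ' y * gaussKer n (γ x - γ y)) - g x‖ :=
    ((hT n hgi).sub hgi).norm
  have i3 := hd.norm
  have hle : ∫ x in Icc (-r) r, ‖(∫ y, f y * γ' y * gaussKer n (γ x - γ y)) - f x‖ ≤
      ∫ x in Icc (-r) r, (‖∫ y, (f y - g y) * γ' y * gaussKer n (γ x - γ y)‖ +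
        ‖(∫ y, g y * γ' y * gaussKer n (γ x - γ y)) - g x‖ + ‖f x - g x‖) := by
    refine integral_mono_ae ((hT n hf).sub hf).norm.restrict
      ((i1.fun_add i2).fun_add i3).restrict ?_
    filter_upwards [ae_restrict_of_ae hsplit] with x hx
    rw [hx, norm_sub_rev (f x)]
    refine le_trans (le_of_eq ?_) norm_add₃_le
    congr 1
    ring
  rw [integral_add (i1.fun_add i2).restrict i3.restrict, integral_add i1.restrict i2.restrict]
    at hle
  have b1 := (setIntegral_le_integral (s := Icc (-r) r) i1 (ae_of_all _ fun _ => norm_nonneg _)).trans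
    (h.integral_norm_integral_gaussKer_le n hd)
  have b3 := setIntegral_le_integral (s := Icc (-r) r) i3 (ae_of_all _ fun _ => norm_nonneg _)
  linarith

end NiceCurve

/-- A globally defined normalized first integral of `∂/∂y + a ∂/∂x` near the origin. -/
structure IsFirstIntegral (a Z : ℝ × ℝ → ℂ) (K M ρ : ℝ) : Prop where
  contDiff : ContDiff ℝ (⊤ : ℕ∞) Z
  map_zero : Z (0, 0) = 0
  near_one : ∀ p, ‖pdx Z p - 1‖ ≤ 1 / 10
  norm_pdy_le : ∀ p, ‖pdy Z p‖ ≤ M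
  lipschitz : ∀ p q, ‖pdx Z p - pdx Z q‖ ≤ K * dist p q
  nonneg : 0 ≤ K
  pos : 0 < ρ
  eq_zero : ∀ p ∈ Metric.ball (0 : ℝ × ℝ) ρ, pdy Z p + a p * pdx Z p = 0

theorem fderiv_apply_eq_pdx_pdy (f : ℝ × ℝ → ℂ) (p v : ℝ × ℝ) :
    fderiv ℝ f p v = v.1 * pdx f p + v.2 * pdy f p := by
  have : v = v.1 • ((1, 0) : ℝ × ℝ) + v.2 • ((0, 1) : ℝ × ℝ) := by ext <;> simp
  conv_lhs => rw [this]
  rw [map_add, map_smul, map_smul]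
  simp [pdx, pdy]

/-- A function vanishing to second order at the origin agrees near the origin with a compactly
supported smooth function of small derivative. -/
theorem exists_contDiff_small_fderiv {U : Set (ℝ × ℝ)} (hU : IsOpen U) (h0 : (0 : ℝ × ℝ) ∈ U)
    {W : ℝ × ℝ → ℂ} (hW : ContDiffOn ℝ (⊤ : ℕ∞) W U) (hW0 : W 0 = 0) (hW1 : fderiv ℝ W 0 = 0)
    {ε : ℝ} (hε : 0 < ε) :
    ∃ F : ℝ × ℝ → ℂ, ContDiff ℝ (⊤ : ℕ∞) F ∧ HasCompactSupport F ∧ (∀ p, ‖fderiv ℝ F p‖ ≤ ε) ∧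
      ∃ r : ℝ, 0 < r ∧ Metric.ball (0 : ℝ × ℝ) r ⊆ U ∧ ∀ p ∈ Metric.ball (0 : ℝ × ℝ) r,
        F p = W p := by
  let β : ContDiffBump (0 : ℝ × ℝ) := ⟨1, 2, by norm_num, by norm_num⟩
  have hβs : ContDiff ℝ (⊤ : ℕ∞) β := β.contDiff
  obtain ⟨B, hB⟩ := (β.hasCompactSupport.fderiv (𝕜 := ℝ)).exists_bound_of_continuous
    (hβs.continuous_fderiv (by simp))
  have hB0 : 0 ≤ B := (norm_nonneg _).trans (hB 0)
  set ε' : ℝ := ε / (2 * B + 1) with hε'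
  have hε'0 : 0 < ε' := by positivity
  have hcont : ContinuousAt (fderiv ℝ W) 0 :=
    ((hW.continuousOn_fderiv_of_isOpen hU (by simp)).continuousAt (hU.mem_nhds h0))
  have hev : ∀ᶠ p in 𝓝 (0 : ℝ × ℝ), p ∈ U ∧ ‖fderiv ℝ W p‖ < ε' := by
    refine (hU.eventually_mem h0).and ?_
    have := hcont.norm
    rw [ContinuousAt, hW1, norm_zero] at this
    exact this.eventually (gt_mem_nhds hε'0)
  obtain ⟨s, hs, hsU⟩ := Metric.eventually_nhds_iff_ball.1 hev
  have hr : 0 < s / 3 := by positivity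
  set r := s / 3 with hrdef
  have hWd : ∀ p ∈ Metric.ball (0 : ℝ × ℝ) s, DifferentiableAt ℝ W p := fun p hp =>
    (hW.contDiffAt (hU.mem_nhds (hsU p hp).1)).differentiableAt (by simp)
  have hWb : ∀ p ∈ Metric.ball (0 : ℝ × ℝ) s, ‖W p‖ ≤ ε' * ‖p‖ := by
    intro p hp
    have := (convex_ball (0 : ℝ × ℝ) s).norm_image_sub_le_of_norm_fderiv_le (𝕜 := ℝ) hWd
      (fun q hq => (hsU q hq).2.le) (Metric.mem_ball_self hs) hp
    simpa [hW0] using this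
  set F : ℝ × ℝ → ℂ := fun p => β (r⁻¹ • p) • W p with hF
  have hβout : ∀ p : ℝ × ℝ, 2 * r ≤ ‖p‖ → β (r⁻¹ • p) = 0 := by
    intro p hp
    refine β.zero_of_le_dist ?_
    show (2 : ℝ) ≤ dist (r⁻¹ • p) 0
    rw [dist_zero_right, norm_smul, Real.norm_of_nonneg (by positivity), inv_mul_eq_div,
      le_div_iff₀ hr]
    exact hp
  have hβr : ContDiff ℝ (⊤ : ℕ∞) fun p : ℝ × ℝ => β (r⁻¹ • p) :=
    hβs.comp (contDiff_const_smul r⁻¹)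
  have hFout : ∀ p : ℝ × ℝ, 2 * r < ‖p‖ → F =ᶠ[𝓝 p] fun _ => 0 := by
    intro p hp
    filter_upwards [(isOpen_lt continuous_const continuous_norm).mem_nhds hp] with q hq
    simp only [hF]
    rw [hβout q (le_of_lt hq), zero_smul]
  have hin : ∀ p : ℝ × ℝ, ‖p‖ ≤ 2 * r → p ∈ Metric.ball (0 : ℝ × ℝ) s := by
    intro p hp
    rw [mem_ball_zero_iff]
    linarith
  refine ⟨F, ?_, ?_, ?_, r, hr, ?_, ?_⟩
  · rw [contDiff_iff_contDiffAt]
    intro p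
    rcases lt_or_ge (2 * r) ‖p‖ with hp | hp
    · exact contDiffAt_const.congr_of_eventuallyEq (hFout p hp)
    · exact hβr.contDiffAt.smul (hW.contDiffAt (hU.mem_nhds (hsU p (hin p hp)).1))
  · refine HasCompactSupport.intro (isCompact_closedBall (0 : ℝ × ℝ) (2 * r)) fun p hp => ?_
    rw [mem_closedBall_zero_iff, not_le] at hp
    simp only [hF]
    rw [hβout p hp.le, zero_smul]
  · intro p
    rcases lt_or_ge (2 * r) ‖p‖ with hp | hp
    · rw [(hFout p hp).fderiv_eq]
      simp [hε.le]
    · have hps := hin p hp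
      have h1 : HasFDerivAt (fun p : ℝ × ℝ => β (r⁻¹ • p))
          ((fderiv ℝ β (r⁻¹ • p)).comp (r⁻¹ • ContinuousLinearMap.id ℝ (ℝ × ℝ))) p := by
        have hd : DifferentiableAt ℝ β (r⁻¹ • p) := hβs.differentiable (by simp) _
        exact HasFDerivAt.comp (g := β) (f := fun p : ℝ × ℝ => r⁻¹ • p) p hd.hasFDerivAt
          ((hasFDerivAt_id p).const_smul r⁻¹)
      have h2 := h1.smul (hWd p hps).hasFDerivAt
      have h2' : fderiv ℝ F p = _ := h2.fderiv
      rw [h2']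
      refine (norm_add_le _ _).trans ?_
      rw [norm_smul, ContinuousLinearMap.norm_smulRight_apply]
      have e1 : ‖β (r⁻¹ • p)‖ ≤ 1 := by
        rw [Real.norm_of_nonneg β.nonneg]
        exact β.le_one
      have e2 : ‖(fderiv ℝ β (r⁻¹ • p)).comp (r⁻¹ • ContinuousLinearMap.id ℝ (ℝ × ℝ))‖ ≤
          B * r⁻¹ := by
        refine (ContinuousLinearMap.opNorm_comp_le _ _).trans ?_
        refine mul_le_mul (hB _) ?_ (norm_nonneg _) hB0
        rw [norm_smul, Real.norm_of_nonneg (by positivity)]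
        have := ContinuousLinearMap.norm_id_le (𝕜 := ℝ) (E := ℝ × ℝ)
        have hr' : 0 ≤ r⁻¹ := by positivity
        nlinarith
      have e3 : ‖W p‖ ≤ ε' * (2 * r) := (hWb p hps).trans (by gcongr)
      calc _ ≤ 1 * ε' + B * r⁻¹ * (ε' * (2 * r)) := by
            gcongr
            exact (hsU p hps).2.le
        _ = ε := by rw [hε']; field_simp; ring
  · intro p hp
    exact (hsU p (Metric.ball_subset_ball (by linarith) hp)).1
  · intro p hp
    simp only [hF]
    have : β (r⁻¹ • p) = 1 := by
      refine β.one_of_mem_closedBall ?_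
      rw [mem_closedBall_zero_iff, norm_smul, Real.norm_of_nonneg (by positivity), inv_mul_eq_div]
      rw [mem_ball_zero_iff] at hp
      exact ((div_lt_one hr).2 hp).le
    rw [this, one_smul]

theorem LocallyIntegrableAtOrigin.exists_isFirstIntegral {a : ℝ × ℝ → ℂ}
    (h : LocallyIntegrableAtOrigin a) :
    ∃ (Z : ℝ × ℝ → ℂ) (K M ρ : ℝ), IsFirstIntegral a Z K M ρ := by
  obtain ⟨U, hU, h0, Z, hZ, hZa, hZ0⟩ := h
  have h0' : (0 : ℝ × ℝ) ∈ U := h0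
  have hx0 : pdx Z (0, 0) ≠ 0 := by
    intro hx
    refine hZ0 (ContinuousLinearMap.ext fun v => ?_)
    have := hZa _ h0
    rw [hx, mul_zero, add_zero] at this
    rw [fderiv_apply_eq_pdx_pdy, hx, this]
    simp
  set c₁ := pdx Z (0, 0) with hc₁
  set T : ℝ × ℝ →L[ℝ] ℂ := c₁⁻¹ • fderiv ℝ Z 0 with hT
  have hT1 : T (1, 0) = 1 := by
    show c₁⁻¹ * pdx Z (0, 0) = 1
    rw [← hc₁, inv_mul_cancel₀ hx0]
  set W : ℝ × ℝ → ℂ := fun p => c₁⁻¹ • (Z p - Z 0) - T p with hW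
  have hZd : ∀ p ∈ U, HasFDerivAt Z (fderiv ℝ Z p) p := fun p hp =>
    ((hZ.contDiffAt (hU.mem_nhds hp)).differentiableAt (by simp)).hasFDerivAt
  have hWd : ∀ p ∈ U, HasFDerivAt W (c₁⁻¹ • fderiv ℝ Z p - T) p := fun p hp =>
    (((hZd p hp).sub_const _).const_smul c₁⁻¹).sub T.hasFDerivAt
  obtain ⟨F, hFs, hFc, hFε, r, hr, hrU, hFW⟩ := exists_contDiff_small_fderiv hU h0'
    (W := W) (by
      refine ContDiffOn.sub (ContDiffOn.const_smul c₁⁻¹ (hZ.sub contDiffOn_const)) ?_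
      exact T.contDiff.contDiffOn) (by simp [hW])
    (by rw [(hWd 0 h0').fderiv, hT, sub_self]) (ε := 1 / 10) (by norm_num)
  have hFd : ∀ p, HasFDerivAt F (fderiv ℝ F p) p := fun p =>
    (hFs.differentiable (by simp) p).hasFDerivAt
  have hG : ∀ p, fderiv ℝ (fun p => T p + F p) p = T + fderiv ℝ F p := fun p =>
    (T.hasFDerivAt.add (hFd p)).fderiv
  have hv1 : ‖((1, 0) : ℝ × ℝ)‖ ≤ 1 := by simp [Prod.norm_def]
  have hv2 : ‖((0, 1) : ℝ × ℝ)‖ ≤ 1 := by simp [Prod.norm_def]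
  have hap : ∀ p, ∀ v : ℝ × ℝ, ‖v‖ ≤ 1 → ‖fderiv ℝ F p v‖ ≤ 1 / 10 := fun p v hv => by
    refine ((fderiv ℝ F p).le_opNorm v).trans ?_
    have := mul_le_mul (hFε p) hv (norm_nonneg _) (by norm_num)
    linarith
  have hF1 : ContDiff ℝ 1 (fderiv ℝ F) := hFs.fderiv_right (by norm_cast)
  obtain ⟨K, hK⟩ := hF1.lipschitzWith_of_hasCompactSupport (hFc.fderiv (𝕜 := ℝ)) (by simp)
  refine ⟨fun p => T p + F p, K, ‖T (0, 1)‖ + 1 / 10, r, ?_⟩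
  refine ⟨T.contDiff.add hFs, ?_, ?_, ?_, ?_, K.2, hr, ?_⟩
  · have := hFW 0 (Metric.mem_ball_self hr)
    show T 0 + F 0 = 0
    rw [this]
    simp [hW]
  · intro p
    rw [pdx, hG]
    simpa [hT1] using hap p _ hv1
  · intro p
    rw [pdy, hG]
    exact (norm_add_le _ _).trans (add_le_add_right (hap p _ hv2) _)
  · intro p q
    rw [pdx, pdx, hG, hG]
    have e : (T + fderiv ℝ F p) (1, 0) - (T + fderiv ℝ F q) (1, 0) =
        (fderiv ℝ F p - fderiv ℝ F q) (1, 0) := by simp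
    rw [e]
    refine (ContinuousLinearMap.le_opNorm _ _).trans ?_
    have := hK.dist_le_mul p q
    rw [dist_eq_norm] at this
    calc _ ≤ ‖fderiv ℝ F p - fderiv ℝ F q‖ * 1 := by gcongr
      _ ≤ _ := by rw [mul_one]; exact this
  · intro p hp
    have hpU := hrU hp
    have heq : (fun p => T p + F p) =ᶠ[𝓝 p] fun p => c₁⁻¹ • (Z p - Z 0) := by
      filter_upwards [Metric.isOpen_ball.mem_nhds hp] with q hq
      rw [hFW q hq, hW]
      ring
    have hd : fderiv ℝ (fun p => T p + F p) p = c₁⁻¹ • fderiv ℝ Z p := by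
      rw [heq.fderiv_eq]
      exact (((hZd p hpU).sub_const _).const_smul c₁⁻¹).fderiv
    rw [pdx, pdy, hd]
    have := hZa p hpU
    simp only [_root_.smul_apply, smul_eq_mul]
    rw [pdx, pdy] at this
    linear_combination c₁⁻¹ * this

namespace IsFirstIntegral

variable {a Z : ℝ × ℝ → ℂ} {K M ρ : ℝ}

theorem hasFDerivAt (h : IsFirstIntegral a Z K M ρ) (p : ℝ × ℝ) :
    HasFDerivAt Z (fderiv ℝ Z p) p :=
  (h.contDiff.differentiable (by simp) p).hasFDerivAt

theorem hasDerivAt_fst (h : IsFirstIntegral a Z K M ρ) (x y : ℝ) :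
    HasDerivAt (fun x => Z (x, y)) (pdx Z (x, y)) x :=
  (h.hasFDerivAt (x, y)).comp_hasDerivAt x ((hasDerivAt_id x).prodMk (hasDerivAt_const x y))

theorem hasDerivAt_snd (h : IsFirstIntegral a Z K M ρ) (x y : ℝ) :
    HasDerivAt (fun y => Z (x, y)) (pdy Z (x, y)) y :=
  (h.hasFDerivAt (x, y)).comp_hasDerivAt y ((hasDerivAt_const y x).prodMk (hasDerivAt_id y))

theorem niceCurve (h : IsFirstIntegral a Z K M ρ) (y : ℝ) :
    NiceCurve (fun x => Z (x, y)) (fun x => pdx Z (x, y)) K where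
  hasDerivAt x := h.hasDerivAt_fst x y
  near_one x := h.near_one (x, y)
  lipschitz x x' := by
    have := h.lipschitz (x, y) (x', y)
    simpa [Prod.dist_eq, Real.dist_eq] using this
  nonneg := h.nonneg

theorem norm_sub_le_snd (h : IsFirstIntegral a Z K M ρ) (x y y' : ℝ) :
    ‖Z (x, y) - Z (x, y')‖ ≤ M * |y - y'| := by
  have := convex_univ.norm_image_sub_le_of_norm_hasDerivWithin_le (f := fun y => Z (x, y))
    (f' := fun y => pdy Z (x, y)) (C := M)
    (fun y _ => (h.hasDerivAt_snd x y).hasDerivWithinAt) (fun y _ => h.norm_pdy_le (x, y))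
    (mem_univ y') (mem_univ y)
  simpa using this

theorem nonneg_bound (h : IsFirstIntegral a Z K M ρ) : 0 ≤ M :=
  (norm_nonneg _).trans (h.norm_pdy_le 0)

theorem le_norm_sub_fst (h : IsFirstIntegral a Z K M ρ) (x x' y : ℝ) :
    9 / 10 * |x - x'| ≤ ‖Z (x, y) - Z (x', y)‖ := by
  have h1 := (h.niceCurve y).norm_chord x x'
  have h2 : ‖((x - x' : ℝ) : ℂ)‖ = |x - x'| := by simp only [norm_real, Real.norm_eq_abs]
  have h3 := norm_sub_norm_le ((x - x' : ℝ) : ℂ) (Z (x, y) - Z (x', y))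
  rw [norm_sub_rev ((x - x' : ℝ) : ℂ)] at h3
  linarith

theorem abs_sub_le_of_eq_zero (h : IsFirstIntegral a Z K M ρ) {x y x' y' : ℝ}
    (hz : Z (x, y) = 0) (hz' : Z (x', y') = 0) : |x - x'| ≤ 2 * M * |y - y'| := by
  have h1 := h.le_norm_sub_fst x x' y
  have h2 := h.norm_sub_le_snd x' y y'
  rw [hz, zero_sub, norm_neg] at h1
  rw [hz', sub_zero] at h2
  have := mul_nonneg h.nonneg_bound (abs_nonneg (y - y'))
  linarith

theorem pdx_ne_zero (h : IsFirstIntegral a Z K M ρ) (p : ℝ × ℝ) : pdx Z p ≠ 0 := by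
  intro h0
  have := h.near_one p
  rw [h0] at this
  norm_num at this

/-- A curve of zeros of the first integral is an integral curve of `∂/∂y + a ∂/∂x`. -/
theorem hasDerivWithinAt_of_eq_zero (h : IsFirstIntegral a Z K M ρ) {q : ℝ → ℝ} {S : Set ℝ}
    (hq : ∀ y ∈ S, Z (q y, y) = 0) {y : ℝ} (hy : y ∈ S)
    (hyρ : (q y, y) ∈ Metric.ball (0 : ℝ × ℝ) ρ) :
    HasDerivWithinAt (fun y => (q y : ℂ)) (a (q y, y)) S y := by
  have hO : (fun y' => (q y', y') - (q y, y)) =O[𝓝[S] y] fun y' => y' - y := by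
    refine Asymptotics.IsBigO.of_bound (2 * M + 1) ?_
    filter_upwards [self_mem_nhdsWithin] with y' hy'
    have := h.abs_sub_le_of_eq_zero (hq y' hy') (hq y hy)
    have hM := mul_nonneg h.nonneg_bound (abs_nonneg (y' - y))
    rw [Prod.mk_sub_mk, Prod.norm_def]
    simp only [Real.norm_eq_abs]
    refine max_le ?_ ?_
    · linarith [abs_nonneg (y' - y)]
    · linarith
  have ht : Tendsto (fun y' => (q y', y')) (𝓝[S] y) (𝓝 (q y, y)) := by
    rw [tendsto_iff_norm_sub_tendsto_zero]
    refine (hO.trans_tendsto ?_).norm.trans (by simp)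
    have : Tendsto (fun y' => y' - y) (𝓝 y) (𝓝 (y - y)) := (continuous_id.sub continuous_const).tendsto y
    rw [sub_self] at this
    exact this.mono_left nhdsWithin_le_nhds
  have ho := ((h.hasFDerivAt (q y, y)).isLittleO.comp_tendsto ht).trans_isBigO hO
  rw [hasDerivWithinAt_iff_isLittleO]
  have ho2 := ho.const_mul_left (-(pdx Z (q y, y))⁻¹)
  refine ho2.congr' ?_ EventuallyEq.rfl
  filter_upwards [self_mem_nhdsWithin] with y' hy'
  have h1 := h.pdx_ne_zero (q y, y)
  have h2 := h.eq_zero _ hyρ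
  simp only [Function.comp, hq y' hy', hq y hy, fderiv_apply_eq_pdx_pdy, Prod.mk_sub_mk,
    real_smul]
  rw [show pdy Z (q y, y) = -(a (q y, y) * pdx Z (q y, y)) from by linear_combination h2]
  field_simp
  push_cast
  ring

/-- If elliptic points accumulate at the origin along the integral curve of the real part, then
the first integral omits the value `0` on some nearby horizontal line. -/
theorem exists_forall_ne_zero (h : IsFirstIntegral a Z K M ρ)
    (ha : ContDiffAt ℝ 1 a (0 : ℝ × ℝ)) {η : ℝ} (hη : 0 < η) {g : ℝ → ℝ} (hg0 : g 0 = 0)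
    (hg : ∀ y ∈ Ico 0 η, HasDerivAt g (a (g y, y)).re y)
    (hell : ∃ᶠ y in 𝓝[>] 0, (a (g y, y)).im ≠ 0) {ε : ℝ} (hε : 0 < ε) :
    ∃ y ∈ Ioo 0 ε, ∀ x, Z (x, y) ≠ 0 := by
  by_contra! hcon
  have hex : ∀ y, ∃ x, y ∈ Ico 0 ε → Z (x, y) = 0 := by
    intro y
    by_cases hy : y ∈ Ioo 0 ε
    · obtain ⟨x, hx⟩ := hcon y hy
      exact ⟨x, fun _ => hx⟩
    · refine ⟨0, fun hy' => ?_⟩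
      rcases hy'.1.eq_or_lt with h0 | h0
      · rw [← h0]; exact h.map_zero
      · exact absurd ⟨h0, hy'.2⟩ hy
  choose q hq using hex
  have hq0 : q 0 = 0 := by
    have := h.abs_sub_le_of_eq_zero (hq 0 ⟨le_rfl, hε⟩) h.map_zero
    simpa using this
  have hqb : ∀ y ∈ Ico 0 ε, |q y| ≤ 2 * M * y := by
    intro y hy
    have := h.abs_sub_le_of_eq_zero (hq y hy) h.map_zero
    rwa [sub_zero, sub_zero, abs_of_nonneg hy.1] at this
  obtain ⟨L, t, ht, hL⟩ := ha.exists_lipschitzOnWith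
  obtain ⟨r, hr, hrt⟩ := Metric.mem_nhds_iff.1 ht
  have hev1 : ∀ᶠ y in 𝓝[>] (0 : ℝ), ∀ y' ∈ Icc 0 y, |g y'| < r ∧ |q y'| < r ∧
      |q y'| < ρ ∧ y' < r ∧ y' < ρ ∧ y' < ε ∧ y' < η := by
    have hgc : ∀ᶠ y in 𝓝 (0 : ℝ), |g y| < r := by
      have : Tendsto (fun y => |g y|) (𝓝 0) (𝓝 |g 0|) :=
        ((hg 0 ⟨le_rfl, hη⟩).continuousAt).abs
      rw [hg0, abs_zero] at this
      exact this.eventually (gt_mem_nhds hr)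
    have hM : ∀ s : ℝ, 0 < s → ∀ᶠ y in 𝓝 (0 : ℝ), 2 * M * y < s := by
      intro s hs
      have : Tendsto (fun y => 2 * M * y) (𝓝 0) (𝓝 (2 * M * 0)) :=
        (continuous_const.mul continuous_id).tendsto 0
      rw [mul_zero] at this
      exact this.eventually (gt_mem_nhds hs)
    have hall := hgc.and ((hM r hr).and ((hM ρ h.pos).and ((gt_mem_nhds hr).and
      ((gt_mem_nhds h.pos).and ((gt_mem_nhds hε).and (gt_mem_nhds hη))))))
    obtain ⟨s, hs, hsb⟩ := Metric.eventually_nhds_iff_ball.1 hall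
    filter_upwards [Ioo_mem_nhdsGT hs] with y hy y' hy'
    obtain ⟨h1, h2, h3, h4, h5, h6, h7⟩ := hsb y' (by
      rw [mem_ball_zero_iff, Real.norm_eq_abs, abs_of_nonneg hy'.1]
      exact hy'.2.trans_lt hy.2)
    have := hqb y' ⟨hy'.1, h6⟩
    exact ⟨h1, this.trans_lt h2, this.trans_lt h3, h4, h5, h6, h7⟩
  obtain ⟨b, him, hb, hb0⟩ := (hell.and_eventually (hev1.and self_mem_nhdsWithin)).exists
  have hb0' : (0 : ℝ) < b := hb0
  have hqd : ∀ y ∈ Icc 0 b, HasDerivWithinAt (fun y => (q y : ℂ)) (a (q y, y)) (Ico 0 ε) y := by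
    intro y hy
    obtain ⟨h1, h2, h3, h4, h5, h6, h7⟩ := hb y hy
    refine h.hasDerivWithinAt_of_eq_zero (fun y hy => hq y hy) ⟨hy.1, h6⟩ ?_
    rw [mem_ball_zero_iff, Prod.norm_def]
    simpa [abs_of_nonneg hy.1] using ⟨h3, h5⟩
  have hqre : ∀ y ∈ Icc 0 b, HasDerivWithinAt q (a (q y, y)).re (Ico 0 ε) y := fun y hy => 
    reCLM.hasFDerivAt.comp_hasDerivWithinAt y (hqd y hy)
  have hqim : ∀ y ∈ Icc 0 b, (a (q y, y)).im = 0 := fun y hy => by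
    have h1 : HasDerivWithinAt (fun _ : ℝ => (0 : ℝ)) (a (q y, y)).im (Ico 0 ε) y := by
      have h2 := imCLM.hasFDerivAt.comp_hasDerivWithinAt y (hqd y hy)
      exact h2.congr_of_mem (fun z _ => (ofReal_im (q z)).symm) ⟨hy.1, (hb y hy).2.2.2.2.2.1⟩
    exact (uniqueDiffOn_Ico 0 ε y ⟨hy.1, (hb y hy).2.2.2.2.2.1⟩).eq_deriv _ h1
      (hasDerivWithinAt_const y _ 0)
  have heq : EqOn g q (Icc 0 b) := by
    refine ODE_solution_unique_of_mem_Icc_right (v := fun t x => (a (x, t)).re)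
      (s := fun _ => Metric.ball 0 r) (K := L) ?_ ?_ ?_ ?_ ?_ ?_ ?_ ?_
    · intro y hy
      refine LipschitzOnWith.of_dist_le_mul fun x hx x' hx' => ?_
      have hmem : ∀ x ∈ Metric.ball (0 : ℝ) r, (x, y) ∈ t := fun x hx => hrt (by
        rw [mem_ball_zero_iff] at hx ⊢
        rw [Prod.norm_def]
        have := (hb y (Ico_subset_Icc_self hy)).2.2.2.1
        simpa [abs_of_nonneg hy.1] using ⟨hx, this⟩)
      have h1 := hL.dist_le_mul _ (hmem x hx) _ (hmem x' hx')
      have h2 := abs_re_le_norm (a (x, y) - a (x', y))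
      rw [sub_re, ← dist_eq_norm] at h2
      refine h2.trans (h1.trans_eq ?_)
      simp [Prod.dist_eq]
    · exact fun y hy => (hg y ⟨hy.1, (hb y hy).2.2.2.2.2.2⟩).continuousAt.continuousWithinAt
    · exact fun y hy => (hg y ⟨hy.1, (hb y (Ico_subset_Icc_self hy)).2.2.2.2.2.2⟩).hasDerivWithinAt
    · exact fun y hy => by simpa using (hb y (Ico_subset_Icc_self hy)).1
    · exact fun y hy => (hqre y hy).continuousWithinAt.mono fun z hz =>
        ⟨hz.1, (hb z hz).2.2.2.2.2.1⟩
    · intro y hy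
      have hy' := Ico_subset_Icc_self hy
      refine (hqre y hy').mono_of_mem_nhdsWithin ?_
      refine mem_of_superset (Ico_mem_nhdsGE (hb y hy').2.2.2.2.2.1) (Ico_subset_Ico_left hy.1)
    · exact fun y hy => by simpa using (hb y (Ico_subset_Icc_self hy)).2.1
    · rw [hg0, hq0]
  refine him ?_
  rw [heq ⟨hb0'.le, le_rfl⟩]
  exact hqim b ⟨hb0'.le, le_rfl⟩

end IsFirstIntegral

namespace IsFirstIntegral

variable {a Z : ℝ × ℝ → ℂ} {K M ρ : ℝ}

theorem fderiv_conj_comp (h : IsFirstIntegral a Z K M ρ) (p v : ℝ × ℝ) :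
    fderiv ℝ (fun p => (starRingEnd ℂ) (Z p)) p v = (starRingEnd ℂ) (fderiv ℝ Z p v) := by
  have h1 : HasFDerivAt (fun p => (starRingEnd ℂ) (Z p)) _ p :=
    conjCLE.toContinuousLinearMap.hasFDerivAt.comp p (h.hasFDerivAt p)
  rw [h1.fderiv]
  rfl

theorem conj (h : IsFirstIntegral a Z K M ρ) :
    IsFirstIntegral (fun p => (starRingEnd ℂ) (a p)) (fun p => (starRingEnd ℂ) (Z p)) K M ρ where
  contDiff := conjCLE.contDiff.comp h.contDiff
  map_zero := by simp [h.map_zero]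
  near_one p := by
    rw [pdx, h.fderiv_conj_comp, ← map_one (starRingEnd ℂ), ← map_sub, norm_conj]
    exact h.near_one p
  norm_pdy_le p := by
    rw [pdy, h.fderiv_conj_comp, norm_conj]
    exact h.norm_pdy_le p
  lipschitz p q := by
    rw [pdx, pdx, h.fderiv_conj_comp, h.fderiv_conj_comp, ← map_sub, norm_conj]
    exact h.lipschitz p q
  nonneg := h.nonneg
  pos := h.pos
  eq_zero p hp := by
    rw [pdx, pdy, h.fderiv_conj_comp, h.fderiv_conj_comp, ← map_mul, ← map_add]
    exact (congrArg _ (h.eq_zero p hp)).trans (_root_.map_zero _)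

theorem le_abs_re_sub (h : IsFirstIntegral a Z K M ρ) (x x' y : ℝ) :
    9 / 10 * |x - x'| ≤ |(Z (x, y)).re - (Z (x', y)).re| := by
  have h1 := (abs_re_le_norm _).trans ((h.niceCurve y).norm_chord x x')
  rw [sub_re, ofReal_re, sub_re] at h1
  have h3 := abs_sub_abs_le_abs_sub (x - x') ((Z (x, y)).re - (Z (x', y)).re)
  rw [abs_sub_comm (x - x')] at h3
  linarith

theorem abs_im_sub_le (h : IsFirstIntegral a Z K M ρ) (x x' y : ℝ) :
    |(Z (x, y)).im - (Z (x', y)).im| ≤ |x - x'| / 10 := by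
  have h1 := (abs_im_le_norm _).trans ((h.niceCurve y).norm_chord x x')
  rwa [sub_im, ofReal_im, sub_im, sub_zero] at h1

/-- Points of a small disc above the curve `Z(·, 0)` are values of `Z` on a small rectangle, as
soon as a curve `Z(·, y₁)` passes well above the origin. -/
theorem exists_eq_of_im_ge (h : IsFirstIntegral a Z K M ρ) {x₁ y₁ R : ℝ} (hy₁ : 0 ≤ y₁)
    (hre : (Z (x₁, y₁)).re = 0) (him : 3 * R ≤ (Z (x₁, y₁)).im) {x t : ℝ} (ht : 0 ≤ t)
    (hz : ‖Z (x, 0) + t * I‖ ≤ R) :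
    ∃ x' y', y' ∈ Icc 0 y₁ ∧ |x'| ≤ 2 * (R + M * y₁) ∧ Z (x', y') = Z (x, 0) + t * I := by
  set z := Z (x, 0) + t * I with hzdef
  have hM := h.nonneg_bound
  have hR : 0 ≤ R := (norm_nonneg _).trans hz
  have hex : ∀ y, ∃ ξ, (Z (ξ, y)).re = z.re := fun y => (h.niceCurve y).surjective_re z.re
  choose ξ hξ using hex
  have hlip : ∀ y y', |ξ y - ξ y'| ≤ 2 * M * |y - y'| := by
    intro y y'
    have h1 := h.le_abs_re_sub (ξ y) (ξ y') y
    rw [hξ y, ← hξ y', ← sub_re] at h1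
    have h2 := (abs_re_le_norm _).trans (h.norm_sub_le_snd (ξ y') y' y)
    rw [abs_sub_comm y'] at h2
    have := mul_nonneg hM (abs_nonneg (y - y'))
    linarith
  have hcont : Continuous ξ := by
    refine (LipschitzWith.of_dist_le_mul (K := (2 * M).toNNReal) fun y y' => ?_).continuous
    rw [Real.coe_toNNReal _ (by positivity)]
    exact hlip y y'
  have hF : Continuous fun y => (Z (ξ y, y)).im :=
    continuous_im.comp (h.contDiff.continuous.comp (hcont.prodMk continuous_id))
  have hzre : |z.re| ≤ R := (abs_re_le_norm z).trans hz
  have hzim : |z.im| ≤ R := (abs_im_le_norm z).trans hz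
  have h0 : (Z (ξ 0, 0)).im ≤ z.im := by
    have hx0 : ξ 0 = x := (h.niceCurve 0).strictMono_re.injective (by
      simp only [hξ 0, hzdef, add_re, mul_re, ofReal_re, I_re, ofReal_im, I_im]; ring)
    rw [hx0, hzdef]
    simpa using ht
  have h1 : z.im ≤ (Z (ξ y₁, y₁)).im := by
    have e1 := h.le_abs_re_sub (ξ y₁) x₁ y₁
    rw [hξ, hre, sub_zero] at e1
    have e2 := (abs_le.1 (h.abs_im_sub_le (ξ y₁) x₁ y₁)).1
    have e3 := (abs_le.1 hzim).2
    linarith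
  obtain ⟨y, hy, hyz⟩ := intermediate_value_Icc hy₁ hF.continuousOn ⟨h0, h1⟩
  have hZ : Z (ξ y, y) = z := Complex.ext (hξ y) hyz
  refine ⟨ξ y, y, hy, ?_, hZ⟩
  have e1 := h.le_norm_sub_fst (ξ y) 0 y
  have e2 := h.norm_sub_le_snd 0 y 0
  have e3 := _root_.norm_sub_le (Z (ξ y, y)) (Z (0, y))
  rw [h.map_zero, sub_zero, sub_zero, abs_of_nonneg hy.1] at e2
  rw [hZ] at e1 e3
  rw [sub_zero] at e1
  have := mul_le_mul_of_nonneg_left hy.2 hM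
  have := mul_nonneg hM hy₁
  linarith

theorem exists_eq_of_im_le (h : IsFirstIntegral a Z K M ρ) {x₁ y₁ R : ℝ} (hy₁ : 0 ≤ y₁)
    (hre : (Z (x₁, y₁)).re = 0) (him : (Z (x₁, y₁)).im ≤ -(3 * R)) {x t : ℝ} (ht : 0 ≤ t)
    (hz : ‖Z (x, 0) - t * I‖ ≤ R) :
    ∃ x' y', y' ∈ Icc 0 y₁ ∧ |x'| ≤ 2 * (R + M * y₁) ∧ Z (x', y') = Z (x, 0) - t * I := by
  have hconj : (starRingEnd ℂ) (Z (x, 0)) + t * I = (starRingEnd ℂ) (Z (x, 0) - t * I) := by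
    simp
  obtain ⟨x', y', hy', hx', he⟩ := h.conj.exists_eq_of_im_ge hy₁ (by simpa using hre)
    (R := R) (x₁ := x₁) (by simp only [conj_im]; linarith) ht (x := x)
    (by rw [hconj, norm_conj]; exact hz)
  refine ⟨x', y', hy', hx', ?_⟩
  rw [hconj] at he
  exact (starRingEnd ℂ).injective he

end IsFirstIntegral

theorem hasDerivAt_pdx {f : ℝ × ℝ → ℂ} {p : ℝ × ℝ} (hf : DifferentiableAt ℝ f p) :
    HasDerivAt (fun x => f (x, p.2)) (pdx f p) p.1 :=
  hf.hasFDerivAt.comp_hasDerivAt p.1 ((hasDerivAt_id p.1).prodMk (hasDerivAt_const p.1 p.2))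

theorem hasDerivAt_pdy {f : ℝ × ℝ → ℂ} {p : ℝ × ℝ} (hf : DifferentiableAt ℝ f p) :
    HasDerivAt (fun y => f (p.1, y)) (pdy f p) p.2 :=
  hf.hasFDerivAt.comp_hasDerivAt p.2 ((hasDerivAt_const p.2 p.1).prodMk (hasDerivAt_id p.2))

theorem contDiff_pdx {f : ℝ × ℝ → ℂ} (hf : ContDiff ℝ (⊤ : ℕ∞) f) :
    ContDiff ℝ (⊤ : ℕ∞) (pdx f) :=
  (hf.fderiv_right (m := (⊤ : ℕ∞)) (by simp)).clm_apply contDiff_const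

theorem contDiff_pdy {f : ℝ × ℝ → ℂ} (hf : ContDiff ℝ (⊤ : ℕ∞) f) :
    ContDiff ℝ (⊤ : ℕ∞) (pdy f) :=
  (hf.fderiv_right (m := (⊤ : ℕ∞)) (by simp)).clm_apply contDiff_const

theorem pdx_pdy_comm {f : ℝ × ℝ → ℂ} (hf : ContDiff ℝ (⊤ : ℕ∞) f) (p : ℝ × ℝ) :
    pdx (pdy f) p = pdy (pdx f) p := by
  have hs : IsSymmSndFDerivAt ℝ f p := hf.contDiffAt.isSymmSndFDerivAt (by
    rw [minSmoothness_of_isRCLikeNormedField]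
    exact WithTop.coe_le_coe.2 (le_top (a := (2 : ℕ∞))))
  have hd : DifferentiableAt ℝ (fderiv ℝ f) p :=
    (hf.fderiv_right (m := (⊤ : ℕ∞)) (by simp)).differentiable (by simp) p
  have key : ∀ v w, fderiv ℝ (fun q => fderiv ℝ f q v) p w = fderiv ℝ (fderiv ℝ f) p w v := by
    intro v w
    rw [fderiv_clm_apply hd (differentiableAt_const v)]
    simp
  show fderiv ℝ (fun q => fderiv ℝ f q (0, 1)) p (1, 0) =
    fderiv ℝ (fun q => fderiv ℝ f q (1, 0)) p (0, 1)
  rw [key, key]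
  exact hs _ _

namespace IsFirstIntegral

variable {a Z u : ℝ × ℝ → ℂ} {K M ρ : ℝ} {Ω : Set (ℝ × ℝ)}

theorem contDiff_comp (h : IsFirstIntegral a Z K M ρ) {H : ℂ → ℂ} (hH : Differentiable ℂ H) :
    ContDiff ℝ (⊤ : ℕ∞) fun p => H (Z p) :=
  ((hH.contDiff (n := (⊤ : ℕ∞))).restrict_scalars ℝ).comp h.contDiff

/-- Testing a distributional solution against `χ(x) θ(y) H(Z) ∂Z/∂x`. -/
theorem integral_mul_sub_eq_zero (h : IsFirstIntegral a Z K M ρ) (hu : IsDistribSol a u Ω)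
    {χ θ : ℝ → ℝ} (hχ : ContDiff ℝ (⊤ : ℕ∞) χ) (hθ : ContDiff ℝ (⊤ : ℕ∞) θ)
    (hχc : HasCompactSupport χ) (hθc : HasCompactSupport θ)
    (hΩ : tsupport χ ×ˢ tsupport θ ⊆ Ω) (hρ : tsupport χ ×ˢ tsupport θ ⊆ Metric.ball 0 ρ)
    {H : ℂ → ℂ} (hH : Differentiable ℂ H) :
    ∫ p in Ω, u p * (χ p.1 * deriv θ p.2 * (H (Z p) * pdx Z p) -
      deriv χ p.1 * θ p.2 * (H (Z p) * pdy Z p)) = 0 := by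
  set G : ℝ × ℝ → ℂ := fun p => H (Z p) with hG
  have hGs : ContDiff ℝ (⊤ : ℕ∞) G := h.contDiff_comp hH
  have hGx : ∀ p, pdx G p = deriv H (Z p) * pdx Z p := fun p =>
    (hasDerivAt_pdx (hGs.differentiable (by simp) p)).unique
      ((hH (Z p)).hasDerivAt.comp_of_eq p.1
        (hasDerivAt_pdx (h.contDiff.differentiable (by simp) p)) rfl)
  have hGy : ∀ p, pdy G p = deriv H (Z p) * pdy Z p := fun p =>
    (hasDerivAt_pdy (hGs.differentiable (by simp) p)).unique
      ((hH (Z p)).hasDerivAt.comp_of_eq p.2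
        (hasDerivAt_pdy (h.contDiff.differentiable (by simp) p)) rfl)
  have hχθ : ContDiff ℝ (⊤ : ℕ∞) fun p : ℝ × ℝ => ((χ p.1 * θ p.2 : ℝ) : ℂ) :=
    ofRealCLM.contDiff.comp ((hχ.comp contDiff_fst).mul (hθ.comp contDiff_snd))
  set ψ : ℝ × ℝ → ℂ := fun p => ((χ p.1 * θ p.2 : ℝ) : ℂ) * (G p * pdx Z p) with hψ
  have hψs : ContDiff ℝ (⊤ : ℕ∞) ψ := hχθ.mul (hGs.mul (contDiff_pdx h.contDiff))
  have hsupp : tsupport ψ ⊆ tsupport χ ×ˢ tsupport θ := by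
    refine closure_minimal (fun p hp => ?_)
      ((isClosed_tsupport χ).prod (isClosed_tsupport θ))
    rw [Function.mem_support, hψ] at hp
    have h1 := left_ne_zero_of_mul hp
    rw [ofReal_ne_zero] at h1
    exact ⟨subset_tsupport _ (left_ne_zero_of_mul h1), subset_tsupport _ (right_ne_zero_of_mul h1)⟩
  have hψc : HasCompactSupport ψ :=
    (hχc.prod hθc).of_isClosed_subset (isClosed_tsupport ψ) hsupp
  have haψ : (fun q => a q * ψ q) =
      fun q => -(((χ q.1 * θ q.2 : ℝ) : ℂ) * (G q * pdy Z q)) := by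
    funext q
    by_cases hq : q ∈ Metric.ball (0 : ℝ × ℝ) ρ
    · simp only [hψ]
      linear_combination ((χ q.1 * θ q.2 : ℝ) : ℂ) * G q * h.eq_zero q hq
    · have h0 : χ q.1 * θ q.2 = 0 := by
        by_contra hne
        exact hq (hρ ⟨subset_tsupport _ (left_ne_zero_of_mul hne),
          subset_tsupport _ (right_ne_zero_of_mul hne)⟩)
      simp only [hψ, h0, ofReal_zero, zero_mul, mul_zero, neg_zero]
  have key := hu ψ hψs hψc (hsupp.trans hΩ)
  rw [haψ] at key
  rw [← key]
  congr 1
  funext p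
  congr 1
  have dG := hGs.differentiable (by simp) p
  have dx := (contDiff_pdx h.contDiff).differentiable (by simp) p
  have dy := (contDiff_pdy h.contDiff).differentiable (by simp) p
  have e1 : pdy ψ p = ((χ p.1 * deriv θ p.2 : ℝ) : ℂ) * (G p * pdx Z p) +
      ((χ p.1 * θ p.2 : ℝ) : ℂ) * (pdy G p * pdx Z p + G p * pdy (pdx Z) p) :=
    (hasDerivAt_pdy (hψs.differentiable (by simp) p)).unique
      ((((hθ.differentiable (by simp) p.2).hasDerivAt.const_mul (χ p.1)).ofReal_comp).mul
        ((hasDerivAt_pdy dG).mul (hasDerivAt_pdy dx)))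
  have e2 : pdx (fun q => -(((χ q.1 * θ q.2 : ℝ) : ℂ) * (G q * pdy Z q))) p =
      -(((deriv χ p.1 * θ p.2 : ℝ) : ℂ) * (G p * pdy Z p) +
      ((χ p.1 * θ p.2 : ℝ) : ℂ) * (pdx G p * pdy Z p + G p * pdx (pdy Z) p)) :=
    (hasDerivAt_pdx ((hχθ.mul (hGs.mul (contDiff_pdy h.contDiff))).neg.differentiable
      (by simp) p)).unique
      ((((hχ.differentiable (by simp) p.1).hasDerivAt.mul_const (θ p.2)).ofReal_comp).mul
        ((hasDerivAt_pdx dG).mul (hasDerivAt_pdx dy))).neg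
  rw [e1, e2, hGx, hGy, pdx_pdy_comm h.contDiff]
  push_cast
  ring

end IsFirstIntegral

/-- A smooth function with integral zero, supported in an interval, has a primitive supported in
the same interval. -/
theorem exists_primitive_of_integral_eq_zero {φ : ℝ → ℝ} {r : ℝ}
    (hφ : ContDiff ℝ (⊤ : ℕ∞) φ) (hφc : HasCompactSupport φ) (hφs : tsupport φ ⊆ Ioo 0 r)
    (h0 : ∫ x, φ x = 0) :
    ∃ θ : ℝ → ℝ, ContDiff ℝ (⊤ : ℕ∞) θ ∧ HasCompactSupport θ ∧ tsupport θ ⊆ Ioo 0 r ∧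
      deriv θ = φ := by
  rcases (tsupport φ).eq_empty_or_nonempty with hemp | hne
  · have : φ = 0 := tsupport_eq_empty_iff.1 hemp
    refine ⟨0, contDiff_const, HasCompactSupport.zero, ?_, ?_⟩
    · rw [tsupport_eq_empty_iff.2 rfl]; exact empty_subset _
    · rw [this]; funext x; exact deriv_const x 0
  obtain ⟨α, hα, hαl⟩ := hφc.exists_isLeast hne
  obtain ⟨β, hβ, hβg⟩ := hφc.exists_isGreatest hne
  have hc : Continuous φ := hφ.continuous
  have hi : Integrable φ := hc.integrable_of_hasCompactSupport hφc
  set θ : ℝ → ℝ := fun y => ∫ t in Iic y, φ t with hθ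
  have hd : ∀ y, HasDerivAt θ (φ y) y := by
    intro y
    have h1 : ∀ z, θ z = (∫ t in Iic 0, φ t) + ∫ t in (0 : ℝ)..z, φ t := by
      intro z
      rw [← intervalIntegral.integral_Iic_sub_Iic hi.integrableOn hi.integrableOn]
      ring
    have h2 := (intervalIntegral.integral_hasDerivAt_right (a := 0) (b := y)
      (hc.intervalIntegrable _ _) (hc.stronglyMeasurableAtFilter _ _) hc.continuousAt).const_add
      (∫ t in Iic 0, φ t)
    exact h2.congr_of_eventuallyEq (Eventually.of_forall h1)
  have hderiv : deriv θ = φ := funext fun y => (hd y).deriv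
  have hz : ∀ y, y ∉ Icc α β → θ y = 0 := by
    intro y hy
    rcases lt_or_ge y α with h | h
    · refine setIntegral_eq_zero_of_forall_eq_zero fun t ht => ?_
      by_contra hne'
      exact absurd (hαl (subset_tsupport _ hne')) (not_le.2 (lt_of_le_of_lt ht h))
    · have hy' : β < y := by
        by_contra hcon
        exact hy ⟨h, not_lt.1 hcon⟩
      rw [← h0]
      refine setIntegral_eq_integral_of_forall_compl_eq_zero fun t ht => ?_
      by_contra hne'
      exact ht ((hβg (subset_tsupport _ hne')).trans hy'.le)
  have hsub : tsupport θ ⊆ Icc α β := closure_minimal (fun y hy => by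
    by_contra hcon
    exact hy (hz y hcon)) isClosed_Icc
  refine ⟨θ, ?_, HasCompactSupport.of_support_subset_isCompact isCompact_Icc
    ((subset_tsupport θ).trans hsub), hsub.trans (Icc_subset_Ioo (hφs hα).1 (hφs hβ).2), hderiv⟩
  rw [contDiff_infty_iff_deriv, hderiv]
  exact ⟨fun y => (hd y).differentiableAt, hφ⟩

theorem integral_deriv_mul_integral_Ioc {θ : ℝ → ℝ} (hθ : ContDiff ℝ (⊤ : ℕ∞) θ)
    (hθc : HasCompactSupport θ) {r : ℝ} (hθs : tsupport θ ⊆ Ioo 0 r) {J : ℝ → ℂ}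
    (hJ : Integrable J) :
    ∫ y, ((deriv θ y : ℝ) : ℂ) * ∫ s in Ioc 0 y, J s = -∫ y, (θ y : ℂ) * J y := by
  set T : Set (ℝ × ℝ) := {p | 0 < p.2 ∧ p.2 ≤ p.1} with hT
  have hTm : MeasurableSet T :=
    (measurableSet_lt measurable_const measurable_snd).inter
      (measurableSet_le measurable_snd measurable_fst)
  have hθ' : Integrable fun y => ((deriv θ y : ℝ) : ℂ) :=
    ((hθ.continuous_deriv (by simp)).integrable_of_hasCompactSupport hθc.deriv).ofReal
  have h_int : Integrable (T.indicator fun p : ℝ × ℝ => ((deriv θ p.1 : ℝ) : ℂ) * J p.2)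
      (volume.prod volume) := (hθ'.mul_prod hJ).indicator hTm
  have e1 : ∀ y, (((deriv θ y : ℝ) : ℂ) * ∫ s in Ioc 0 y, J s) =
      ∫ s, T.indicator (fun p : ℝ × ℝ => ((deriv θ p.1 : ℝ) : ℂ) * J p.2) (y, s) := by
    intro y
    rw [← integral_indicator measurableSet_Ioc, ← integral_const_mul]
    congr 1
    funext s
    by_cases hs : s ∈ Ioc 0 y
    · rw [indicator_of_mem hs, indicator_of_mem (show (y, s) ∈ T from hs)]
    · rw [indicator_of_notMem hs, indicator_of_notMem (show (y, s) ∉ T from hs), mul_zero]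
  simp_rw [e1]
  rw [integral_integral_swap (f := fun y s => T.indicator
    (fun p : ℝ × ℝ => ((deriv θ p.1 : ℝ) : ℂ) * J p.2) (y, s)) h_int, ← integral_neg]
  congr 1
  funext s
  by_cases hs : 0 < s
  · have e2 : ∀ y, T.indicator (fun p : ℝ × ℝ => ((deriv θ p.1 : ℝ) : ℂ) * J p.2) (y, s) =
        (Ici s).indicator (fun y => ((deriv θ y : ℝ) : ℂ)) y * J s := by
      intro y
      by_cases hy : s ≤ y
      · rw [indicator_of_mem (show (y, s) ∈ T from ⟨hs, hy⟩), indicator_of_mem (mem_Ici.2 hy)]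
      · rw [indicator_of_notMem (show (y, s) ∉ T from fun h => hy h.2),
          indicator_of_notMem (by simpa using hy), zero_mul]
    simp_rw [e2]
    rw [integral_mul_const, integral_indicator measurableSet_Ici, integral_Ici_eq_integral_Ioi,
      integral_complex_ofReal, hθc.integral_Ioi_deriv_eq (hθ.of_le (by simp)) s]
    push_cast
    ring
  · have e2 : ∀ y, T.indicator (fun p : ℝ × ℝ => ((deriv θ p.1 : ℝ) : ℂ) * J p.2) (y, s) = 0 :=
      fun y => indicator_of_notMem (fun h => hs h.1) _
    have e3 : θ s = 0 := by
      by_contra hne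
      exact hs (hθs (subset_tsupport _ hne)).1
    simp [e2, e3]

/-- The du Bois-Reymond lemma. -/
theorem exists_ae_add_integral_Ioc_eq {I J : ℝ → ℂ} {r : ℝ} (hr : 0 < r) (hI : Integrable I)
    (hJ : Integrable J)
    (h : ∀ θ : ℝ → ℝ, ContDiff ℝ (⊤ : ℕ∞) θ → HasCompactSupport θ → tsupport θ ⊆ Ioo 0 r →
      ∫ y, (((deriv θ y : ℝ) : ℂ) * I y - θ y * J y) = 0) :
    ∃ c, ∀ᵐ y, y ∈ Ioo 0 r → I y + ∫ s in Ioc 0 y, J s = c := by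
  set F : ℝ → ℂ := fun y => ∫ s in Ioc 0 y, J s with hF
  have hFc : Continuous F := by
    have e : F = fun y => ∫ s in (0 : ℝ)..max y 0, J s := by
      funext y
      rw [intervalIntegral.integral_of_le (le_max_right _ _)]
      rcases le_total 0 y with hy | hy
      · rw [max_eq_left hy]
      · rw [hF, max_eq_right hy]
        simp only [Ioc_self, Ioc_eq_empty (not_lt.2 hy)]
    rw [e]
    exact (intervalIntegral.continuous_primitive (fun _ _ => hJ.intervalIntegrable) 0).comp
      (continuous_id.max continuous_const)
  have hFm : AEStronglyMeasurable F := hFc.aestronglyMeasurable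
  have hFb : ∀ y, ‖F y‖ ≤ ∫ s, ‖J s‖ := fun y =>
    (norm_integral_le_integral_norm _).trans
      (setIntegral_le_integral hJ.norm (ae_of_all _ fun _ => norm_nonneg _))
  have hmul : ∀ θ : ℝ → ℝ, Continuous θ → HasCompactSupport θ →
      Integrable fun y => (θ y : ℂ) * (I y + F y) := by
    intro θ hc hs
    obtain ⟨B, hB⟩ := hs.exists_bound_of_continuous hc
    have h1 : Integrable fun y => (θ y : ℂ) * I y :=
      hI.bdd_mul (c := B) (continuous_ofReal.comp hc).aestronglyMeasurable
        (ae_of_all _ fun y => by simpa using hB y)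
    have h2 : Integrable fun y => (θ y : ℂ) * F y :=
      ((hc.integrable_of_hasCompactSupport hs).ofReal).mul_bdd (c := ∫ s, ‖J s‖) hFm
        (ae_of_all _ hFb)
    exact (h1.fun_add h2).congr (ae_of_all _ fun y => by simp only [mul_add])
  have h0 : ∀ θ : ℝ → ℝ, ContDiff ℝ (⊤ : ℕ∞) θ → HasCompactSupport θ → tsupport θ ⊆ Ioo 0 r →
      ∫ y, ((deriv θ y : ℝ) : ℂ) * (I y + F y) = 0 := by
    intro θ h1 h2 h3
    have hc1 := h1.continuous_deriv (by simp)
    obtain ⟨B, hB⟩ := h2.exists_bound_of_continuous h1.continuous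
    obtain ⟨B', hB'⟩ := h2.deriv.exists_bound_of_continuous hc1
    have i1 : Integrable fun y => ((deriv θ y : ℝ) : ℂ) * I y :=
      hI.bdd_mul (c := B') (continuous_ofReal.comp hc1).aestronglyMeasurable
        (ae_of_all _ fun y => by simpa using hB' y)
    have i2 : Integrable fun y => (θ y : ℂ) * J y :=
      hJ.bdd_mul (c := B) (continuous_ofReal.comp h1.continuous).aestronglyMeasurable
        (ae_of_all _ fun y => by simpa using hB y)
    have i3 : Integrable fun y => ((deriv θ y : ℝ) : ℂ) * F y :=
      ((hc1.integrable_of_hasCompactSupport h2.deriv).ofReal).mul_bdd (c := ∫ s, ‖J s‖) hFm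
        (ae_of_all _ hFb)
    have e1 := h θ h1 h2 h3
    rw [integral_sub i1 i2] at e1
    simp_rw [mul_add]
    rw [integral_add i1 i3, integral_deriv_mul_integral_Ioc h1 h2 h3 hJ]
    exact e1
  let β : ContDiffBump (r / 2) := ⟨r / 8, r / 4, by positivity, by linarith⟩
  have hβs : tsupport (β.normed volume) ⊆ Ioo 0 r := by
    rw [β.tsupport_normed_eq, Real.closedBall_eq_Icc]
    exact Icc_subset_Ioo (by simp only [β]; linarith) (by simp only [β]; linarith)
  have hβd : ContDiff ℝ (⊤ : ℕ∞) (β.normed volume) := β.contDiff_normed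
  have hβc : HasCompactSupport (β.normed volume) := β.hasCompactSupport_normed
  set c := ∫ y, (β.normed volume y : ℂ) * (I y + F y) with hc
  refine ⟨c, ?_⟩
  have key := isOpen_Ioo.ae_eq_zero_of_integral_contDiff_smul_eq_zero (μ := (volume : Measure ℝ))
    (U := Ioo 0 r) (f := fun y => I y + F y - c) ?_ ?_
  · filter_upwards [key] with y hy hy'
    exact sub_eq_zero.1 (hy hy')
  · exact ((hI.locallyIntegrable.add hFc.locallyIntegrable).sub (locallyIntegrable_const c)).locallyIntegrableOn _
  · intro φ hφ hφc hφs
    have hφi : Integrable φ := hφ.continuous.integrable_of_hasCompactSupport hφc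
    have hβi : Integrable (β.normed volume) := hβd.continuous.integrable_of_hasCompactSupport hβc
    set m := ∫ x, φ x with hm
    have hms : HasCompactSupport fun y => φ y - m * β.normed volume y :=
      hφc.sub (hβc.mul_left)
    have hms2 : tsupport (fun y => φ y - m * β.normed volume y) ⊆ Ioo 0 r := by
      refine (tsupport_sub _ _).trans (union_subset hφs ?_)
      exact (closure_mono (Function.support_mul_subset_right _ _)).trans hβs
    obtain ⟨θ, t1, t2, t3, t4⟩ := exists_primitive_of_integral_eq_zero
      (hφ.sub (contDiff_const.mul hβd)) hms hms2 (by
        rw [integral_sub hφi (hβi.const_mul m), integral_const_mul, β.integral_normed, mul_one,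
          sub_self])
    have e1 := h0 θ t1 t2 t3
    rw [t4] at e1
    have e2 : ∫ y, ((φ y : ℂ) * (I y + F y) - m * (β.normed volume y * (I y + F y))) = 0 := by
      rw [← e1]
      congr 1
      funext y
      push_cast
      ring
    rw [integral_sub (hmul φ hφ.continuous hφc) ((hmul _ hβd.continuous hβc).const_mul _),
      integral_const_mul, ← hc] at e2
    have e3 : ∀ y, φ y • (I y + F y - c) = (φ y : ℂ) * (I y + F y) - φ y * c := fun y => by
      rw [real_smul]; ring
    simp_rw [e3]
    have hφi' : Integrable fun y => (φ y : ℂ) := hφi.ofReal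
    rw [integral_sub (hmul φ hφ.continuous hφc) (hφi'.mul_const c), integral_mul_const,
      integral_complex_ofReal]
    exact e2

/-- `v` is a bounded weak solution on `(-r, r) × (0, r)`, extended by zero, tested only against
functions of the first integral `Z`, and `b` is its weak trace on `y = 0`. -/
structure IsLocalSolution (Z v : ℝ × ℝ → ℂ) (b : ℝ → ℂ) (C r : ℝ) (N : Set ℝ) : Prop where
  pos : 0 < r
  measurable : Measurable v
  norm_le : ∀ p, ‖v p‖ ≤ C
  eq_zero : ∀ p, p ∉ Ioo (-r) r ×ˢ Ioo 0 r → v p = 0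
  weak : ∀ χ θ : ℝ → ℝ, ContDiff ℝ (⊤ : ℕ∞) χ → ContDiff ℝ (⊤ : ℕ∞) θ →
    HasCompactSupport χ → HasCompactSupport θ → tsupport χ ⊆ Ioo (-r) r →
    tsupport θ ⊆ Ioo 0 r → ∀ H : ℂ → ℂ, Differentiable ℂ H →
    ∫ p, v p * (χ p.1 * deriv θ p.2 * (H (Z p) * pdx Z p) -
      deriv χ p.1 * θ p.2 * (H (Z p) * pdy Z p)) = 0
  null : volume N = 0
  trace : ∀ φ : ℝ → ℂ, ContDiff ℝ (⊤ : ℕ∞) φ → HasCompactSupport φ → tsupport φ ⊆ Ioo (-r) r →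
    Tendsto (fun y => ∫ x, v (x, y) * φ x) (𝓝[Ioo 0 r \ N] 0) (𝓝 (∫ x, b x * φ x))

namespace IsLocalSolution

variable {a Z v : ℝ × ℝ → ℂ} {b : ℝ → ℂ} {K M ρ C r : ℝ} {N : Set ℝ}

theorem nonneg (hv : IsLocalSolution Z v b C r N) : 0 ≤ C :=
  (norm_nonneg _).trans (hv.norm_le 0)

theorem eq_zero_of_fst (hv : IsLocalSolution Z v b C r N) {x : ℝ} (hx : x ∉ Ioo (-r) r) (y : ℝ) :
    v (x, y) = 0 :=
  hv.eq_zero _ fun h => hx h.1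

theorem integrable_mul (hv : IsLocalSolution Z v b C r N) {G : ℝ × ℝ → ℂ} (hG : Continuous G) :
    Integrable fun p => v p * G p := by
  have hc : IsCompact (Icc (-r) r ×ˢ Icc 0 r) := isCompact_Icc.prod isCompact_Icc
  have h1 : IntegrableOn (fun p => v p * G p) (Icc (-r) r ×ˢ Icc 0 r) :=
    (hG.continuousOn.integrableOn_compact hc).bdd_mul (c := C)
      hv.measurable.aestronglyMeasurable (ae_of_all _ hv.norm_le)
  refine (integrableOn_iff_integrable_of_support_subset fun p hp => ?_).1 h1
  by_contra hcon
  refine left_ne_zero_of_mul hp (hv.eq_zero p fun h => hcon ?_)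
  exact ⟨Ioo_subset_Icc_self h.1, Ioo_subset_Icc_self h.2⟩

theorem measurable_slice (hv : IsLocalSolution Z v b C r N) (y : ℝ) :
    Measurable fun x => v (x, y) :=
  hv.measurable.comp (measurable_id.prodMk measurable_const)

theorem integrable_slice_mul (hv : IsLocalSolution Z v b C r N) (y : ℝ) {g : ℝ → ℂ}
    (hg : Continuous g) : Integrable fun x => v (x, y) * g x := by
  have h1 : IntegrableOn (fun x => v (x, y) * g x) (Icc (-r) r) :=
    (hg.continuousOn.integrableOn_compact isCompact_Icc).bdd_mul (c := C)
      (hv.measurable_slice y).aestronglyMeasurable (ae_of_all _ fun _ => hv.norm_le _)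
  refine (integrableOn_iff_integrable_of_support_subset fun x hx => ?_).1 h1
  by_contra hcon
  exact left_ne_zero_of_mul hx (hv.eq_zero_of_fst (fun h => hcon (Ioo_subset_Icc_self h)) y)

/-- The slices `∫ v(x, y) G(x, y) dx` have the expected limit as `y → 0⁺`. -/
theorem tendsto_integral_slice (hv : IsLocalSolution Z v b C r N) {G : ℝ × ℝ → ℂ}
    (hG : ContDiff ℝ (⊤ : ℕ∞) G) (hGc : HasCompactSupport fun x => G (x, 0))
    (hGs : tsupport (fun x => G (x, 0)) ⊆ Ioo (-r) r) :
    Tendsto (fun y => ∫ x, v (x, y) * G (x, y)) (𝓝[Ioo 0 r \ N] 0)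
      (𝓝 (∫ x, b x * G (x, 0))) := by
  have hGcont := hG.continuous
  have h1 := hv.trace (fun x => G (x, 0)) (hG.comp (contDiff_id.prodMk contDiff_const)) hGc hGs
  obtain ⟨B, hB⟩ := ((isCompact_Icc (a := -r) (b := r)).prod
    (isCompact_Icc (a := (-1 : ℝ)) (b := 1))).exists_bound_of_continuousOn hGcont.continuousOn
  have h2 : Tendsto (fun y => ∫ x, v (x, y) * (G (x, y) - G (x, 0))) (𝓝 0)
      (𝓝 (∫ _ : ℝ, (0 : ℂ))) := by
    refine tendsto_integral_filter_of_dominated_convergence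
      ((Icc (-r) r).indicator fun _ => C * (B + B)) ?_ ?_ ?_ ?_
    · refine Eventually.of_forall fun y => ?_
      exact ((hv.measurable_slice y).aestronglyMeasurable).mul
        (Continuous.aestronglyMeasurable (by fun_prop))
    · filter_upwards [Icc_mem_nhds (show (-1 : ℝ) < 0 by norm_num) one_pos] with y hy
      refine ae_of_all _ fun x => ?_
      by_cases hx : x ∈ Icc (-r) r
      · rw [indicator_of_mem hx, norm_mul]
        have e1 := hB (x, y) ⟨hx, hy⟩
        have e2 := hB (x, 0) ⟨hx, by norm_num⟩
        exact mul_le_mul (hv.norm_le _) ((_root_.norm_sub_le _ _).trans (add_le_add e1 e2))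
          (norm_nonneg _) hv.nonneg
      · rw [hv.eq_zero_of_fst (fun h => hx (Ioo_subset_Icc_self h)) y, zero_mul, norm_zero,
          indicator_of_notMem hx]
    · exact (integrable_indicator_iff measurableSet_Icc).2
        (continuousOn_const.integrableOn_compact isCompact_Icc)
    · refine ae_of_all _ fun x => ?_
      refine squeeze_zero_norm (a := fun y => C * ‖G (x, y) - G (x, 0)‖) (fun y => ?_) ?_
      · rw [norm_mul]
        exact mul_le_mul_of_nonneg_right (hv.norm_le _) (norm_nonneg _)
      · have : Continuous fun y => C * ‖G (x, y) - G (x, 0)‖ := by fun_prop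
        simpa using this.tendsto 0
  rw [integral_zero] at h2
  have h3 := h1.add (h2.mono_left nhdsWithin_le_nhds)
  rw [add_zero] at h3
  refine h3.congr fun y => ?_
  rw [← integral_add (hv.integrable_slice_mul y (g := fun x => G (x, 0)) (by fun_prop))
    (hv.integrable_slice_mul y (g := fun x => G (x, y) - G (x, 0)) (by fun_prop))]
  congr 1
  funext x
  ring

theorem neBot {y₀ r : ℝ} (hr : y₀ < r) {S : Set ℝ} (hS : volume S = 0) :
    (𝓝[Ioo y₀ r \ S] y₀).NeBot := by
  rw [← mem_closure_iff_nhdsWithin_neBot, Metric.mem_closure_iff]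
  intro ε hε
  have hpos : 0 < volume (Ioo y₀ (min (y₀ + ε) r) \ S) := by
    rw [measure_sdiff_null hS, Real.volume_Ioo]
    simp [hε, hr]
  obtain ⟨y, hy, hyS⟩ := nonempty_of_measure_ne_zero hpos.ne'
  refine ⟨y, ⟨⟨hy.1, hy.2.trans_le (min_le_right _ _)⟩, hyS⟩, ?_⟩
  rw [dist_comm, Real.dist_eq, abs_of_pos (sub_pos.2 hy.1), sub_lt_iff_lt_add']
  exact hy.2.trans_le (min_le_left _ _)

/-- Green's formula on the strip between `0` and `y`. -/
theorem ae_integral_add_eq (hv : IsLocalSolution Z v b C r N) (hZ : ContDiff ℝ (⊤ : ℕ∞) Z)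
    {χ : ℝ → ℝ} (hχ : ContDiff ℝ (⊤ : ℕ∞) χ) (hχc : HasCompactSupport χ)
    (hχs : tsupport χ ⊆ Ioo (-r) r) {H : ℂ → ℂ} (hH : Differentiable ℂ H) :
    ∀ᵐ y, y ∈ Ioo 0 r → (∫ x, v (x, y) * (χ x * (H (Z (x, y)) * pdx Z (x, y)))) +
      (∫ s in Ioc 0 y, ∫ x, v (x, s) * (deriv χ x * (H (Z (x, s)) * pdy Z (x, s)))) =
      ∫ x, b x * (χ x * (H (Z (x, 0)) * pdx Z (x, 0))) := by
  have hHZ : ContDiff ℝ (⊤ : ℕ∞) fun p => H (Z p) :=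
    ((hH.contDiff (n := (⊤ : ℕ∞))).restrict_scalars ℝ).comp hZ
  set G₁ : ℝ × ℝ → ℂ := fun p => χ p.1 * (H (Z p) * pdx Z p) with hG₁
  set G₂ : ℝ × ℝ → ℂ := fun p => deriv χ p.1 * (H (Z p) * pdy Z p) with hG₂
  have hG₁s : ContDiff ℝ (⊤ : ℕ∞) G₁ :=
    (ofRealCLM.contDiff.comp (hχ.comp contDiff_fst)).mul (hHZ.mul (contDiff_pdx hZ))
  have hG₂c : Continuous G₂ :=
    (continuous_ofReal.comp ((hχ.continuous_deriv (by simp)).comp continuous_fst)).mul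
      (hHZ.continuous.mul (contDiff_pdy hZ).continuous)
  have hsupp : Function.support (fun x => G₁ (x, 0)) ⊆ tsupport χ := fun x hx => by
    have := left_ne_zero_of_mul hx
    rw [ofReal_ne_zero] at this
    exact subset_tsupport _ this
  have i1 := hv.integrable_mul hG₁s.continuous
  have i2 := hv.integrable_mul hG₂c
  set I : ℝ → ℂ := fun y => ∫ x, v (x, y) * G₁ (x, y) with hI
  set J : ℝ → ℂ := fun y => ∫ x, v (x, y) * G₂ (x, y) with hJ
  have hIi : Integrable I := i1.integral_prod_right
  have hJi : Integrable J := i2.integral_prod_right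
  obtain ⟨c, hc⟩ := exists_ae_add_integral_Ioc_eq hv.pos hIi hJi fun θ hθ hθc hθs => by
    rw [← hv.weak χ θ hχ hθ hχc hθc hχs hθs H hH]
    have j1 : Integrable fun p : ℝ × ℝ => v p * (((deriv θ p.2 : ℝ) : ℂ) * G₁ p) :=
      hv.integrable_mul ((continuous_ofReal.comp ((hθ.continuous_deriv (by simp)).comp
        continuous_snd)).mul hG₁s.continuous)
    have j2 : Integrable fun p : ℝ × ℝ => v p * (((θ p.2 : ℝ) : ℂ) * G₂ p) :=
      hv.integrable_mul ((continuous_ofReal.comp (hθ.continuous.comp continuous_snd)).mul hG₂c)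
    have e : ∀ p : ℝ × ℝ, v p * (χ p.1 * deriv θ p.2 * (H (Z p) * pdx Z p) -
        deriv χ p.1 * θ p.2 * (H (Z p) * pdy Z p)) =
        v p * (((deriv θ p.2 : ℝ) : ℂ) * G₁ p) - v p * (((θ p.2 : ℝ) : ℂ) * G₂ p) := fun p => by
      simp only [hG₁, hG₂]; ring
    simp_rw [e]
    have j3 : Integrable (fun p : ℝ × ℝ => v p * (((deriv θ p.2 : ℝ) : ℂ) * G₁ p) -
      v p * (((θ p.2 : ℝ) : ℂ) * G₂ p)) (volume.prod volume) := j1.sub j2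
    rw [Measure.volume_eq_prod, integral_prod_symm _ j3]
    congr 1
    funext y
    rw [integral_sub]
    · rw [hI, hJ]
      simp only
      rw [← integral_const_mul, ← integral_const_mul]
      congr 1 <;> (congr 1; funext x; ring)
    · exact hv.integrable_slice_mul y (g := fun x => ((deriv θ y : ℝ) : ℂ) * G₁ (x, y))
        (continuous_const.mul (hG₁s.continuous.comp (continuous_id.prodMk continuous_const)))
    · exact hv.integrable_slice_mul y (g := fun x => ((θ y : ℝ) : ℂ) * G₂ (x, y))
        (continuous_const.mul (hG₂c.comp (continuous_id.prodMk continuous_const)))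
  have hlim := hv.tendsto_integral_slice hG₁s
    (HasCompactSupport.of_support_subset_isCompact hχc hsupp)
    ((closure_minimal hsupp (isClosed_tsupport χ)).trans hχs)
  have hF : Tendsto (fun y => ∫ s in Ioc 0 y, J s) (𝓝[Ioo 0 r \ N] 0) (𝓝 0) := by
    have h1 := (intervalIntegral.continuous_primitive
      (fun _ _ => hJi.intervalIntegrable) 0).tendsto (0 : ℝ) |>.mono_left
        (nhdsWithin_le_nhds (s := Ioo 0 r \ N))
    rw [intervalIntegral.integral_same] at h1
    refine h1.congr' ?_
    filter_upwards [self_mem_nhdsWithin] with y hy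
    rw [intervalIntegral.integral_of_le hy.1.1.le]
  have hsum := hlim.add hF
  rw [add_zero] at hsum
  set S := {y | ¬ (y ∈ Ioo 0 r → I y + ∫ s in Ioc 0 y, J s = c)} with hS
  have hS0 : volume S = 0 := hc
  have : (𝓝[Ioo 0 r \ (N ∪ S)] (0 : ℝ)).NeBot :=
    neBot hv.pos (measure_union_null hv.null hS0)
  have hceq : c = ∫ x, b x * G₁ (x, 0) := by
    refine tendsto_nhds_unique (f := fun _ : ℝ => c) (l := 𝓝[Ioo 0 r \ (N ∪ S)] (0 : ℝ))
      tendsto_const_nhds ?_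
    refine (hsum.mono_left (nhdsWithin_mono _
      (sdiff_subset_sdiff_right subset_union_left))).congr' ?_
    filter_upwards [self_mem_nhdsWithin] with y hy
    have hyS : ¬ y ∈ S := fun h => hy.2 (Or.inr h)
    rw [hS, mem_ofPred_eq, not_not] at hyS
    exact hyS hy.1
  filter_upwards [hc] with y hy hy'
  rw [← hceq]
  exact hy hy'

end IsLocalSolution

theorem differentiable_integral_gaussKer {X : Type*} [MetricSpace X] [MeasurableSpace X]
    [BorelSpace X] {μ : Measure X} {S : Set X} (hS : IsCompact S) {f : X → ℂ}
    (hf : Integrable f μ) (hfS : ∀ x, x ∉ S → f x = 0) {Φ : X → ℂ} (hΦ : Continuous Φ) (n : ℕ) :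
    Differentiable ℂ fun z => ∫ x, f x * gaussKer n (z - Φ x) ∂μ := by
  have h1 := differentiableOn_integral_kernel hS hf.integrableOn (μ := μ) (f := f)
    (k := fun z x => gaussKer n (z - Φ x)) (k' := fun z x => deriv (gaussKer n) (z - Φ x))
    (Ω := univ) isOpen_univ
    (fun x _ z _ => by
      simpa using ((differentiable_gaussKer n (z - Φ x)).hasDerivAt).comp_sub_const z (Φ x))
    (((continuous_gaussKer n).comp
      (continuous_fst.sub (hΦ.comp continuous_snd))).continuousOn)
    ((((differentiable_gaussKer n).contDiff (n := 1)).continuous_deriv le_rfl).comp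
      (continuous_fst.sub (hΦ.comp continuous_snd))).continuousOn
  rw [differentiableOn_univ] at h1
  convert h1 using 2 with z
  exact (setIntegral_eq_integral_of_forall_compl_eq_zero fun x hx => by
    rw [hfS x hx, zero_mul]).symm

theorem tendsto_gaussMaj {d : ℝ} (hd : 0 < d) : Tendsto (fun n => gaussMaj n d) atTop (𝓝 0) := by
  have h1 := ((tendsto_rpow_mul_exp_neg_mul_atTop_nhds_zero (1 / 2) (d ^ 2 / 2)
    (by positivity)).comp tendsto_natCast_atTop_atTop).const_mul (√Real.pi)⁻¹
  rw [mul_zero] at h1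
  refine h1.congr fun n => ?_
  simp only [Function.comp, gaussMaj]
  rw [← Real.sqrt_eq_rpow, Real.sqrt_div n.cast_nonneg,
    show -(d ^ 2 / 2) * (n : ℝ) = -(n / 2) * d ^ 2 by ring]
  field_simp

theorem integrable_mul_of_hasCompactSupport {b χ : ℝ → ℂ} (hb : Integrable b)
    (hχ : Continuous χ) (hχc : HasCompactSupport χ) : Integrable fun x => b x * χ x := by
  obtain ⟨B, hB⟩ := hχc.exists_bound_of_continuous hχ
  exact hb.mul_bdd (c := B) hχ.aestronglyMeasurable (ae_of_all _ hB)

namespace IsLocalSolution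

variable {a Z v : ℝ × ℝ → ℂ} {b : ℝ → ℂ} {K M ρ C r : ℝ} {N : Set ℝ}

theorem setIntegral_slice_eq (hv : IsLocalSolution Z v b C r N) {G : ℝ × ℝ → ℂ}
    (hG : Continuous G) (y : ℝ) :
    ∫ s in Ioc 0 y, ∫ x, v (x, s) * G (x, s) =
      ∫ p, (univ ×ˢ Ioc 0 y).indicator (fun p => v p * G p) p := by
  have hm : MeasurableSet (univ ×ˢ Ioc 0 y : Set (ℝ × ℝ)) := MeasurableSet.univ.prod measurableSet_Ioc
  rw [Measure.volume_eq_prod, integral_prod_symm _ ((hv.integrable_mul hG).indicator hm),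
    ← integral_indicator measurableSet_Ioc]
  congr 1
  funext s
  by_cases hs : s ∈ Ioc 0 y
  · rw [indicator_of_mem hs]
    congr 1
    funext x
    rw [indicator_of_mem (show (x, s) ∈ univ ×ˢ Ioc 0 y from ⟨mem_univ _, hs⟩)]
  · rw [indicator_of_notMem hs]
    refine (integral_eq_zero_of_ae (ae_of_all _ fun x => ?_)).symm
    exact indicator_of_notMem (fun h => hs h.2) _

/-- Green's formula for all Gaussian kernels simultaneously. -/
theorem ae_forall_gaussKer (hv : IsLocalSolution Z v b C r N) (hZ : ContDiff ℝ (⊤ : ℕ∞) Z)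
    (hb : Integrable b) {χ : ℝ → ℝ} (hχ : ContDiff ℝ (⊤ : ℕ∞) χ) (hχc : HasCompactSupport χ)
    (hχs : tsupport χ ⊆ Ioo (-r) r) :
    ∀ᵐ y, y ∈ Ioo 0 r → ∀ (n : ℕ) (z : ℂ),
      (∫ x, v (x, y) * χ x * pdx Z (x, y) * gaussKer n (z - Z (x, y))) +
      (∫ s in Ioc 0 y, ∫ x, v (x, s) *
        (deriv χ x * pdy Z (x, s) * gaussKer n (z - Z (x, s)))) =
      ∫ x, b x * χ x * pdx Z (x, 0) * gaussKer n (z - Z (x, 0)) := by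
  have hχ' := hχ.continuous_deriv (by simp)
  have hx := (contDiff_pdx hZ).continuous
  have hy := (contDiff_pdy hZ).continuous
  have hZc := hZ.continuous
  have hcount : ∀ᵐ y, ∀ n m : ℕ, y ∈ Ioo 0 r →
      (∫ x, v (x, y) * χ x * pdx Z (x, y) * gaussKer n (TopologicalSpace.denseSeq ℂ m - Z (x, y))) +
      (∫ s in Ioc 0 y, ∫ x, v (x, s) *
        (deriv χ x * pdy Z (x, s) * gaussKer n (TopologicalSpace.denseSeq ℂ m - Z (x, s)))) =
      ∫ x, b x * χ x * pdx Z (x, 0) * gaussKer n (TopologicalSpace.denseSeq ℂ m - Z (x, 0)) := by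
    refine ae_all_iff.2 fun n => ae_all_iff.2 fun m => ?_
    have h1 := hv.ae_integral_add_eq hZ hχ hχc hχs
      (H := fun w => gaussKer n (TopologicalSpace.denseSeq ℂ m - w))
      ((differentiable_gaussKer n).comp ((differentiable_const _).sub differentiable_id))
    filter_upwards [h1] with y hy hyr
    have h2 := hy hyr
    simp only [mul_assoc] at h2 ⊢
    simp only [mul_comm (gaussKer n _)] at h2
    exact h2
  filter_upwards [hcount] with y hy1 hyr n
  refine funext_iff.1 (DenseRange.equalizer (TopologicalSpace.denseRange_denseSeq ℂ)
    ?_ ?_ (funext fun m => hy1 n m hyr))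
  · refine Continuous.add ?_ ?_
    · refine (differentiable_integral_gaussKer (isCompact_Icc (a := -r) (b := r))
        (f := fun x => v (x, y) * χ x * pdx Z (x, y)) ?_ ?_ (by fun_prop) n).continuous
      · simp_rw [mul_assoc]
        exact hv.integrable_slice_mul y (g := fun x => χ x * pdx Z (x, y))
          ((continuous_ofReal.comp hχ.continuous).mul (by fun_prop))
      · intro x hx
        rw [hv.eq_zero_of_fst (fun h => hx (Ioo_subset_Icc_self h)), zero_mul, zero_mul]
    · have e : (fun z => ∫ s in Ioc 0 y, ∫ x, v (x, s) *
          (deriv χ x * pdy Z (x, s) * gaussKer n (z - Z (x, s)))) = fun z =>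
          ∫ p, (univ ×ˢ Ioc 0 y).indicator (fun p => v p * (deriv χ p.1 * pdy Z p)) p *
            gaussKer n (z - Z p) := by
        funext z
        rw [hv.setIntegral_slice_eq (G := fun p => deriv χ p.1 * pdy Z p * gaussKer n (z - Z p))]
        · congr 1
          funext p
          by_cases hp : p ∈ (univ ×ˢ Ioc 0 y : Set (ℝ × ℝ))
          · rw [indicator_of_mem hp, indicator_of_mem hp]; ring
          · rw [indicator_of_notMem hp, indicator_of_notMem hp, zero_mul]
        · exact ((continuous_ofReal.comp (hχ'.comp continuous_fst)).mul hy).mul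
            ((continuous_gaussKer n).comp (continuous_const.sub hZc))
      rw [e]
      refine (differentiable_integral_gaussKer
        ((isCompact_Icc (a := -r) (b := r)).prod (isCompact_Icc (a := 0) (b := r)))
        ?_ ?_ hZc n).continuous
      · exact (hv.integrable_mul ((continuous_ofReal.comp (hχ'.comp continuous_fst)).mul
          hy)).indicator (MeasurableSet.univ.prod measurableSet_Ioc)
      · intro p hp
        refine indicator_apply_eq_zero.2 fun _ => ?_
        rw [hv.eq_zero p (fun h => hp ⟨Ioo_subset_Icc_self h.1, Ioo_subset_Icc_self h.2⟩),
          zero_mul]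
  · refine (differentiable_integral_gaussKer hχc
        (f := fun x => b x * χ x * pdx Z (x, 0)) ?_ ?_ (by fun_prop) n).continuous
    · have := integrable_mul_of_hasCompactSupport hb (χ := fun x => χ x * pdx Z (x, 0))
        ((continuous_ofReal.comp hχ.continuous).mul (by fun_prop))
        (hχc.comp_left (g := fun t : ℝ => (t : ℂ)) ofReal_zero).mul_right
      simpa only [mul_assoc] using this
    · intro x hx
      rw [image_eq_zero_of_notMem_tsupport hx, ofReal_zero, mul_zero, zero_mul]

end IsLocalSolution

theorem exists_cutoff {r : ℝ} (hr : 0 < r) : ∃ χ : ℝ → ℝ, ContDiff ℝ (⊤ : ℕ∞) χ ∧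
    HasCompactSupport χ ∧ tsupport χ ⊆ Ioo (-r) r ∧ (∀ x, |χ x| ≤ 1) ∧
    ∀ x, |x| ≤ r / 2 → χ x = 1 := by
  let β : ContDiffBump (0 : ℝ) := ⟨r / 2, 3 * r / 4, by positivity, by linarith⟩
  refine ⟨β, β.contDiff, β.hasCompactSupport, ?_, fun x => ?_, fun x hx => ?_⟩
  · rw [β.tsupport_eq, Real.closedBall_eq_Icc]
    exact Icc_subset_Ioo (by simp only [β]; linarith) (by simp only [β]; linarith)
  · rw [abs_of_nonneg β.nonneg]
    exact β.le_one
  · exact β.one_of_mem_closedBall (by simpa [Real.closedBall_eq_Icc, abs_le] using hx)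

theorem IsFirstIntegral.norm_gaussKer_le_of_far {a Z : ℝ × ℝ → ℂ} {K M ρ r : ℝ}
    (h : IsFirstIntegral a Z K M ρ) (hr : 0 < r) {x₀ y x s : ℝ} (hx₀ : |x₀| ≤ r / 4)
    (hx : r / 2 ≤ |x|) (hs : 0 ≤ s) (hsy : s ≤ y) (hy : M * y ≤ r / 40) (n : ℕ) :
    ‖gaussKer n (Z (x₀, y) - Z (x, s))‖ ≤ gaussMaj n (r / 4) := by
  have hd : r / 4 ≤ |x₀ - x| := by
    have := abs_sub_abs_le_abs_sub x x₀
    rw [abs_sub_comm] at this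
    linarith
  have hM := h.nonneg_bound
  have h1 := (h.niceCurve s).norm_chord x₀ x
  have h2 := h.norm_sub_le_snd x₀ y s
  rw [abs_of_nonneg (sub_nonneg.2 hsy)] at h2
  have h3 : M * (y - s) ≤ M * y := mul_le_mul_of_nonneg_left (by linarith) hM
  have h4 : ‖Z (x₀, y) - Z (x, s) - ((x₀ - x : ℝ) : ℂ)‖ ≤ 1 / 5 * |x₀ - x| := by
    have := norm_add_le (Z (x₀, y) - Z (x₀, s)) (Z (x₀, s) - Z (x, s) - ((x₀ - x : ℝ) : ℂ))
    rw [show Z (x₀, y) - Z (x₀, s) + (Z (x₀, s) - Z (x, s) - ((x₀ - x : ℝ) : ℂ)) =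
      Z (x₀, y) - Z (x, s) - ((x₀ - x : ℝ) : ℂ) by ring] at this
    linarith
  have h5 := re_sq_ge_of_norm_sub_le h4
  have h6 : (r / 4) ^ 2 ≤ (x₀ - x) ^ 2 := by
    rw [← sq_abs (x₀ - x)]
    exact pow_le_pow_left₀ (by positivity) hd 2
  rw [norm_gaussKer, gaussMaj]
  gcongr
  have hn : (0 : ℝ) ≤ n := n.cast_nonneg
  nlinarith

namespace IsLocalSolution

variable {a Z v : ℝ × ℝ → ℂ} {b : ℝ → ℂ} {K M ρ C r : ℝ} {N : Set ℝ}

theorem norm_strip_le (hv : IsLocalSolution Z v b C r N) (h : IsFirstIntegral a Z K M ρ)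
    {χ : ℝ → ℝ} {B : ℝ} (hB : ∀ x, |deriv χ x| ≤ B) (hχ1 : ∀ x, |x| ≤ r / 2 → χ x = 1)
    {x₀ y : ℝ} (hx₀ : |x₀| ≤ r / 4) (hy0 : 0 ≤ y) (hyr : y ≤ r) (hy : M * y ≤ r / 40) (n : ℕ) :
    ‖∫ s in Ioc 0 y, ∫ x, v (x, s) *
      (deriv χ x * pdy Z (x, s) * gaussKer n (Z (x₀, y) - Z (x, s)))‖ ≤
      C * (B * M) * (2 * r) * r * gaussMaj n (r / 4) := by
  have hr := hv.pos
  have hM := h.nonneg_bound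
  have hB0 : 0 ≤ B := (abs_nonneg _).trans (hB 0)
  have hC := hv.nonneg
  have hg := gaussMaj_nonneg n (r / 4)
  have hder : ∀ x, |x| < r / 2 → deriv χ x = 0 := by
    intro x hx
    have : χ =ᶠ[𝓝 x] fun _ => 1 := by
      filter_upwards [(continuous_abs.tendsto x).eventually (gt_mem_nhds hx)] with t ht
      exact hχ1 t ht.le
    rw [this.deriv_eq, deriv_const]
  have h1 : ∀ s ∈ Ioc 0 y, ‖∫ x, v (x, s) *
      (deriv χ x * pdy Z (x, s) * gaussKer n (Z (x₀, y) - Z (x, s)))‖ ≤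
      C * (B * M * gaussMaj n (r / 4)) * (2 * r) := by
    intro s hs
    have e : ∫ x, v (x, s) * (deriv χ x * pdy Z (x, s) * gaussKer n (Z (x₀, y) - Z (x, s))) =
        ∫ x in Ioo (-r) r, v (x, s) *
          (deriv χ x * pdy Z (x, s) * gaussKer n (Z (x₀, y) - Z (x, s))) :=
      (setIntegral_eq_integral_of_forall_compl_eq_zero fun x hx => by
        rw [hv.eq_zero_of_fst hx, zero_mul]).symm
    rw [e]
    refine (norm_setIntegral_le_of_norm_le_const (C := C * (B * M * gaussMaj n (r / 4)))
      (by simp) fun x _ => ?_).trans_eq ?_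
    · rw [norm_mul, norm_mul, norm_mul, norm_real, Real.norm_eq_abs]
      refine mul_le_mul (hv.norm_le _) ?_ (by positivity) hC
      rcases lt_or_ge |x| (r / 2) with hx | hx
      · rw [hder x hx, abs_zero, zero_mul, zero_mul]
        positivity
      · gcongr
        · exact hB x
        · exact h.norm_pdy_le _
        · exact h.norm_gaussKer_le_of_far hr hx₀ hx hs.1.le hs.2 hy n
    · rw [Measure.real, Real.volume_Ioo, ENNReal.toReal_ofReal (by linarith)]
      ring
  refine (norm_setIntegral_le_of_norm_le_const (by simp) h1).trans ?_
  rw [Measure.real, Real.volume_Ioc, ENNReal.toReal_ofReal (by linarith), sub_zero]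
  calc C * (B * M * gaussMaj n (r / 4)) * (2 * r) * y
      ≤ C * (B * M * gaussMaj n (r / 4)) * (2 * r) * r := by gcongr
    _ = _ := by ring

/-- The entire functions approximating the trace are uniformly bounded on the image of a small
rectangle. -/
theorem exists_norm_le (hv : IsLocalSolution Z v b C r N) (h : IsFirstIntegral a Z K M ρ)
    (hb : Integrable b) {χ : ℝ → ℝ} (hχ : ContDiff ℝ (⊤ : ℕ∞) χ) (hχc : HasCompactSupport χ)
    (hχs : tsupport χ ⊆ Ioo (-r) r) (hχ1 : ∀ x, |χ x| ≤ 1) (hχ2 : ∀ x, |x| ≤ r / 2 → χ x = 1)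
    {σ : ℝ} (hσr : σ ≤ r / 4) (hMσ : M * σ ≤ r / 40) :
    ∃ C', 0 < C' ∧ ∀ (n : ℕ) (x₀ y₀ : ℝ), |x₀| ≤ σ → y₀ ∈ Ico 0 σ →
      ‖∫ x, b x * χ x * pdx Z (x, 0) * gaussKer n (Z (x₀, y₀) - Z (x, 0))‖ ≤ C' := by
  have hr := hv.pos
  obtain ⟨B, hB⟩ := hχc.deriv.exists_bound_of_continuous (hχ.continuous_deriv (by simp))
  obtain ⟨D, hD⟩ := (tendsto_gaussMaj (d := r / 4) (by positivity)).bddAbove_range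
  have hD' : ∀ n, gaussMaj n (r / 4) ≤ D := fun n => hD (mem_range_self n)
  have hD0 : 0 ≤ D := (gaussMaj_nonneg 0 _).trans (hD' 0)
  have hM := h.nonneg_bound
  have hB0 : 0 ≤ B := (norm_nonneg _).trans (hB 0)
  have hC := hv.nonneg
  refine ⟨2 * C + C * (B * M) * (2 * r) * r * D + 1, by positivity, fun n x₀ y₀ hx₀ hy₀ => ?_⟩
  have hcont : Continuous fun y => ‖∫ x, b x * χ x * pdx Z (x, 0) *
      gaussKer n (Z (x₀, y) - Z (x, 0))‖ := by
    have hZc := h.contDiff.continuous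
    have hx := (contDiff_pdx h.contDiff).continuous
    refine ((differentiable_integral_gaussKer hχc (f := fun x => b x * χ x * pdx Z (x, 0))
      ?_ ?_ (Φ := fun x => Z (x, 0)) (by fun_prop) n).continuous.comp
        (g := fun z => ∫ x, b x * χ x * pdx Z (x, 0) * gaussKer n (z - Z (x, 0)))
        (f := fun y => Z (x₀, y)) (by fun_prop)).norm
    · have := integrable_mul_of_hasCompactSupport hb (χ := fun x => χ x * pdx Z (x, 0))
        ((continuous_ofReal.comp hχ.continuous).mul (by fun_prop))
        (hχc.comp_left (g := fun t : ℝ => (t : ℂ)) ofReal_zero).mul_right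
      simpa only [mul_assoc] using this
    · intro x hx
      rw [image_eq_zero_of_notMem_tsupport hx, ofReal_zero, mul_zero, zero_mul]
  have hae := hv.ae_forall_gaussKer h.contDiff hb hχ hχc hχs
  set S := {y | ¬ (y ∈ Ioo 0 r → ∀ (n : ℕ) (z : ℂ),
      (∫ x, v (x, y) * χ x * pdx Z (x, y) * gaussKer n (z - Z (x, y))) +
      (∫ s in Ioc 0 y, ∫ x, v (x, s) *
        (deriv χ x * pdy Z (x, s) * gaussKer n (z - Z (x, s)))) =
      ∫ x, b x * χ x * pdx Z (x, 0) * gaussKer n (z - Z (x, 0)))} with hS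
  have hS0 : volume S = 0 := hae
  have : (𝓝[Ioo y₀ σ \ S] y₀).NeBot := neBot hy₀.2 hS0
  refine le_of_tendsto ((hcont.tendsto y₀).mono_left
    (nhdsWithin_le_nhds : 𝓝[Ioo y₀ σ \ S] y₀ ≤ 𝓝 y₀)) ?_
  filter_upwards [self_mem_nhdsWithin] with y hy
  have hy0 : 0 < y := hy₀.1.trans_lt hy.1.1
  have hyσ : y < σ := hy.1.2
  have hyr : y < r := by linarith
  have hyS : ¬ y ∈ S := hy.2
  rw [hS, mem_ofPred_eq, not_not] at hyS
  rw [← hyS ⟨hy0, hyr⟩ n]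
  have h1 := (h.niceCurve y).norm_integral_gaussKer_le n (f := fun x => v (x, y) * χ x) (C := C)
    (fun x => by
      rw [norm_mul, norm_real, Real.norm_eq_abs]
      exact (mul_le_mul (hv.norm_le _) (hχ1 x) (abs_nonneg _) hC).trans_eq (mul_one C)) x₀
  have h2 := hv.norm_strip_le h hB hχ2 (hx₀.trans hσr) hy0.le hyr.le
    ((mul_le_mul_of_nonneg_left hyσ.le hM).trans hMσ) n
  have h3 : C * (B * M) * (2 * r) * r * gaussMaj n (r / 4) ≤ C * (B * M) * (2 * r) * r * D :=
    mul_le_mul_of_nonneg_left (hD' n) (by positivity)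
  refine (norm_add_le _ _).trans ?_
  linarith

/-- A solution with zero trace vanishes near the origin. -/
theorem ae_eq_zero_of_trace_eq_zero (hv : IsLocalSolution Z v 0 C r N)
    (h : IsFirstIntegral a Z K M ρ) {σ : ℝ} (hσr : σ ≤ r / 4) (hMσ : M * σ ≤ r / 40) :
    ∀ᵐ p, p ∈ Ioo (-σ) σ ×ˢ Ioo 0 σ → v p = 0 := by
  have hr := hv.pos
  have hM := h.nonneg_bound
  obtain ⟨χ, hχ, hχc, hχs, hχ1, hχ2⟩ := exists_cutoff hr
  obtain ⟨B, hB⟩ := hχc.deriv.exists_bound_of_continuous (hχ.continuous_deriv (by simp))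
  have hae := hv.ae_forall_gaussKer h.contDiff (integrable_zero _ _ _) hχ hχc hχs
  have hZc := h.contDiff.continuous
  have hxc := (contDiff_pdx h.contDiff).continuous
  have hχC : Continuous fun x => (χ x : ℂ) := continuous_ofReal.comp hχ.continuous
  have hgm := tendsto_gaussMaj (d := r / 4) (by positivity)
  have hB0 : 0 ≤ B := (norm_nonneg _).trans (hB 0)
  have hC := hv.nonneg
  set A := C * (B * M) * (2 * r) * r with hA
  have hA0 : 0 ≤ A := by positivity
  obtain ⟨D, hD⟩ := hgm.bddAbove_range
  have hD' : ∀ n, gaussMaj n (r / 4) ≤ D := fun n => hD (mem_range_self n)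
  have key : ∀ᵐ y, y ∈ Ioo 0 σ → ∀ᵐ x, x ∈ Icc (-σ) σ → v (x, y) = 0 := by
    filter_upwards [hae] with y hy hyσ
    have hyr : y < r := by linarith [hyσ.2]
    have hbound : ∀ (n : ℕ) (x₀ : ℝ), x₀ ∈ Icc (-σ) σ → ‖∫ x, v (x, y) * χ x * pdx Z (x, y) *
        gaussKer n (Z (x₀, y) - Z (x, y))‖ ≤ A * gaussMaj n (r / 4) := by
      intro n x₀ hx₀
      have h1 := hy ⟨hyσ.1, hyr⟩ n (Z (x₀, y))
      simp only [Pi.zero_apply, zero_mul, integral_zero] at h1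
      rw [eq_neg_of_add_eq_zero_left h1, norm_neg]
      exact hv.norm_strip_le h hB hχ2 ((abs_le.2 hx₀).trans hσr) hyσ.1.le hyr.le
        ((mul_le_mul_of_nonneg_left hyσ.2.le hM).trans hMσ) n
    have hf : Integrable fun x => v (x, y) * χ x := hv.integrable_slice_mul y hχC
    have hI : ∀ n : ℕ, Continuous fun x₀ => ∫ x, v (x, y) * χ x * pdx Z (x, y) *
        gaussKer n (Z (x₀, y) - Z (x, y)) := by
      intro n
      refine (differentiable_integral_gaussKer hχc (f := fun x => v (x, y) * χ x * pdx Z (x, y))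
        ?_ ?_ (Φ := fun x => Z (x, y)) (by fun_prop) n).continuous.comp
          (g := fun z => ∫ x, v (x, y) * χ x * pdx Z (x, y) * gaussKer n (z - Z (x, y)))
          (f := fun x₀ => Z (x₀, y)) (by fun_prop)
      · have := hv.integrable_slice_mul y (g := fun x => χ x * pdx Z (x, y)) (by fun_prop)
        simpa only [mul_assoc] using this
      · intro x hx
        rw [image_eq_zero_of_notMem_tsupport hx, ofReal_zero, mul_zero, zero_mul]
    have hlim := (h.niceCurve y).tendsto_integral_norm_gaussKer_sub hf σ
    have hlim2 : Tendsto (fun n : ℕ => ∫ x₀ in Icc (-σ) σ, ‖(∫ x, v (x, y) * χ x * pdx Z (x, y) *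
        gaussKer n (Z (x₀, y) - Z (x, y))) - v (x₀, y) * χ x₀‖) atTop
        (𝓝 (∫ x₀ in Icc (-σ) σ, ‖v (x₀, y) * χ x₀‖)) := by
      refine tendsto_integral_of_dominated_convergence
        (fun x₀ => A * D + ‖v (x₀, y) * χ x₀‖) (fun n => ?_) ?_ (fun n => ?_) ?_
      · exact (((hI n).aestronglyMeasurable).sub hf.aestronglyMeasurable.restrict).norm
      · exact (integrableOn_const (by simp)).add hf.norm.integrableOn
      · filter_upwards [ae_restrict_mem measurableSet_Icc] with x₀ hx₀
        rw [norm_norm]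
        refine (_root_.norm_sub_le _ _).trans (add_le_add_left ((hbound n x₀ hx₀).trans ?_) _)
        exact mul_le_mul_of_nonneg_left (hD' n) hA0
      · filter_upwards [ae_restrict_mem measurableSet_Icc] with x₀ hx₀
        have h0 : Tendsto (fun n : ℕ => ∫ x, v (x, y) * χ x * pdx Z (x, y) *
            gaussKer n (Z (x₀, y) - Z (x, y))) atTop (𝓝 0) :=
          squeeze_zero_norm (fun n => hbound n x₀ hx₀) (by simpa using hgm.const_mul A)
        simpa using (h0.sub_const (v (x₀, y) * χ x₀)).norm
    have h0 := tendsto_nhds_unique hlim2 hlim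
    rw [integral_eq_zero_iff_of_nonneg (fun _ => norm_nonneg _) hf.norm.integrableOn] at h0
    filter_upwards [(ae_restrict_iff' measurableSet_Icc).1 h0] with x hx hxσ
    have h2 := hx hxσ
    rw [hχ2 x ((abs_le.2 hxσ).trans (by linarith))] at h2
    simpa using h2
  have hmeas : MeasurableSet {p : ℝ × ℝ | p ∈ Ioo (-σ) σ ×ˢ Ioo 0 σ → v p = 0} :=
    (measurableSet_Ioo.prod measurableSet_Ioo).imp (hv.measurable (measurableSet_singleton 0))
  rw [Measure.volume_eq_prod, ← Measure.prod_swap, ae_map_iff measurable_swap.aemeasurable hmeas,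
    Measure.ae_prod_iff_ae_ae (p := fun q : ℝ × ℝ => q.swap ∈ Ioo (-σ) σ ×ˢ Ioo 0 σ →
      v q.swap = 0) (measurable_swap hmeas)]
  filter_upwards [key] with y hy
  by_cases hyσ : y ∈ Ioo 0 σ
  · filter_upwards [hy hyσ] with x hx hxy
    exact hx (Ioo_subset_Icc_self hxy.1)
  · exact ae_of_all _ fun x hxy => absurd hxy.2 hyσ

end IsLocalSolution

theorem LogIntegralNegInf.mono {f : ℝ → ℂ} {s t : Set ℝ} (h : LogIntegralNegInf f s)
    (hst : s ⊆ t) : LogIntegralNegInf f t := by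
  refine h.imp (fun h1 => h1.trans_le (measure_mono fun x hx => ⟨hst hx.1, hx.2⟩)) fun h1 => ?_
  exact top_unique (h1.symm.trans_le (lintegral_mono_set hst))

theorem max_truncLog_sub_norm_le {ε : ℝ} (hε : 0 < ε) (hε1 : ε ≤ 1) (c : ℂ) :
    max (truncLog ε c) 0 - ‖c‖ ≤ truncLog ε c := by
  rcases le_total 0 (truncLog ε c) with h | h
  · rw [max_eq_left h]
    linarith [norm_nonneg c]
  · rw [max_eq_right h, truncLog]
    have h1 : 1 ≤ max ‖c‖ ε := by
      by_contra! hlt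
      have := Real.log_neg (lt_max_of_lt_right hε) hlt
      rw [truncLog] at h
      linarith
    rcases le_total ε ‖c‖ with h2 | h2
    · rw [max_eq_left h2] at h1 ⊢
      have := Real.log_le_sub_one_of_pos (zero_lt_one.trans_le h1)
      linarith
    · rw [max_eq_right h2] at h1 ⊢
      have := norm_nonneg c
      rw [le_antisymm hε1 h1, Real.log_one]
      linarith

theorem truncLog_div {ε C : ℝ} (hε : 0 < ε) (hC : 0 < C) (c : ℂ) :
    truncLog (ε / C) (c / C) = Real.log C + truncLog ε c := by
  have hm : 0 < max ‖c‖ ε := lt_max_of_lt_right hε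
  rw [truncLog, truncLog, norm_div, norm_real, Real.norm_eq_abs, abs_of_pos hC,
    max_div_div_right hC.le, Real.log_div hm.ne' hC.ne']
  ring

/-- If the logarithmic integral diverges, then so do the truncated ones. -/
theorem LogIntegralNegInf.exists_le_integral_truncLog {b : ℝ → ℂ} (hb : Integrable b) {δ C : ℝ}
    (hC : 1 < C) (h : LogIntegralNegInf b (Ioo (-δ) δ)) (m : ℝ) :
    ∃ ε : ℝ, 0 < ε ∧ ε < 1 ∧ m ≤ ∫ x in Icc (-δ) δ, truncLog ε (b x / C) := by
  replace h := h.mono Ioo_subset_Icc_self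
  have hC0 : 0 < C := one_pos.trans hC
  set μ := volume.restrict (Icc (-δ) δ) with hμ
  set e : ℕ → ℝ := fun n => Real.exp (-n) with he
  have he0 : ∀ n, 0 < e n := fun n => Real.exp_pos _
  have he1 : ∀ n, e n ≤ 1 := fun n => Real.exp_le_one_iff.2 (by simp)
  have hbm : AEMeasurable b μ := hb.aestronglyMeasurable.aemeasurable.restrict
  have hTm : ∀ n, AEMeasurable (fun x => truncLog (e n) (b x)) μ := fun n =>
    (continuous_truncLog (he0 n)).measurable.comp_aemeasurable hbm
  have hmm : ∀ n, AEMeasurable (fun x => max (truncLog (e n) (b x)) 0) μ := fun n =>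
    (hTm n).max aemeasurable_const
  have hle : ∀ n x, max (truncLog (e n) (b x)) 0 ≤ n := fun n x =>
    max_le ((truncLog_le (he0 n) _).trans_eq (by simp [he])) n.cast_nonneg
  have h_int : ∀ n, Integrable (fun x => max (truncLog (e n) (b x)) 0) μ := fun n =>
    Integrable.of_bound (hmm n).aestronglyMeasurable n (ae_of_all _ fun x => by
      rw [Real.norm_eq_abs, abs_of_nonneg (le_max_right _ _)]
      exact hle n x)
  have hbi : Integrable (fun x => ‖b x‖) μ := hb.norm.restrict
  have hTi : ∀ n, Integrable (fun x => truncLog (e n) (b x)) μ := fun n => by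
    refine ((h_int n).add hbi).mono' (hTm n).aestronglyMeasurable (ae_of_all _ fun x => ?_)
    rw [Real.norm_eq_abs, abs_le]
    have h1 := max_truncLog_sub_norm_le (he0 n) (he1 n) (b x)
    have h2 := le_max_left (truncLog (e n) (b x)) 0
    have h3 := le_max_right (truncLog (e n) (b x)) 0
    have h4 := norm_nonneg (b x)
    simp only [Pi.add_apply]
    constructor <;> linarith
  obtain ⟨n, hn⟩ : ∃ n, m + ∫ x, ‖b x‖ ∂μ < ∫ x, max (truncLog (e n) (b x)) 0 ∂μ := by
    by_contra! hcon
    set m' := m + ∫ x, ‖b x‖ ∂μ with hm'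
    have h1 : ∀ n, ∫⁻ x, ENNReal.ofReal (max (truncLog (e n) (b x)) 0) ∂μ ≤ ENNReal.ofReal m' := by
      intro n
      rw [← ofReal_integral_eq_lintegral_ofReal (h_int n) (ae_of_all _ fun x => le_max_right _ _)]
      exact ENNReal.ofReal_le_ofReal (hcon n)
    have hmono : ∀ᵐ x ∂μ, Monotone fun n => ENNReal.ofReal (max (truncLog (e n) (b x)) 0) := by
      refine ae_of_all _ fun x n k hnk => ENNReal.ofReal_le_ofReal (max_le_max_right _ ?_)
      rw [truncLog, truncLog]
      refine neg_le_neg (Real.log_le_log (lt_max_of_lt_right (he0 k)) (max_le_max_left _ ?_))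
      exact Real.exp_le_exp.2 (by simpa using hnk)
    have h2 : ∫⁻ x, ⨆ n, ENNReal.ofReal (max (truncLog (e n) (b x)) 0) ∂μ ≤ ENNReal.ofReal m' := by
      rw [lintegral_iSup' (fun n => (hmm n).ennreal_ofReal) hmono]
      exact iSup_le h1
    rcases h with h | h
    · have h3 := ae_lt_top' (AEMeasurable.iSup fun n => (hmm n).ennreal_ofReal)
        (h2.trans_lt ENNReal.ofReal_lt_top).ne
      rw [hμ, ae_restrict_iff' measurableSet_Icc] at h3
      refine h.ne' (measure_mono_null (fun x hx => ?_) h3)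
      refine fun hcon => (hcon hx.1).ne (ENNReal.eq_top_of_forall_nnreal_le fun q => ?_)
      obtain ⟨n, hn⟩ := exists_nat_ge (q : ℝ)
      refine le_trans ?_ (le_iSup _ n)
      rw [hx.2, truncLog, norm_zero, max_eq_right (he0 n).le]
      rw [← ENNReal.ofReal_coe_nnreal]
      exact ENNReal.ofReal_le_ofReal (le_max_of_le_left (by simpa [he] using hn))
    · refine (h.symm.trans_le ((lintegral_mono fun x => ?_).trans h2)).not_gt ENNReal.ofReal_lt_top
      by_cases hx : b x = 0
      · simp [hx]
      · obtain ⟨n, hn⟩ := exists_nat_ge (-Real.log ‖b x‖)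
        refine le_trans (ENNReal.ofReal_le_ofReal (max_le_max_right _ ?_))
          (le_iSup (fun n => ENNReal.ofReal (max (truncLog (e n) (b x)) 0)) n)
        rw [truncLog, max_eq_left]
        rw [he, ← Real.le_log_iff_exp_le (norm_pos_iff.2 hx)]
        linarith
  refine ⟨e n / C, div_pos (he0 n) hC0, (div_lt_one hC0).2 ((he1 n).trans_lt hC), ?_⟩
  simp_rw [truncLog_div (he0 n) hC0]
  calc m ≤ ∫ x, (max (truncLog (e n) (b x)) 0 - ‖b x‖) ∂μ := by
        rw [integral_sub (h_int n) hbi]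
        linarith
    _ ≤ _ := by
        refine integral_mono ((h_int n).sub hbi) ((integrable_const _).add (hTi n)) fun x => ?_
        have h1 := max_truncLog_sub_norm_le (he0 n) (he1 n) (b x)
        have h2 := Real.log_pos hC
        dsimp only
        linarith

namespace IsFirstIntegral

variable {a Z : ℝ × ℝ → ℂ} {K M ρ : ℝ}

/-- Near an accumulation of elliptic points, a trace with divergent logarithmic integral vanishes
near the origin. -/
theorem exists_radius_trace_eq_zero (h : IsFirstIntegral a Z K M ρ)
    (ha : ContDiffAt ℝ 1 a (0 : ℝ × ℝ)) {η : ℝ} (hη : 0 < η) {g : ℝ → ℝ} (hg0 : g 0 = 0)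
    (hg : ∀ y ∈ Ico 0 η, HasDerivAt g (a (g y, y)).re y)
    (hell : ∃ᶠ y in 𝓝[>] 0, (a (g y, y)).im ≠ 0) {r : ℝ} (hr : 0 < r) :
    ∃ δ R : ℝ, 0 < δ ∧ 0 < R ∧ R ≤ r ∧ ∀ (v : ℝ × ℝ → ℂ) (b : ℝ → ℂ) (C : ℝ) (N : Set ℝ),
      IsLocalSolution Z v b C r N → Integrable b → LogIntegralNegInf b (Ioo (-δ) δ) →
      ∀ᵐ x, x ∈ Ioo (-R) R → b x = 0 := by
  have hM := h.nonneg_bound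
  have hK := h.nonneg
  obtain ⟨σ, hσ, hσr, hMσ⟩ : ∃ σ : ℝ, 0 < σ ∧ σ ≤ r / 4 ∧ M * σ ≤ r / 40 := by
    refine ⟨r / (40 * (M + 1)), by positivity, ?_, ?_⟩
    · gcongr
      linarith
    · rw [mul_div_assoc', div_le_div_iff₀ (by positivity) (by positivity)]
      nlinarith
  obtain ⟨y₁, hy₁, hne⟩ := h.exists_forall_ne_zero ha hη hg0 hg hell
    (ε := σ / (4 * (M + 1))) (by positivity)
  have hy₁' : y₁ * (4 * (M + 1)) < σ := (lt_div_iff₀ (by positivity)).1 hy₁.2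
  have hMy : 0 ≤ M * y₁ := mul_nonneg hM hy₁.1.le
  obtain ⟨x₁, hre⟩ := (h.niceCurve y₁).surjective_re 0
  have him : (Z (x₁, y₁)).im ≠ 0 := fun him => hne x₁ (Complex.ext hre him)
  have him0 := abs_pos.2 him
  obtain ⟨R, hR, hR1, hR2⟩ : ∃ R : ℝ, 0 < R ∧ 3 * R ≤ |(Z (x₁, y₁)).im| ∧ R ≤ σ / 4 :=
    ⟨min (|(Z (x₁, y₁)).im| / 3) (σ / 4), by positivity,
      by linarith [min_le_left (|(Z (x₁, y₁)).im| / 3) (σ / 4)], min_le_right _ _⟩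
  obtain ⟨κ, hκ, hκK, hκR⟩ : ∃ κ : ℝ, 0 < κ ∧ 2 * K ≤ κ ∧ 4 ≤ κ * R :=
    ⟨2 * K + 4 / R, by positivity, by linarith [show 0 < 4 / R by positivity], by
      rw [add_mul, div_mul_cancel₀ _ hR.ne']
      linarith [mul_nonneg hK hR.le]⟩
  obtain ⟨δ, hδ, hδκ, hδr⟩ : ∃ δ : ℝ, 0 < δ ∧ δ * (240 * κ) ≤ 1 ∧ δ ≤ r / 2 :=
    ⟨min (1 / (240 * κ)) (r / 2), by positivity,
      (le_div_iff₀ (by positivity)).1 (min_le_left _ _), min_le_right _ _⟩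
  refine ⟨δ, R / 4, hδ, by positivity, by linarith, fun v b C N hv hb hlog => ?_⟩
  obtain ⟨χ, hχ, hχc, hχs, hχ1, hχ2⟩ := exists_cutoff hr
  obtain ⟨C', hC', hbound⟩ := hv.exists_norm_le h hb hχ hχc hχs hχ1 hχ2 hσr hMσ
  have hZc := h.contDiff.continuous
  have hxc := (contDiff_pdx h.contDiff).continuous
  have hχC : Continuous fun x => (χ x : ℂ) := continuous_ofReal.comp hχ.continuous
  have hχC' : HasCompactSupport fun x => (χ x : ℂ) :=
    hχc.comp_left (g := fun t : ℝ => (t : ℂ)) ofReal_zero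
  have hf : Integrable fun x => b x * χ x := integrable_mul_of_hasCompactSupport hb hχC hχC'
  set E : ℕ → ℂ → ℂ := fun n z => ∫ x, b x * χ x * pdx Z (x, 0) * gaussKer n (z - Z (x, 0)) with hE
  have hEd : ∀ n, Differentiable ℂ (E n) := by
    intro n
    refine differentiable_integral_gaussKer hχc (f := fun x => b x * χ x * pdx Z (x, 0)) ?_ ?_
      (Φ := fun x => Z (x, 0)) (by fun_prop) n
    · have := integrable_mul_of_hasCompactSupport hb (χ := fun x => χ x * pdx Z (x, 0))
        (by fun_prop) hχC'.mul_right
      simpa only [mul_assoc] using this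
    · intro x hx
      rw [image_eq_zero_of_notMem_tsupport hx, ofReal_zero, mul_zero, zero_mul]
  have hlim := (h.niceCurve 0).tendsto_integral_norm_gaussKer_sub hf R
  have hC1 : 1 < C' + 1 := by linarith
  have hlog' : ∀ m : ℝ, ∃ ε : ℝ, 0 < ε ∧ ε < 1 ∧
      m ≤ ∫ x in Icc (-δ) δ, truncLog ε (b x * χ x / (C' + 1 : ℝ)) := by
    intro m
    obtain ⟨ε, hε, hε1, hm⟩ := hlog.exists_le_integral_truncLog hb hC1 m
    refine ⟨ε, hε, hε1, hm.trans_eq (setIntegral_congr_fun measurableSet_Icc fun x hx => ?_)⟩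
    simp only [hχ2 x ((abs_le.2 hx).trans hδr), ofReal_one, mul_one]
  have hbd : ∀ n x' y', y' ∈ Icc 0 y₁ → |x'| ≤ 2 * (R + M * y₁) →
      ‖E n (Z (x', y'))‖ ≤ C' + 1 := fun n x' y' hy' hx' =>
    (hbound n x' y' (by linarith [hy₁.1]) ⟨hy'.1, by linarith [hy'.2, hy₁.1]⟩).trans (by linarith)
  have key : ∀ᵐ x, x ∈ Ioo (-(R / 4)) (R / 4) → b x * χ x = 0 := by
    rcases le_total 0 (Z (x₁, y₁)).im with hs | hs
    · rw [abs_of_nonneg hs] at hR1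
      refine (h.niceCurve 0).ae_eq_zero_of_log h.map_zero hR hκK hκR hδ hδκ (C := C' + 1)
        (by positivity) hEd (fun n x t ht hz => ?_) hf hlim hlog'
      obtain ⟨x', y', hy', hx', he⟩ := h.exists_eq_of_im_ge hy₁.1.le hre hR1 ht hz
      rw [← he]
      exact hbd n x' y' hy' hx'
    · rw [abs_of_nonpos hs] at hR1
      refine (h.niceCurve 0).ae_eq_zero_of_log_below h.map_zero hR hκK hκR hδ hδκ (C := C' + 1)
        (by positivity) hEd (fun n x t ht hz => ?_) hf hlim hlog'
      obtain ⟨x', y', hy', hx', he⟩ := h.exists_eq_of_im_le hy₁.1.le hre (by linarith) ht hz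
      rw [← he]
      exact hbd n x' y' hy' hx'
  filter_upwards [key] with x hx hxR
  have h1 := hx hxR
  rwa [hχ2 x ((abs_lt.2 hxR).le.trans (by linarith)), ofReal_one, mul_one] at h1

end IsFirstIntegral

/-- A function whose product with a nonvanishing continuous function is integrable is locally
integrable. -/
theorem integrableAtFilter_of_mul {b φ : ℝ → ℂ} {s : Set ℝ} (hφ : Continuous φ) {x₀ : ℝ}
    (hx₀ : φ x₀ ≠ 0) (h : IntegrableOn (fun x => b x * φ x) s) :
    IntegrableAtFilter b (𝓝[s] x₀) := by
  have hev : ∀ᶠ x in 𝓝 x₀, ‖φ x₀‖ / 2 < ‖φ x‖ :=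
    (hφ.norm.tendsto x₀).eventually (lt_mem_nhds (half_lt_self (norm_pos_iff.2 hx₀)))
  obtain ⟨t, ht, hto, hxt⟩ := mem_nhds_iff.1 hev
  refine ⟨s ∩ t, inter_mem_nhdsWithin _ (hto.mem_nhds hxt), ?_⟩
  have hpos : 0 < ‖φ x₀‖ / 2 := half_pos (norm_pos_iff.2 hx₀)
  have hae : ∀ᵐ x ∂volume.restrict (s ∩ t), x ∈ t := by
    have := ae_mono (Measure.restrict_mono inter_subset_right le_rfl : volume.restrict (s ∩ t) ≤
      volume.restrict t) (ae_restrict_mem hto.measurableSet)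
    exact this
  have h1 : IntegrableOn (fun x => b x * φ x * (φ x)⁻¹) (s ∩ t) := by
    refine (h.mono_set inter_subset_left).mul_bdd (c := (‖φ x₀‖ / 2)⁻¹)
      hφ.measurable.inv.aestronglyMeasurable ?_
    filter_upwards [hae] with x hx
    rw [norm_inv]
    exact inv_anti₀ hpos (ht hx).le
  refine h1.congr ?_
  filter_upwards [hae] with x hx
  exact mul_inv_cancel_right₀ (norm_pos_iff.1 (hpos.trans (ht hx))) _

/-- A weak limit of bounded functions may be represented by an integrable function, with the same
logarithmic integrals near the origin. -/
theorem exists_integrable_trace {a₀ r C : ℝ} (hr : r < a₀) {l : Filter ℝ} {w : ℝ → ℝ → ℂ}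
    (hw : ∀ᶠ y in l, Measurable (w y) ∧ ∀ x ∈ Ioo (-a₀) a₀, ‖w y x‖ ≤ C) {bu : ℝ → ℂ}
    (htr : ∀ φ : ℝ → ℂ, ContDiff ℝ (⊤ : ℕ∞) φ → HasCompactSupport φ →
      tsupport φ ⊆ Ioo (-a₀) a₀ → Tendsto (fun y => ∫ x in Ioo (-a₀) a₀, w y x * φ x) l
        (𝓝 (∫ x in Ioo (-a₀) a₀, bu x * φ x))) :
    ∃ b : ℝ → ℂ, Integrable b ∧
      (∀ φ : ℝ → ℂ, ContDiff ℝ (⊤ : ℕ∞) φ → HasCompactSupport φ → tsupport φ ⊆ Ioo (-r) r →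
        Tendsto (fun y => ∫ x in Ioo (-a₀) a₀, w y x * φ x) l (𝓝 (∫ x, b x * φ x))) ∧
      ∀ δ, 0 < δ → δ ≤ r → LogIntegralNegInf bu (Ioo (-δ) δ) →
        LogIntegralNegInf b (Ioo (-δ) δ) := by
  have hsub : Icc (-r) r ⊆ Ioo (-a₀) a₀ := fun x hx => ⟨by linarith [hx.1], by linarith [hx.2]⟩
  by_cases hloc : LocallyIntegrableOn bu (Ioo (-a₀) a₀)
  · have h_int := hloc.integrableOn_compact_subset hsub isCompact_Icc
    refine ⟨(Icc (-r) r).indicator bu, h_int.integrable_indicator measurableSet_Icc,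
      fun φ hφ hφc hφs => ?_, fun δ hδ hδr hlog => ?_⟩
    · convert htr φ hφ hφc (hφs.trans (Ioo_subset_Icc_self.trans hsub)) using 2
      rw [← integral_indicator measurableSet_Ioo]
      congr 1 with x
      by_cases hx : x ∈ Icc (-r) r
      · rw [indicator_of_mem hx, indicator_of_mem (hsub hx)]
      · have h0 : φ x = 0 := image_eq_zero_of_notMem_tsupport fun h =>
          hx (Ioo_subset_Icc_self (hφs h))
        rw [h0, mul_zero, indicator_apply]
        split_ifs <;> simp [h0]
    · have hsub' : Ioo (-δ) δ ⊆ Icc (-r) r := fun x hx => ⟨by linarith [hx.1], by linarith [hx.2]⟩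
      refine hlog.imp (fun h => ?_) fun h => ?_
      · refine h.trans_le (measure_mono fun x hx => ⟨hx.1, ?_⟩)
        rw [indicator_of_mem (hsub' hx.1)]
        exact hx.2
      · rw [← h]
        refine setLIntegral_congr_fun measurableSet_Ioo fun x hx => ?_
        simp only [indicator_of_mem (hsub' hx)]
  · obtain ⟨x₀, hx₀, hbad⟩ : ∃ x₀ ∈ Ioo (-a₀) a₀,
        ¬ IntegrableAtFilter bu (𝓝[Ioo (-a₀) a₀] x₀) := by
      simpa only [LocallyIntegrableOn, not_forall, exists_prop] using hloc
    have hzero : ∀ φ : ℝ → ℂ, Continuous φ → φ x₀ ≠ 0 →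
        ∫ x in Ioo (-a₀) a₀, bu x * φ x = 0 := fun φ hφ hφ0 =>
      integral_undef fun h => hbad (integrableAtFilter_of_mul hφ hφ0 h)
    obtain ⟨ε, hε, hεs⟩ := Metric.mem_nhds_iff.1 (Ioo_mem_nhds hx₀.1 hx₀.2)
    let β : ContDiffBump x₀ := ⟨ε / 4, ε / 2, by positivity, by linarith⟩
    have hβ1 : (β x₀ : ℂ) = 1 := by
      rw [β.one_of_mem_closedBall (Metric.mem_closedBall_self (by positivity)), ofReal_one]
    have hβs : ContDiff ℝ (⊤ : ℕ∞) fun x => (β x : ℂ) := ofRealCLM.contDiff.comp β.contDiff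
    have hβc : HasCompactSupport fun x => (β x : ℂ) :=
      β.hasCompactSupport.comp_left (g := fun t : ℝ => (t : ℂ)) ofReal_zero
    have hβt : tsupport (fun x => (β x : ℂ)) ⊆ Ioo (-a₀) a₀ := by
      refine (closure_mono fun x hx => ?_ : _ ⊆ tsupport β).trans ?_
      · exact fun h0 => hx (by simp only [h0, ofReal_zero])
      · change tsupport β ⊆ _
        rw [β.tsupport_eq]
        exact (Metric.closedBall_subset_ball (by simp only [β]; linarith)).trans hεs
    have hlim0 : ∀ φ : ℝ → ℂ, ContDiff ℝ (⊤ : ℕ∞) φ → HasCompactSupport φ →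
        tsupport φ ⊆ Ioo (-a₀) a₀ →
        Tendsto (fun y => ∫ x in Ioo (-a₀) a₀, w y x * φ x) l (𝓝 0) := by
      intro φ hφ hφc hφs
      by_cases hφ0 : φ x₀ = 0
      · have h1 := htr _ hβs hβc hβt
        have h2 := htr (φ + fun x => (β x : ℂ)) (hφ.add hβs) (hφc.add hβc)
          ((tsupport_add _ _).trans (union_subset hφs hβt))
        rw [hzero _ hβs.continuous (by simp [hβ1])] at h1
        rw [hzero (φ + fun x => (β x : ℂ)) (hφ.add hβs).continuous (by simp [hφ0, hβ1])] at h2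
        have h3 := h2.sub h1
        rw [sub_zero] at h3
        refine h3.congr' ?_
        filter_upwards [hw] with y hy
        have hi : ∀ ψ : ℝ → ℂ, Continuous ψ → HasCompactSupport ψ →
            IntegrableOn (fun x => w y x * ψ x) (Ioo (-a₀) a₀) := fun ψ hψ hψc =>
          ((hψ.integrable_of_hasCompactSupport hψc).integrableOn).bdd_mul (c := C)
            hy.1.aestronglyMeasurable
            ((ae_restrict_iff' measurableSet_Ioo).2 (ae_of_all _ hy.2))
        simp only [Pi.add_apply, mul_add]
        rw [integral_add (hi _ hφ.continuous hφc) (hi _ hβs.continuous hβc), add_sub_cancel_right]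
      · have h1 := htr φ hφ hφc hφs
        rwa [hzero φ hφ.continuous hφ0] at h1
    refine ⟨0, integrable_zero _ _ _, fun φ hφ hφc hφs => ?_, fun δ hδ _ _ => Or.inl ?_⟩
    · simpa using hlim0 φ hφ hφc (hφs.trans (Ioo_subset_Icc_self.trans hsub))
    · simp only [Pi.zero_apply, and_true, ofPred_mem_eq, Real.volume_Ioo]
      simp [hδ]

/-- Restricting a distributional solution to a small rectangle. -/
theorem IsFirstIntegral.isLocalSolution {a Z u : ℝ × ℝ → ℂ} {K M ρ a₀ b₀ C r : ℝ} {b : ℝ → ℂ}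
    {N : Set ℝ} (h : IsFirstIntegral a Z K M ρ) (hr : 0 < r) (hra : r ≤ a₀) (hrb : r ≤ b₀)
    (hrρ : r ≤ ρ) (hum : Measurable u) (hC : ∀ p ∈ Ioo (-a₀) a₀ ×ˢ Ioo 0 b₀, ‖u p‖ ≤ C)
    (hu : IsDistribSol a u (Ioo (-a₀) a₀ ×ˢ Ioo 0 b₀)) (hN : volume N = 0)
    (htr : ∀ φ : ℝ → ℂ, ContDiff ℝ (⊤ : ℕ∞) φ → HasCompactSupport φ → tsupport φ ⊆ Ioo (-r) r →
      Tendsto (fun y => ∫ x in Ioo (-a₀) a₀, u (x, y) * φ x) (𝓝[Ioo 0 b₀ \ N] 0)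
        (𝓝 (∫ x, b x * φ x))) :
    IsLocalSolution Z ((Ioo (-r) r ×ˢ Ioo 0 r).indicator u) b |C| r N where
  pos := hr
  measurable := hum.indicator (measurableSet_Ioo.prod measurableSet_Ioo)
  norm_le p := by
    by_cases hp : p ∈ Ioo (-r) r ×ˢ Ioo 0 r
    · rw [indicator_of_mem hp]
      refine (hC p ?_).trans (le_abs_self C)
      exact prod_mono (Ioo_subset_Ioo (by linarith) hra) (Ioo_subset_Ioo le_rfl hrb) hp
    · rw [indicator_of_notMem hp, norm_zero]
      exact abs_nonneg C
  eq_zero p hp := indicator_of_notMem hp u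
  weak χ θ hχ hθ hχc hθc hχs hθs H hH := by
    have hsub : Ioo (-r) r ×ˢ Ioo 0 r ⊆ Ioo (-a₀) a₀ ×ˢ Ioo 0 b₀ :=
      prod_mono (Ioo_subset_Ioo (by linarith) hra) (Ioo_subset_Ioo le_rfl hrb)
    have hts : tsupport χ ×ˢ tsupport θ ⊆ Ioo (-r) r ×ˢ Ioo 0 r := prod_mono hχs hθs
    rw [← h.integral_mul_sub_eq_zero hu hχ hθ hχc hθc (hts.trans hsub)
      (fun p hp => ?_) hH, ← integral_indicator (measurableSet_Ioo.prod measurableSet_Ioo)]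
    · congr 1 with p
      by_cases hp : p ∈ Ioo (-r) r ×ˢ Ioo 0 r
      · rw [indicator_of_mem hp, indicator_of_mem (hsub hp)]
      · have h0 : χ p.1 * deriv θ p.2 * (H (Z p) * pdx Z p) -
            deriv χ p.1 * θ p.2 * (H (Z p) * pdy Z p) = 0 := by
          have hp' : p.1 ∉ tsupport χ ∨ p.2 ∉ tsupport θ := by
            by_contra! hcon
            exact hp (hts hcon)
          rcases hp' with hp' | hp'
          · rw [image_eq_zero_of_notMem_tsupport hp', image_eq_zero_of_notMem_tsupport
              fun hq => hp' (tsupport_deriv_subset hq)]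
            simp
          · rw [image_eq_zero_of_notMem_tsupport hp', image_eq_zero_of_notMem_tsupport
              (f := deriv θ) fun hq => hp' (tsupport_deriv_subset hq)]
            simp
        simp only [indicator_apply, h0, mul_zero, ite_self]
    · have hq := hts hp
      rw [mem_ball_zero_iff, Prod.norm_def, max_lt_iff, Real.norm_eq_abs, Real.norm_eq_abs, abs_lt,
        abs_lt]
      exact ⟨⟨by linarith [hq.1.1], by linarith [hq.1.2]⟩, by linarith [hq.2.1],
        by linarith [hq.2.2]⟩
  null := hN
  trace φ hφ hφc hφs := by
    refine ((htr φ hφ hφc hφs).mono_left (nhdsWithin_mono _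
      (sdiff_subset_sdiff_left (Ioo_subset_Ioo le_rfl hrb)))).congr' ?_
    filter_upwards [self_mem_nhdsWithin] with y hy
    rw [← integral_indicator measurableSet_Ioo]
    congr 1 with x
    by_cases hx : x ∈ Ioo (-r) r
    · rw [indicator_of_mem (Ioo_subset_Ioo (by linarith) hra hx),
        indicator_of_mem (show (x, y) ∈ Ioo (-r) r ×ˢ Ioo 0 r from ⟨hx, hy.1⟩)]
    · have h0 : φ x = 0 := image_eq_zero_of_notMem_tsupport fun h => hx (hφs h)
      rw [h0, mul_zero, indicator_apply, h0]
      simp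

/-- Theorem 1.2 (first half): strong uniqueness under the hypothesis that elliptic
points on the integral curve of `X = Re L` through the origin accumulate at the
origin from `{y > 0}`. -/
theorem strong_uniqueness
    (a₀ b₀ : ℝ) (ha₀ : 0 < a₀) (hb₀ : 0 < b₀)
    (a : ℝ × ℝ → ℂ) (ha : ContDiffOn ℝ (⊤ : ℕ∞) a (Ioo (-a₀) a₀ ×ˢ Ioo (-b₀) b₀))
    (hloc : LocallyIntegrableAtOrigin a)
    -- the integral curve of `X = Re L` through the origin
    (η : ℝ) (hη : 0 < η) (g : ℝ → ℝ) (hg0 : g 0 = 0)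
    (hg : ∀ y ∈ Ico 0 η, (g y, y) ∈ Ioo (-a₀) a₀ ×ˢ Ioo (-b₀) b₀ ∧
      HasDerivAt g (a (g y, y)).re y)
    -- a sequence of elliptic points on the curve converging to the origin
    (yseq : ℕ → ℝ) (hyseq_pos : ∀ n, 0 < yseq n) (hyseq_mem : ∀ n, yseq n < η)
    (hyseq_lim : Tendsto yseq atTop (𝓝 0))
    (hyseq_ell : ∀ n, (a (g (yseq n), yseq n)).im ≠ 0) :
    ∃ δ : ℝ, 0 < δ ∧ δ < a₀ ∧
      ∀ u : ℝ × ℝ → ℂ, Measurable u →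
        (∃ C : ℝ, ∀ p ∈ Ioo (-a₀) a₀ ×ˢ Ioo 0 b₀, ‖u p‖ ≤ C) →
        IsDistribSol a u (Ioo (-a₀) a₀ ×ˢ Ioo 0 b₀) →
        ∀ bu : ℝ → ℂ, ∀ N : Set ℝ, N ⊆ Ioo 0 b₀ → volume N = 0 →
          (∀ φ : ℝ → ℂ, ContDiff ℝ (⊤ : ℕ∞) φ → HasCompactSupport φ → tsupport φ ⊆ Ioo (-a₀) a₀ →
            Tendsto (fun y => ∫ x in Ioo (-a₀) a₀, u (x, y) * φ x)
              (𝓝[Ioo 0 b₀ \ N] 0) (𝓝 (∫ x in Ioo (-a₀) a₀, bu x * φ x))) →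
          LogIntegralNegInf bu (Ioo (-δ) δ) →
          ∀ᵐ p ∂(volume.restrict (Ioo (-δ) δ ×ˢ Ioo 0 δ)), u p = 0 := by
  obtain ⟨Z, K, M, ρ, h⟩ := hloc.exists_isFirstIntegral
  have hρ := h.pos
  have hM := h.nonneg_bound
  have haC : ContDiffAt ℝ 1 a (0 : ℝ × ℝ) :=
    (ha.contDiffAt (prod_mem_nhds (Ioo_mem_nhds (by simpa using ha₀) ha₀)
      (Ioo_mem_nhds (by simpa using hb₀) hb₀))).of_le (by exact_mod_cast le_top)
  have hell : ∃ᶠ y in 𝓝[>] (0 : ℝ), (a (g y, y)).im ≠ 0 :=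
    (tendsto_nhdsWithin_iff.2 ⟨hyseq_lim, Eventually.of_forall hyseq_pos⟩).frequently
      (Frequently.of_forall hyseq_ell)
  obtain ⟨r, hr, hra, hrb, hrρ⟩ : ∃ r : ℝ, 0 < r ∧ r < a₀ ∧ r ≤ b₀ ∧ r ≤ ρ :=
    ⟨min (a₀ / 2) (min b₀ ρ), by positivity, (min_le_left _ _).trans_lt (by linarith),
      (min_le_right _ _).trans (min_le_left _ _), (min_le_right _ _).trans (min_le_right _ _)⟩
  obtain ⟨δ₁, R, hδ₁, hR, hRr, hmain⟩ :=
    h.exists_radius_trace_eq_zero haC hη hg0 (fun y hy => (hg y hy).2) hell hr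
  obtain ⟨σ, hσ, hσr, hMσ⟩ : ∃ σ : ℝ, 0 < σ ∧ σ ≤ R / 4 ∧ M * σ ≤ R / 40 := by
    refine ⟨R / (40 * (M + 1)), by positivity, ?_, ?_⟩
    · gcongr
      linarith
    · rw [mul_div_assoc', div_le_div_iff₀ (by positivity) (by positivity)]
      nlinarith
  refine ⟨min δ₁ σ, by positivity, (min_le_right _ _).trans_lt (by linarith),
    fun u hum ⟨C, hC⟩ hu bu N _ hN htr hlog => ?_⟩
  obtain ⟨b, hb, htrb, hlogb⟩ := exists_integrable_trace (C := C) hra (w := fun y x => u (x, y)) (by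
    filter_upwards [self_mem_nhdsWithin] with y hy
    exact ⟨hum.comp (measurable_id.prodMk measurable_const), fun x hx => hC _ ⟨hx, hy.1⟩⟩) htr
  have hlog' := (hlogb _ (by positivity) ((min_le_right _ _).trans (by linarith)) hlog).mono
    (Ioo_subset_Ioo (neg_le_neg (min_le_left δ₁ σ)) (min_le_left _ _))
  have hb0 := hmain _ b _ N
    (h.isLocalSolution hr hra.le hrb hrρ hum hC hu hN htrb) hb hlog'
  have hsol := h.isLocalSolution (b := 0) hR (hRr.trans hra.le) (hRr.trans hrb) (hRr.trans hrρ)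
    hum hC hu hN fun φ hφ hφc hφs => by
      have h1 := htrb φ hφ hφc (hφs.trans (Ioo_subset_Ioo (neg_le_neg hRr) hRr))
      have h2 : ∫ x, b x * φ x = ∫ x, (0 : ℝ → ℂ) x * φ x := by
        refine integral_congr_ae ?_
        filter_upwards [hb0] with x hx
        by_cases hxR : x ∈ Ioo (-R) R
        · simp [hx hxR]
        · simp [image_eq_zero_of_notMem_tsupport fun hq => hxR (hφs hq)]
      rwa [h2] at h1
  rw [ae_restrict_iff' (measurableSet_Ioo.prod measurableSet_Ioo)]
  filter_upwards [hsol.ae_eq_zero_of_trace_eq_zero h hσr hMσ] with p hp hpδ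
  have hpσ : p ∈ Ioo (-σ) σ ×ˢ Ioo 0 σ :=
    Set.prod_mono (Ioo_subset_Ioo (neg_le_neg (min_le_right _ _)) (min_le_right _ _))
      (Ioo_subset_Ioo le_rfl (min_le_right _ _)) hpδ
  have h1 := hp hpσ
  rwa [indicator_of_mem (Set.prod_mono (Ioo_subset_Ioo (by linarith) (by linarith))
    (Ioo_subset_Ioo le_rfl (by linarith)) hpσ)] at h1
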